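/- Assume n ≥ 3 and let Ψ ∈ P_dLV_k(ℝⁿ). Then Ψ is rigid motion invariant (i.e. Ψ(f∘g; g⁻¹(B)) = Ψ(f;B) for every f, every bounded Borel set B, and every map g(x) = ρx + x₀ with ρ ∈ SO(n), x₀ ∈ ℝⁿ) if and only if there exist unique constants c_{ij}, d_{ij} ∈ ℂ such that for every f ∈ Conv(ℝⁿ,ℝ) ∩ C²(ℝⁿ) and every bounded Borel set B ⊂ ℝⁿ: Ψ(f;B) = Σ_{i=0}^{min(n,k)} Σ_{j=0}^{⌊min(k−i,d)/2⌋} c_{ij} ∫_B f(x)^{k−2j−i} |∇f(x)|^{2j} D(D²f(x)[i], Id[n−i]) dx + Σ_{i=1}^{min(n−1,k)} Σ_{j=1}^{⌊min(k−i,d)/2⌋} d_{ij} ∫_B f(x)^{k−2j−i} |∇f(x)|^{2(j−1)} D(D²f(x)[i], ∇f(x)∇f(x)ᵀ[1], Id[n−i−1]) dx. -/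

import Mathlib

open scoped CompactlySupported NNReal

noncomputable section

abbrev Eucl (n : ℕ) := EuclideanSpace ℝ (Fin n)

def RadonMeasure (n : ℕ) : Submodule ℂ (C_c(Eucl n, ℂ) →ₗ[ℂ] ℂ) where
  carrier := {μ | ∀ A : Set (Eucl n), IsCompact A → ∃ C : ℝ, ∀ φ : C_c(Eucl n, ℂ),
      tsupport ⇑φ ⊆ A → (∀ x, ‖φ x‖ ≤ 1) → ‖μ φ‖ ≤ C}
  add_mem' := by
    intro μ ν hμ hν A hA
    obtain ⟨C₁, h₁⟩ := hμ A hA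
    obtain ⟨C₂, h₂⟩ := hν A hA
    refine ⟨C₁ + C₂, fun φ h h' => ?_⟩
    calc ‖(μ + ν) φ‖ = ‖μ φ + ν φ‖ := by simp
    _ ≤ ‖μ φ‖ + ‖ν φ‖ := norm_add_le _ _
    _ ≤ C₁ + C₂ := add_le_add (h₁ φ h h') (h₂ φ h h')
  zero_mem' := fun _ _ => ⟨0, fun φ _ _ => by simp⟩
  smul_mem' := by
    intro c μ hμ A hA
    obtain ⟨C, h⟩ := hμ A hA
    refine ⟨‖c‖ * C, fun φ hs hb => ?_⟩
    simp only [LinearMap.smul_apply, norm_smul]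
    exact mul_le_mul_of_nonneg_left (h φ hs hb) (norm_nonneg c)

abbrev ConvFn (n : ℕ) := {f : C(Eucl n, ℝ) // ConvexOn ℝ Set.univ ⇑f}

def IsLocalFunctional {n : ℕ} (Ψ : ConvFn n → RadonMeasure n) : Prop :=
  ∀ (f h : ConvFn n) (U : Set (Eucl n)), IsOpen U → (∀ x ∈ U, f.1 x = h.1 x) →
    ∀ φ : C_c(Eucl n, ℂ), tsupport ⇑φ ⊆ U → (Ψ f).1 φ = (Ψ h).1 φ

def IsContinuousFunctional {n : ℕ} (Ψ : ConvFn n → RadonMeasure n) : Prop :=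
  ∀ φ : C_c(Eucl n, ℂ), Continuous fun f : ConvFn n => (Ψ f).1 φ

lemma convexOn_affine {n : ℕ} (s : ℝ) (v : Eucl n) :
    ConvexOn ℝ Set.univ (fun x : Eucl n => s + inner ℝ v x) := by
  refine ⟨convex_univ, fun x _ y _ a b _ _ hab => le_of_eq ?_⟩
  simp only [smul_eq_mul, inner_add_right, real_inner_smul_right]
  linear_combination s * hab.symm

/-- Add the affine function `ℓ(x) = s + ⟨v, x⟩` to a convex function. -/
def addAffine {n : ℕ} (f : ConvFn n) (s : ℝ) (v : Eucl n) : ConvFn n :=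
  ⟨⟨fun x => f.1 x + (s + inner ℝ v x),
    (map_continuous f.1).add (continuous_const.add (Continuous.inner continuous_const continuous_id))⟩,
    f.2.add (convexOn_affine s v)⟩

/-- `Ψ` is polynomial of degree at most `d`: for every `f` and `φ`, the map
`(s, v) ↦ Ψ(f + s + ⟨v, ·⟩)(φ)` is (the restriction of) a polynomial of degree at most `d`
on `ℝ × ℝⁿ`. -/
def IsPolynomialDeg {n : ℕ} (d : ℕ) (Ψ : ConvFn n → RadonMeasure n) : Prop :=
  ∀ (f : ConvFn n) (φ : C_c(Eucl n, ℂ)), ∃ P : MvPolynomial (Fin (n + 1)) ℂ,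
    P.totalDegree ≤ d ∧ ∀ (s : ℝ) (v : Eucl n),
      (Ψ (addAffine f s v)).1 φ = MvPolynomial.eval (Fin.cons (s : ℂ) fun i => (v i : ℂ)) P

/-- `P_dLV(ℝⁿ)`: continuous local functionals, polynomial of degree at most `d`. -/
def MemPdLV {n : ℕ} (d : ℕ) (Ψ : ConvFn n → RadonMeasure n) : Prop :=
  IsLocalFunctional Ψ ∧ IsContinuousFunctional Ψ ∧ IsPolynomialDeg d Ψ

/-- Multiply a convex function by a nonnegative scalar `t ≥ 0`. -/
def smulConv {n : ℕ} (t : ℝ≥0) (f : ConvFn n) : ConvFn n :=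
  ⟨(t : ℝ) • f.1, by exact f.2.smul t.2⟩

/-- `Ψ` is homogeneous of degree `k`: `Ψ(t f) = t^k Ψ(f)` for `t ≥ 0`. -/
def IsHomogeneousDeg {n : ℕ} (k : ℕ) (Ψ : ConvFn n → RadonMeasure n) : Prop :=
  ∀ (f : ConvFn n) (t : ℝ≥0), Ψ (smulConv t f) = ((t : ℝ) : ℂ) ^ k • Ψ f

open MeasureTheory

/-- The gradient `∇f(x)` of `f : ℝⁿ → ℝ`, in coordinates. -/
def gradVec {n : ℕ} (f : Eucl n → ℝ) (x : Eucl n) : Fin n → ℝ :=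
  fun i => fderiv ℝ f x (EuclideanSpace.single i 1)

/-- The Hessian matrix `D²f(x)` of `f : ℝⁿ → ℝ`. -/
def hessMat {n : ℕ} (f : Eucl n → ℝ) (x : Eucl n) : Matrix (Fin n) (Fin n) ℝ :=
  Matrix.of fun i j =>
    fderiv ℝ (fun y => fderiv ℝ f y (EuclideanSpace.single j 1)) x (EuclideanSpace.single i 1)

/-- The mixed discriminant `D(A₁, …, Aₙ) = (1/n!) ∂ⁿ/∂λ₁⋯∂λₙ det(λ₁A₁ + ⋯ + λₙAₙ)` of `n`
matrices, via its standard expansion over permutations. -/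
def mixedDisc {n : ℕ} (A : Fin n → Matrix (Fin n) (Fin n) ℝ) : ℝ :=
  ((n.factorial : ℝ))⁻¹ * ∑ σ : Equiv.Perm (Fin n), (Matrix.of fun i j => A (σ i) i j).det

/-- The affine map `x ↦ L x + b`. -/
def affOf {n : ℕ} (L : Eucl n →ₗ[ℝ] Eucl n) (b : Eucl n) : Eucl n →ᵃ[ℝ] Eucl n where
  toFun := fun x => L x + b
  linear := L
  map_vadd' := by intro p v; simp [map_add, add_assoc]

/-- The composition `f ∘ g` of a convex function with the rigid motion `g(x) = ρ x + x₀`. -/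
def rigidComp {n : ℕ} (ρ : Eucl n ≃ₗᵢ[ℝ] Eucl n) (x₀ : Eucl n) (f : ConvFn n) : ConvFn n :=
  ⟨⟨fun x => f.1 (ρ x + x₀), (map_continuous f.1).comp (by continuity)⟩, by
    have h := f.2.comp_affineMap (affOf (ρ.toLinearEquiv : Eucl n →ₗ[ℝ] Eucl n) x₀)
    simp only [Set.preimage_univ] at h
    exact h⟩

/-- The composition `φ ∘ g` of a test function with the rigid motion `g(x) = ρ x + x₀`. -/
def rigidCompCc {n : ℕ} (ρ : Eucl n ≃ₗᵢ[ℝ] Eucl n) (x₀ : Eucl n) (φ : C_c(Eucl n, ℂ)) :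
    C_c(Eucl n, ℂ) :=
  ⟨⟨fun x => φ (ρ x + x₀), φ.continuous.comp (by continuity)⟩,
    φ.hasCompactSupport'.comp_homeomorph (ρ.toHomeomorph.trans (Homeomorph.addRight x₀))⟩

/-- `Ψ` is rigid motion invariant: `Ψ(f ∘ g; g⁻¹(B)) = Ψ(f; B)` for every rigid motion
`g(x) = ρ x + x₀`, `ρ ∈ SO(n)` (a linear isometry of determinant `1`); in terms of test
functions, `Ψ(f ∘ g)(φ ∘ g) = Ψ(f)(φ)`. -/
def IsRigidMotionInvariant {n : ℕ} (Ψ : ConvFn n → RadonMeasure n) : Prop :=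
  ∀ ρ : Eucl n ≃ₗᵢ[ℝ] Eucl n, LinearMap.det (ρ.toLinearEquiv : Eucl n →ₗ[ℝ] Eucl n) = 1 →
    ∀ (x₀ : Eucl n) (f : ConvFn n) (φ : C_c(Eucl n, ℂ)),
      (Ψ (rigidComp ρ x₀ f)).1 (rigidCompCc ρ x₀ φ) = (Ψ f).1 φ

/-- The functional `E^{a,b}_c` tested against `φ`:
`∫ φ(x) f(x)^a |∇f(x)|^{2b} D(D²f(x)[c], Id[n−c]) dx`. -/
def Efun {n : ℕ} (a b c : ℕ) (f : Eucl n → ℝ) (φ : C_c(Eucl n, ℂ)) : ℂ :=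
  ∫ x, φ x * (((f x ^ a * (∑ t, gradVec f x t ^ 2) ^ b *
    mixedDisc (fun t : Fin n => if (t : ℕ) < c then hessMat f x else 1)) : ℝ) : ℂ) ∂(volume)

/-- The functional `F^{a,b}_c` tested against `φ`:
`∫ φ(x) f(x)^a |∇f(x)|^{2(b−1)} D(D²f(x)[c], ∇f(x)∇f(x)ᵀ[1], Id[n−c−1]) dx`. -/
def Ffun {n : ℕ} (a b c : ℕ) (f : Eucl n → ℝ) (φ : C_c(Eucl n, ℂ)) : ℂ :=
  ∫ x, φ x * (((f x ^ a * (∑ t, gradVec f x t ^ 2) ^ (b - 1) *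
    mixedDisc (fun t : Fin n =>
      if (t : ℕ) < c then hessMat f x
      else if (t : ℕ) < c + 1 then Matrix.vecMulVec (gradVec f x) (gradVec f x)
      else 1)) : ℝ) : ℂ) ∂(volume)

section aux
open Finset (sum_congr range mul_sum univ sum_add_distrib mem_powerset sum_mul mem_Icc mem_range sum_subset sum_eq_zero mem_map_equiv mem_powersetCard sum_nonneg sum_comm sum_sub_distrib mem_filter card_pos powersetCard prod_congr sum_add_sum_compl prod_eq_zero card_eq_zero sum_eq_single mem_compl sum_eq_single_of_mem subset_univ)
open EuclideanSpace (single inner_single_left real_norm_sq_eq proj inner_single_right basisFun)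
open Real (cos norm_of_nonneg sin dist_eq norm_eq_abs neg_one_le_cos)
open MvPolynomial (eval aeval totalDegree_finsetSum_le)
open Function (update)
open Metric (ball closedBall isClosed_closedBall mem_ball ball_mem_nhds isOpen_ball)
open Equiv (Perm swap symm_swap swap_apply_of_ne_of_ne)
open Complex (norm_real ofReal_pow)
open Set (mem_univ Icc mem_ofPred_eq indicator_of_mem infinite_range_of_injective indicator_of_notMem indicator_nonneg)
open Matrix (of_apply transpose_apply det_apply' diagonal_apply)
open Nat (cast_nonneg hyperfilter_le_atTop)
open ContinuousLinearMap (id_apply integral_comp_comm comp_apply)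
open Polynomial (monomial)
open Filter Topology
open scoped BoundedContinuousFunction
local notation "⟪" x ", " y "⟫" => inner ℝ x y

section
abbrev Cc (n : ℕ) := C_c(Eucl n, ℂ)

lemma cc_ext {n : ℕ} {φ ψ : Cc n} (h : ∀ x, φ x = ψ x) : φ = ψ := DFunLike.ext _ _ h

lemma tsupp_of_zero {n : ℕ} {R : ℝ} {φ : Eucl n → ℂ} (h : ∀ x, R < ‖x‖ → φ x = 0) :
    tsupport φ ⊆ closedBall 0 R := by
  refine closure_minimal (fun x hx => ?_) isClosed_closedBall
  rw [mem_closedBall_zero_iff]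
  by_contra hc
  exact hx (h x (not_le.mp hc))

def ccMk {n : ℕ} (φ : Eucl n → ℂ) (hc : Continuous φ) (R : ℝ) (h : ∀ x, R < ‖x‖ → φ x = 0) :
    Cc n :=
  ⟨⟨φ, hc⟩, HasCompactSupport.of_support_subset_isCompact (isCompact_closedBall 0 R)
    ((subset_tsupport _).trans (tsupp_of_zero h))⟩

@[simp] lemma ccMk_apply {n : ℕ} (φ : Eucl n → ℂ) (hc : Continuous φ) (R : ℝ)
    (h : ∀ x, R < ‖x‖ → φ x = 0) (x : Eucl n) : ccMk φ hc R h x = φ x := rfl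

lemma cc_supp {n : ℕ} (φ : Cc n) : ∃ R : ℝ, 0 < R ∧ ∀ x, R < ‖x‖ → φ x = 0 := by
  obtain ⟨R, hR⟩ := φ.hasCompactSupport'.isCompact.isBounded.subset_closedBall 0
  refine ⟨max R 1, by positivity, fun x hx => ?_⟩
  by_contra hc
  have := hR (subset_tsupport _ hc)
  rw [mem_closedBall_zero_iff] at this
  exact absurd (lt_of_le_of_lt (le_max_left _ _) hx) (not_lt.mpr this)

lemma cc_bdd {n : ℕ} (φ : Cc n) : ∃ M : ℝ, 0 ≤ M ∧ ∀ x, ‖φ x‖ ≤ M := by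
  obtain ⟨C, hC⟩ := φ.hasCompactSupport'.exists_bound_of_continuous φ.continuous
  exact ⟨max C 0, le_max_right _ _, fun x => (hC x).trans (le_max_left _ _)⟩

lemma radon_bound {n : ℕ} (μ : RadonMeasure n) {A : Set (Eucl n)} (hA : IsCompact A) :
    ∃ C : ℝ, 0 ≤ C ∧ ∀ (φ : Cc n) (M : ℝ), 0 ≤ M → tsupport ⇑φ ⊆ A → (∀ x, ‖φ x‖ ≤ M) →
      ‖μ.1 φ‖ ≤ C * M := by
  obtain ⟨C, hC⟩ := μ.2 A hA
  refine ⟨max C 0, le_max_right _ _, fun φ M hM hs hb => ?_⟩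
  rcases hM.eq_or_lt with h0 | hpos
  · have : φ = 0 := cc_ext fun x => by
      have := hb x; rw [← h0] at this; simpa using this
    simp [this, ← h0]
  · have h1 := hC ((M : ℂ)⁻¹ • φ) ((closure_mono (by
      intro x hx hc; apply hx; simp [hc])).trans hs) (fun x => by
        have : ((M : ℂ)⁻¹ • φ) x = (M : ℂ)⁻¹ * φ x := rfl
        rw [this, norm_mul, norm_inv, norm_real, norm_of_nonneg hM]
        rw [inv_mul_le_iff₀ hpos]; simpa using hb x)
    rw [map_smul, norm_smul, norm_inv, norm_real, norm_of_nonneg hM,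
      inv_mul_le_iff₀ hpos] at h1
    rw [mul_comm]
    exact h1.trans (mul_le_mul_of_nonneg_left (le_max_left _ _) hM)

def mulCc {n : ℕ} (χ : Cc n) (ψ : Eucl n →ᵇ ℂ) : Cc n :=
  ⟨⟨fun x => χ x * ψ x, χ.continuous.mul ψ.continuous⟩, χ.hasCompactSupport'.mul_right⟩

lemma mulCc_apply {n : ℕ} (χ : Cc n) (ψ : Eucl n →ᵇ ℂ) (x : Eucl n) :
    mulCc χ ψ x = χ x * ψ x := rfl

def cutF {n : ℕ} (χ : Cc n) (μ : RadonMeasure n) : (Eucl n →ᵇ ℂ) →L[ℂ] ℂ :=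
  LinearMap.mkContinuousOfExistsBound
    { toFun := fun ψ => μ.1 (mulCc χ ψ)
      map_add' := fun a b => by
        rw [← map_add]; congr 1; apply cc_ext; intro x
        simp [mulCc_apply, mul_add]
      map_smul' := fun c a => by
        rw [RingHom.id_apply, ← map_smul]; congr 1; apply cc_ext; intro x
        simp only [mulCc_apply, BoundedContinuousFunction.coe_smul,
          CompactlySupportedContinuousMap.coe_smul, Pi.smul_apply, smul_eq_mul]; ring }
    (by
      obtain ⟨C, hC0, hC⟩ := radon_bound μ χ.hasCompactSupport'.isCompact
      obtain ⟨M, hM0, hM⟩ := cc_bdd χ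
      refine ⟨C * M, fun ψ => ?_⟩
      have := hC (mulCc χ ψ) (M * ‖ψ‖) (by positivity) (closure_mono (by
        intro x hx hc; apply hx; have hc' : χ x = 0 := hc; rw [mulCc_apply, hc', zero_mul])) (fun x => by
          rw [mulCc_apply, norm_mul]
          exact mul_le_mul (hM x) (ψ.norm_coe_le_norm x) (norm_nonneg _) hM0)
      simpa [mul_assoc] using this)

lemma cutF_apply {n : ℕ} (χ : Cc n) (μ : RadonMeasure n) (ψ : Eucl n →ᵇ ℂ) :
    cutF χ μ ψ = μ.1 (mulCc χ ψ) := rfl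

def cutR (n : ℕ) (R : ℝ) : Cc n :=
  ccMk (fun x => ((max 0 (min 1 (R + 1 - ‖x‖)) : ℝ) : ℂ)) (by fun_prop) (R + 1) (fun x hx => by
    rw [max_eq_left]; · simp
    exact (min_le_right _ _).trans (by linarith))

lemma cutR_one {n : ℕ} {R : ℝ} {x : Eucl n} (h : ‖x‖ ≤ R) : cutR n R x = 1 := by
  show ((max 0 (min 1 (R + 1 - ‖x‖)) : ℝ) : ℂ) = 1
  rw [min_eq_left (by linarith)]; simp

def toB {n : ℕ} (φ : Cc n) : Eucl n →ᵇ ℂ :=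
  BoundedContinuousFunction.ofNormedAddCommGroup φ φ.continuous (cc_bdd φ).choose
    (cc_bdd φ).choose_spec.2

@[simp] lemma toB_apply {n : ℕ} (φ : Cc n) (x : Eucl n) : toB φ x = φ x := rfl

lemma cutF_toB {n : ℕ} (R : ℝ) (μ : RadonMeasure n) (φ : Cc n) (h : ∀ x, R < ‖x‖ → φ x = 0) :
    cutF (cutR n R) μ (toB φ) = μ.1 φ := by
  rw [cutF_apply]; congr 1; apply cc_ext; intro x
  rw [mulCc_apply, toB_apply]
  rcases le_or_gt ‖x‖ R with hx | hx
  · rw [cutR_one hx, one_mul]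
  · rw [h x hx, mul_zero]

lemma radon_ub {n : ℕ} {ι : Type*} (μ : ι → RadonMeasure n)
    (h : ∀ φ : Cc n, ∃ C, ∀ i, ‖(μ i).1 φ‖ ≤ C) (R : ℝ) :
    ∃ C : ℝ, 0 ≤ C ∧ ∀ i (φ : Cc n) (M : ℝ), 0 ≤ M → (∀ x, ‖φ x‖ ≤ M) →
      (∀ x, R < ‖x‖ → φ x = 0) → ‖(μ i).1 φ‖ ≤ C * M := by
  obtain ⟨C, hC⟩ := banach_steinhaus (g := fun i => cutF (cutR n R) (μ i)) (fun ψ => h _)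
  refine ⟨max C 0, le_max_right _ _, fun i φ M hM hb hs => ?_⟩
  rw [← cutF_toB R (μ i) φ hs]
  refine (ContinuousLinearMap.le_opNorm _ _).trans ?_
  exact mul_le_mul ((hC i).trans (le_max_left _ _))
    ((BoundedContinuousFunction.norm_le hM).2 hb) (norm_nonneg _) (le_max_right _ _)

lemma bdd_of_tendsto {u : ℕ → ℂ} {a : ℂ} (h : Tendsto u atTop (𝓝 a)) : ∃ C, ∀ i, ‖u i‖ ≤ C := by
  obtain ⟨C, hC⟩ := (Metric.isBounded_range_of_tendsto u h).exists_norm_le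
  exact ⟨C, fun i => hC _ ⟨i, rfl⟩⟩

lemma conv_ub {n : ℕ} {Ψ : ConvFn n → RadonMeasure n} (hc : IsContinuousFunctional Ψ)
    {f : ℕ → ConvFn n} {f0 : ConvFn n} (hf : Tendsto f atTop (𝓝 f0)) (R : ℝ) :
    ∃ C : ℝ, 0 ≤ C ∧ ∀ i (φ : Cc n) (M : ℝ), 0 ≤ M → (∀ x, ‖φ x‖ ≤ M) →
      (∀ x, R < ‖x‖ → φ x = 0) → ‖(Ψ (f i)).1 φ‖ ≤ C * M :=
  radon_ub _ (fun φ => bdd_of_tendsto (((hc φ).tendsto f0).comp hf)) R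

lemma conv_tendsto {n : ℕ} {Ψ : ConvFn n → RadonMeasure n} (hc : IsContinuousFunctional Ψ)
    {f : ℕ → ConvFn n} {f0 : ConvFn n} (hf : Tendsto f atTop (𝓝 f0)) (R : ℝ)
    {φ : ℕ → Cc n} {φ0 : Cc n} {e : ℕ → ℝ} (he : Tendsto e atTop (𝓝 0))
    (hφ : ∀ i x, ‖φ i x - φ0 x‖ ≤ e i) (hs : ∀ i x, R < ‖x‖ → φ i x = 0)
    (hs0 : ∀ x, R < ‖x‖ → φ0 x = 0) :
    Tendsto (fun i => (Ψ (f i)).1 (φ i)) atTop (𝓝 ((Ψ f0).1 φ0)) := by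
  obtain ⟨C, hC0, hC⟩ := conv_ub hc hf R
  have h1 : Tendsto (fun i => (Ψ (f i)).1 φ0) atTop (𝓝 ((Ψ f0).1 φ0)) :=
    ((hc φ0).tendsto f0).comp hf
  have h2 : Tendsto (fun i => (Ψ (f i)).1 (φ i - φ0)) atTop (𝓝 0) := by
    refine squeeze_zero_norm (a := fun i => C * e i) (fun i => ?_) (by simpa using he.const_mul C)
    exact hC i _ _ ((norm_nonneg _).trans (hφ i 0)) (hφ i)
      (fun x hx => by simp [hs i x hx, hs0 x hx])
  have := h1.add h2
  simpa using this

/-- translate of a bump as an element of `E →ᵇ ℂ` -/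
def trB {n : ℕ} (κ : Cc n) (a : Eucl n) : Eucl n →ᵇ ℂ :=
  BoundedContinuousFunction.ofNormedAddCommGroup (fun x => κ (x - a))
    (κ.continuous.comp (by fun_prop)) (cc_bdd κ).choose (fun x => (cc_bdd κ).choose_spec.2 _)

lemma trB_apply {n : ℕ} (κ : Cc n) (a x : Eucl n) : trB κ a x = κ (x - a) := rfl

lemma trB_cont {n : ℕ} (κ : Cc n) : Continuous (trB κ) := by
  have hu : UniformContinuous κ :=
    κ.hasCompactSupport'.uniformContinuous_of_continuous κ.continuous
  rw [Metric.continuous_iff]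
  intro b ε hε
  obtain ⟨δ, hδ, h⟩ := Metric.uniformContinuous_iff.1 hu (ε / 2) (by positivity)
  refine ⟨δ, hδ, fun a ha => ?_⟩
  have hle : dist (trB κ a) (trB κ b) ≤ ε / 2 := by
    refine (BoundedContinuousFunction.dist_le (by positivity)).2 fun x => ?_
    rw [trB_apply, trB_apply]
    refine (h ?_).le
    rw [dist_eq_norm] at ha ⊢
    rw [show x - a - (x - b) = -(a - b) by abel, norm_neg]; exact ha
  linarith

/-- test function `κ(· - a)` -/
def trCc {n : ℕ} (κ : Cc n) (a : Eucl n) : Cc n :=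
  ⟨⟨fun x => κ (x - a), κ.continuous.comp (by fun_prop)⟩,
    κ.hasCompactSupport'.comp_homeomorph (Homeomorph.subRight a)⟩

@[simp] lemma trCc_apply {n : ℕ} (κ : Cc n) (a x : Eucl n) : trCc κ a x = κ (x - a) := rfl

lemma radon_tr_cont {n : ℕ} (μ : RadonMeasure n) (κ : Cc n) :
    Continuous fun a => μ.1 (trCc κ a) := by
  obtain ⟨r, hr, hκ⟩ := cc_supp κ
  rw [continuous_iff_continuousAt]
  intro b
  have h1 : ContinuousAt (fun a => cutF (cutR n (‖b‖ + 1 + r)) μ (trB κ a)) b :=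
    ((ContinuousLinearMap.continuous _).comp (trB_cont κ)).continuousAt
  refine h1.congr ?_
  filter_upwards [ball_mem_nhds b one_pos] with a ha
  have : trB κ a = toB (trCc κ a) := by ext x; rfl
  rw [this]
  apply cutF_toB
  intro x hx
  apply hκ
  have h2 : ‖a‖ < ‖b‖ + 1 := by
    rw [mem_ball, dist_eq_norm] at ha
    have := norm_sub_norm_le a b; linarith
  have := norm_sub_norm_le x a; linarith

lemma radon_integral {n : ℕ} (μ : RadonMeasure n) (κ φ : Cc n) (w : Eucl n → ℂ)
    (hw : Integrable w) {R : ℝ} (hwR : ∀ x, R < ‖x‖ → w x = 0)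
    (hφ : ∀ x, φ x = ∫ a, w a * κ (x - a)) :
    μ.1 φ = ∫ a, w a * μ.1 (trCc κ a) := by
  obtain ⟨r, hr, hκ⟩ := cc_supp κ
  obtain ⟨M, hM0, hM⟩ := cc_bdd κ
  have hκz : ∀ a x : Eucl n, ‖a‖ ≤ R → R + r < ‖x‖ → κ (x - a) = 0 := fun a x ha hx => hκ _ (by
    have := norm_sub_norm_le x a; linarith)
  have hwk : ∀ a x : Eucl n, R + r < ‖x‖ → w a * κ (x - a) = 0 := fun a x hx => by
    rcases le_or_gt ‖a‖ R with h | h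
    · rw [hκz a x h hx, mul_zero]
    · rw [hwR a h, zero_mul]
  have hint : Integrable (fun a => w a • trB κ a) := by
    refine Integrable.mono' (hw.norm.mul_const M)
      (hw.aestronglyMeasurable.smul (trB_cont κ).aestronglyMeasurable) (ae_of_all _ fun a => ?_)
    rw [norm_smul]
    exact mul_le_mul_of_nonneg_left ((BoundedContinuousFunction.norm_le hM0).2 fun x => hM _)
      (norm_nonneg _)
  have h1 : (∫ a, w a • trB κ a) = toB φ := by
    ext x
    have := integral_comp_comm (BoundedContinuousFunction.evalCLM ℂ x) hint
    simp only [BoundedContinuousFunction.evalCLM_apply] at this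
    rw [← this, toB_apply, hφ]
    rfl
  rw [← cutF_toB (R + r) μ φ (fun x hx => by
    rw [hφ]; simp [hwk _ x hx]), ← h1, ← integral_comp_comm _ hint]
  congr 1; ext a
  rw [map_smul, smul_eq_mul]
  rcases le_or_gt ‖a‖ R with h | h
  · rw [← cutF_toB (R + r) μ (trCc κ a) (fun x hx => hκz a x h hx)]
    congr 2
  · rw [hwR a h, zero_mul, zero_mul]
end

section
lemma conv_ext {n : ℕ} {f g : ConvFn n} (h : ∀ x, f.1 x = g.1 x) : f = g :=
  Subtype.ext (ContinuousMap.ext h)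

lemma conv_tendsto_of {n : ℕ} {ι : Type*} {l : Filter ι} {f : ι → ConvFn n} {g : ConvFn n}
    (h : ∀ R : ℝ, 0 < R → ∀ ε : ℝ, 0 < ε → ∀ᶠ j in l, ∀ x, ‖x‖ ≤ R → |(f j).1 x - g.1 x| ≤ ε) :
    Tendsto f l (𝓝 g) := by
  rw [tendsto_subtype_rng, ContinuousMap.tendsto_iff_forall_isCompact_tendstoUniformlyOn]
  intro K hK
  obtain ⟨R, hR⟩ := hK.isBounded.subset_closedBall 0
  rw [Metric.tendstoUniformlyOn_iff]
  intro ε hε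
  filter_upwards [h (max R 1) (by positivity) (ε / 2) (by positivity)] with j hj x hx
  have h1 := hR hx
  rw [mem_closedBall_zero_iff] at h1
  rw [dist_comm, dist_eq]
  exact lt_of_le_of_lt (hj x (h1.trans (le_max_left _ _))) (by linarith)

/-- translate: `x ↦ f (x - a)` -/
def trF {n : ℕ} (f : ConvFn n) (a : Eucl n) : ConvFn n :=
  rigidComp (LinearIsometryEquiv.refl ℝ _) (-a) f

lemma trF_apply {n : ℕ} (f : ConvFn n) (a x : Eucl n) : (trF f a).1 x = f.1 (x - a) := by
  show f.1 (x + -a) = _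
  rw [sub_eq_add_neg]

lemma addAffine_apply {n : ℕ} (f : ConvFn n) (s : ℝ) (v x : Eucl n) :
    (addAffine f s v).1 x = f.1 x + (s + ⟪v, x⟫) := rfl

def TrInv {n : ℕ} (Ψ : ConvFn n → RadonMeasure n) : Prop :=
  ∀ (a : Eucl n) (f : ConvFn n) (φ : Cc n), (Ψ (trF f a)).1 (trCc φ a) = (Ψ f).1 φ

lemma trInv_of_rigid {n : ℕ} {Ψ : ConvFn n → RadonMeasure n} (h : IsRigidMotionInvariant Ψ) :
    TrInv Ψ := by
  intro a f φ
  rw [← h (LinearIsometryEquiv.refl ℝ _) (by simp) (-a) f φ]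
  show (Ψ (trF f a)).1 (trCc φ a) = (Ψ (trF f a)).1 _
  congr 1

/-- symmetric positive semidefinite operators -/
def IsP {n : ℕ} (A : Eucl n →L[ℝ] Eucl n) : Prop :=
  (∀ x y, ⟪A x, y⟫ = ⟪A y, x⟫) ∧ ∀ x, 0 ≤ ⟪A x, x⟫

def quadF {n : ℕ} (A : Eucl n →L[ℝ] Eucl n) (x : Eucl n) : ℝ := ⟪A x, x⟫ / 2

lemma quadF_sub {n : ℕ} {A : Eucl n →L[ℝ] Eucl n} (hA : IsP A) (x z : Eucl n) :
    quadF A (x - z) = quadF A x - ⟪A z, x⟫ + quadF A z := by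
  simp only [quadF, map_sub, inner_sub_left, inner_sub_right, hA.1 x z]; ring

lemma quadF_smul {n : ℕ} (A : Eucl n →L[ℝ] Eucl n) (t : ℝ) (x : Eucl n) :
    quadF A (t • x) = t ^ 2 * quadF A x := by
  simp only [quadF, map_smul, inner_smul_left, inner_smul_right]; simp; ring

lemma quadF_cont {n : ℕ} (A : Eucl n →L[ℝ] Eucl n) : Continuous (quadF A) := by
  unfold quadF; fun_prop

lemma quadF_convex {n : ℕ} {A : Eucl n →L[ℝ] Eucl n} (hA : IsP A) :
    ConvexOn ℝ Set.univ (quadF A) := by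
  refine ⟨convex_univ, fun x _ y _ a b ha hb hab => ?_⟩
  have h1 := mul_nonneg (mul_nonneg ha hb) (hA.2 (x - y))
  simp only [quadF, map_add, map_sub, map_smul, inner_sub_left, inner_sub_right, inner_add_left,
    inner_add_right, real_inner_smul_left, real_inner_smul_right, hA.1 x y, smul_eq_mul] at h1 ⊢
  have hb' : b = 1 - a := by linarith
  subst hb'
  nlinarith

def qd {n : ℕ} (A : {A : Eucl n →L[ℝ] Eucl n // IsP A}) : ConvFn n :=
  ⟨⟨quadF A.1, quadF_cont _⟩, quadF_convex A.2⟩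

lemma qd_apply {n : ℕ} (A : {A : Eucl n →L[ℝ] Eucl n // IsP A}) (x : Eucl n) :
    (qd A).1 x = quadF A.1 x := rfl

lemma conv_max {n : ℕ} (f g : ConvFn n) : ∃ h : ConvFn n, ∀ x, h.1 x = max (f.1 x) (g.1 x) :=
  ⟨⟨f.1 ⊔ g.1, by
    have := f.2.sup g.2
    exact this⟩, fun x => rfl⟩

/-- points on segment -/
lemma glue_aux {n : ℕ} {g O : Eucl n → ℝ} (hO : ConvexOn ℝ Set.univ O) {R1 R2 : ℝ}
    (h12 : R1 < R2)
    (h : ∀ x, R1 ≤ ‖x‖ → ‖x‖ ≤ R2 → g x ≤ O x) {p y : Eucl n} (hp : ‖p‖ < R1)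
    {Lp Ly : ℝ} (hLy : O y ≤ Ly) (hLy' : ‖y‖ ≤ R2 → g y ≤ Ly) (hLp : O p ≤ Lp) :
    ∃ t : ℝ, 0 < t ∧ t ≤ 1 ∧ g (p + t • (y - p)) ≤ (1 - t) * Lp + t * Ly := by
  rcases le_or_gt ‖y‖ R2 with hy | hy
  · exact ⟨1, one_pos, le_rfl, by simpa using hLy' hy⟩
  · have hc : ContinuousOn (fun t : ℝ => ‖p + t • (y - p)‖) (Icc 0 1) := by fun_prop
    have := intermediate_value_Icc (zero_le_one) hc
    obtain ⟨t, ht, hte⟩ := this (show R1 ∈ _ by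
      simp only [zero_smul, add_zero, one_smul, add_sub_cancel]; exact ⟨hp.le, by linarith⟩)
    simp only at hte
    refine ⟨t, lt_of_le_of_ne ht.1 ?_, ht.2, ?_⟩
    · rintro rfl; simp at hte; linarith
    · refine (h _ hte.ge (by rw [hte]; exact h12.le)).trans ?_
      have h1 := hO.2 (mem_univ p) (mem_univ y) (sub_nonneg.2 ht.2) ht.1 (by ring)
      rw [show p + t • (y - p) = (1 - t) • p + t • y by module]
      refine h1.trans ?_
      simp only [smul_eq_mul]
      have := mul_le_mul_of_nonneg_left hLy ht.1
      have := mul_le_mul_of_nonneg_left hLp (sub_nonneg.2 ht.2)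
      linarith

lemma glue {n : ℕ} (g O : ConvFn n) {R1 R2 : ℝ} (h12 : R1 < R2)
    (h : ∀ x, R1 ≤ ‖x‖ → ‖x‖ ≤ R2 → g.1 x ≤ O.1 x) :
    ∃ G : ConvFn n, (∀ x, ‖x‖ ≤ R2 → G.1 x = max (O.1 x) (g.1 x)) ∧
      (∀ x, R1 ≤ ‖x‖ → G.1 x = O.1 x) := by
  let F : Eucl n → ℝ := fun x => if ‖x‖ ≤ R2 then max (O.1 x) (g.1 x) else O.1 x
  have hF1 : ∀ x, ‖x‖ ≤ R2 → F x = max (O.1 x) (g.1 x) := fun x hx => if_pos hx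
  have hF2 : ∀ x, R1 ≤ ‖x‖ → F x = O.1 x := fun x hx => by
    by_cases h2 : ‖x‖ ≤ R2
    · rw [hF1 x h2, max_eq_left (h x hx h2)]
    · exact if_neg h2
  have hFO : ∀ x, O.1 x ≤ F x := fun x => by
    by_cases h2 : ‖x‖ ≤ R2
    · rw [hF1 x h2]; exact le_max_left _ _
    · exact (if_neg h2).ge
  have hFg : ∀ x, ‖x‖ ≤ R2 → g.1 x ≤ F x := fun x h2 => by
    rw [hF1 x h2]; exact le_max_right _ _
  have hcont : Continuous F := by
    refine Continuous.if_le ((map_continuous O.1).max (map_continuous g.1)) (map_continuous O.1)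
      continuous_norm continuous_const fun x hx => ?_
    exact max_eq_left (h x (by rw [hx]; exact h12.le) hx.le)
  have hconv : ConvexOn ℝ Set.univ F := by
    refine ⟨convex_univ, fun x _ y _ a b ha hb hab => ?_⟩
    simp only [smul_eq_mul]
    set p := a • x + b • y with hp
    have hOL : O.1 p ≤ a * F x + b * F y := by
      refine (O.2.2 (mem_univ x) (mem_univ y) ha hb hab).trans ?_
      simp only [smul_eq_mul]
      exact add_le_add (mul_le_mul_of_nonneg_left (hFO x) ha) (mul_le_mul_of_nonneg_left (hFO y) hb)
    rcases le_or_gt R1 ‖p‖ with hpR | hpR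
    · rw [hF2 p hpR]; exact hOL
    rw [hF1 p (hpR.le.trans h12.le)]
    refine max_le hOL ?_
    set Lp := a * F x + b * F y with hLp
    obtain ⟨t, ht0, ht1, ht⟩ := glue_aux (Lp := Lp) (g := g.1) O.2 h12 h hpR (hFO y) (hFg y) hOL
    obtain ⟨u, hu0, hu1, hu⟩ := glue_aux (Lp := Lp) (g := g.1) O.2 h12 h hpR (hFO x) (hFg x) hOL
    -- p is a convex combination of the two new points
    rcases ha.eq_or_lt with ha0 | ha0
    · have hb1 : b = 1 := by linarith
      have hpy : p = y := by rw [hp, ← ha0, hb1]; simp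
      have h3 := hFg y (by rw [← hpy]; exact hpR.le.trans h12.le)
      have h4 : Lp = F y := by rw [hLp, ← ha0, hb1]; ring
      rw [h4, hpy]; exact h3
    rcases hb.eq_or_lt with hb0 | hb0
    · have hb1 : a = 1 := by linarith
      have hpy : p = x := by rw [hp, ← hb0, hb1]; simp
      have h3 := hFg x (by rw [← hpy]; exact hpR.le.trans h12.le)
      have h4 : Lp = F x := by rw [hLp, ← hb0, hb1]; ring
      rw [h4, hpy]; exact h3
    have hD : 0 < a * t + b * u := by positivity
    have hpc : p = ((a * t) / (a * t + b * u)) • (p + u • (x - p)) +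
        ((b * u) / (a * t + b * u)) • (p + t • (y - p)) := by
      have e1 : a • (x - p) = -(b • (y - p)) := by
        rw [hp]; rw [show a = 1 - b by linarith]; module
      clear_value p
      have e2 : ((a * t) / (a * t + b * u)) • (u • (x - p)) =
          -(((b * u) / (a * t + b * u)) • (t • (y - p))) := by
        have := congrArg (fun w => (t * u / (a * t + b * u)) • w) e1
        simp only [smul_neg, smul_smul] at this ⊢
        convert this using 2 <;> [skip; congr 1] <;> ring_nf
      have e3 : (a * t) / (a * t + b * u) + (b * u) / (a * t + b * u) = 1 := by
        field_simp
      rw [smul_add, smul_add, e2]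
      have := congrArg (fun w : ℝ => w • p) e3
      simp only [add_smul, one_smul] at this
      calc p = _ := this.symm
        _ = _ := by abel
    have := g.2.2 (mem_univ (p + u • (x - p))) (mem_univ (p + t • (y - p)))
      (show 0 ≤ (a * t) / (a * t + b * u) by positivity)
      (show 0 ≤ (b * u) / (a * t + b * u) by positivity) (by field_simp)
    rw [← hpc] at this
    refine this.trans ?_
    simp only [smul_eq_mul]
    calc _ ≤ (a * t) / (a * t + b * u) * ((1 - u) * Lp + u * F x) +
          (b * u) / (a * t + b * u) * ((1 - t) * Lp + t * F y) :=
          add_le_add (mul_le_mul_of_nonneg_left hu (by positivity))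
            (mul_le_mul_of_nonneg_left ht (by positivity))
      _ = Lp := by
        have hb' : b = 1 - a := by linarith
        rw [hLp]; subst hb'; field_simp; ring
  exact ⟨⟨⟨F, hcont⟩, hconv⟩, hF1, hF2⟩
end

section
def sv {n : ℕ} (s : ℝ) (v : Eucl n) : Fin (n + 1) → ℂ := Fin.cons (s : ℂ) fun i => (v i : ℂ)

lemma fd_poly (D : ℕ) : ∃ c : ℕ → ℂ, ∀ P : Polynomial ℂ, P.natDegree ≤ D →
    P.eval 0 = ∑ i ∈ range (D + 1), c i * P.eval ((i : ℂ) + 1) := by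
  refine ⟨fun i => -((-1) ^ (D + 1) * ((-1 : ℂ) ^ (D - i) * (D + 1).choose (i + 1))), fun P hP => ?_⟩
  have h1 := congrFun (Polynomial.fwdDiff_iter_eq_zero_of_degree_lt (Nat.lt_succ_of_le hP)) 0
  rw [fwdDiff_iter_eq_sum_shift, Finset.sum_range_succ'] at h1
  simp only [zero_add, Pi.zero_apply, nsmul_eq_mul, mul_one, zsmul_eq_mul, Nat.choose_zero_right,
    Nat.cast_one, Nat.sub_zero, Nat.cast_zero, Int.cast_pow, Int.cast_neg, Int.cast_one,
    Int.cast_mul, Int.cast_natCast] at h1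
  push_cast at h1
  have hm : ((-1 : ℂ) ^ (D + 1)) * ((-1 : ℂ) ^ (D + 1)) = 1 := by
    rw [← mul_pow]; simp
  have : P.eval 0 = -((-1) ^ (D + 1) * ∑ x ∈ range (D + 1), ((-1 : ℂ) ^ (D - x) * ((D + 1).choose (x + 1)) * P.eval ((x : ℂ) + 1))) := by
    have h2 := congrArg (fun y => (-1 : ℂ) ^ (D + 1) * y) h1
    simp only [mul_add, mul_zero, Nat.succ_eq_add_one] at h2
    rw [← mul_assoc, hm, one_mul] at h2
    linear_combination h2
  rw [this, mul_sum, ← Finset.sum_neg_distrib]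
  refine sum_congr rfl fun i _ => ?_
  ring

lemma fd_line (n d : ℕ) : ∃ c : ℕ → ℂ, ∀ Q : MvPolynomial (Fin (n + 1)) ℂ, Q.totalDegree ≤ d →
    ∀ (s α β : ℝ) (v u : Eucl n), eval (sv s v) Q =
      ∑ i ∈ range (d * 2 + 1), c i * eval
        (sv (s + ((i : ℝ) + 1) ^ 2 * α + ((i : ℝ) + 1) * β) (v + ((i : ℝ) + 1) • u)) Q := by
  obtain ⟨c, hc⟩ := fd_poly (d * 2)
  refine ⟨c, fun Q hQ s α β v u => ?_⟩
  let f : Fin (n + 1) → Polynomial ℂ := Fin.cons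
    (Polynomial.C (s : ℂ) + Polynomial.X ^ 2 * Polynomial.C (α : ℂ) + Polynomial.X * Polynomial.C (β : ℂ))
    (fun i => Polynomial.C (v i : ℂ) + Polynomial.X * Polynomial.C (u i : ℂ))
  have hf : ∀ i, (f i).natDegree ≤ 2 := by
    intro i
    refine Fin.cases ?_ (fun j => ?_) i
    · simp only [f, Fin.cons_zero]; compute_degree
    · simp only [f, Fin.cons_succ]; compute_degree!
  have h1 := hc (aeval f Q) (MvPolynomial.aeval_natDegree_le Q hQ f hf)
  have h2 : ∀ t : ℝ, (aeval f Q).eval (t : ℂ) =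
      eval (sv (s + t ^ 2 * α + t * β) (v + t • u)) Q := by
    intro t
    rw [← Polynomial.coe_evalRingHom, MvPolynomial.aeval_def, MvPolynomial.eval₂_eq',
      MvPolynomial.eval_eq', map_sum]
    refine sum_congr rfl fun m _ => ?_
    rw [map_mul, map_prod]
    congr 1
    · simp
    · refine prod_congr rfl fun i _ => ?_
      rw [map_pow]; congr 1
      refine Fin.cases ?_ (fun j => ?_) i
      · simp [f, sv]; ring
      · simp [f, sv]; ring
  have h3 := h2 0
  simp only [Complex.ofReal_zero] at h3
  rw [show eval (sv s v) Q = (aeval f Q).eval 0 by rw [h3]; simp, h1]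
  refine sum_congr rfl fun i _ => ?_
  rw [← h2]; push_cast; rfl

/-- tilted translate -/
def tl {n : ℕ} (A : Eucl n →L[ℝ] Eucl n) (G : ConvFn n) (z : Eucl n) : ConvFn n :=
  addAffine (trF G z) (-quadF A z) (A z)

lemma tl_apply {n : ℕ} {A : Eucl n →L[ℝ] Eucl n} (hA : IsP A) (G : ConvFn n) (z x : Eucl n) :
    (tl A G z).1 x = quadF A x + (G.1 (x - z) - quadF A (x - z)) := by
  rw [quadF_sub hA]
  simp only [tl, addAffine_apply, trF_apply]; ring

lemma psi_tl {n : ℕ} {Ψ : ConvFn n → RadonMeasure n} (htr : TrInv Ψ)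
    (A : Eucl n →L[ℝ] Eucl n) (G : ConvFn n) (z : Eucl n) (s : ℝ) (v : Eucl n) (φ : Cc n) :
    (Ψ (addAffine (tl A G z) s v)).1 (trCc φ z) =
      (Ψ (addAffine G (s + quadF A z + ⟪v, z⟫) (v + A z))).1 φ := by
  rw [← htr z (addAffine G (s + quadF A z + ⟪v, z⟫) (v + A z)) φ]
  congr 3
  apply conv_ext; intro x
  simp only [tl, addAffine_apply, trF_apply, inner_add_left, inner_sub_right, quadF]; ring

lemma tile {n : ℕ} {A : Eucl n →L[ℝ] Eucl n} (hA : IsP A) {ι : Type*} [DecidableEq ι] (z : ι → Eucl n)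
    {R e : ℝ} (he : 0 ≤ e)
    (hz : ∀ i j, i ≠ j → 2 * R ≤ ‖z i - z j‖) (G : ConvFn n) (h1 : ∀ x, quadF A x ≤ G.1 x)
    (h2 : ∀ x, G.1 x ≤ quadF A x + e) (h3 : ∀ x, R ≤ ‖x‖ → G.1 x = quadF A x) (S : Finset ι) :
    ∃ H : ConvFn n, (∀ x, quadF A x ≤ H.1 x) ∧ (∀ x, H.1 x ≤ quadF A x + e) ∧
      (∀ i ∈ S, ∀ x, ‖x - z i‖ < R → H.1 x = (tl A G (z i)).1 x) ∧
      (∀ x, (∀ i ∈ S, R ≤ ‖x - z i‖) → H.1 x = quadF A x) := by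
  induction S using Finset.induction_on with
  | empty => exact ⟨qd ⟨A, hA⟩, fun x => le_rfl, fun x => by rw [qd_apply]; linarith, by simp,
      fun x _ => rfl⟩
  | insert a S ha ih =>
    obtain ⟨H, b1, b2, b3, b4⟩ := ih
    obtain ⟨K, hK⟩ := conv_max H (tl A G (z a))
    have t1 : ∀ x, quadF A x ≤ (tl A G (z a)).1 x := fun x => by
      rw [tl_apply hA]; linarith [h1 (x - z a)]
    have t2 : ∀ x, (tl A G (z a)).1 x ≤ quadF A x + e := fun x => by
      rw [tl_apply hA]; linarith [h2 (x - z a)]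
    have t3 : ∀ x, R ≤ ‖x - z a‖ → (tl A G (z a)).1 x = quadF A x := fun x hx => by
      rw [tl_apply hA, h3 _ hx]; ring
    have hsep : ∀ i j x, i ≠ j → ‖x - z i‖ < R → R ≤ ‖x - z j‖ := fun i j x hij hx => by
      have := hz i j hij
      have h4 : ‖z i - z j‖ ≤ ‖x - z j‖ + ‖x - z i‖ := by
        rw [show z i - z j = (x - z j) - (x - z i) by abel]; exact norm_sub_le _ _
      linarith
    refine ⟨K, fun x => ?_, fun x => ?_, fun i hi x hx => ?_, fun x hx => ?_⟩
    · rw [hK]; exact (b1 x).trans (le_max_left _ _)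
    · rw [hK]; exact max_le (b2 x) (t2 x)
    · rw [hK]
      rcases Finset.mem_insert.1 hi with rfl | hi2
      · rw [b4 x (fun j hj => hsep i j x (by rintro rfl; exact ha hj) hx), max_eq_right (t1 x)]
      · rw [b3 i hi2 x hx, t3 x (hsep i a x (fun hh => ha (hh ▸ hi2)) hx), max_eq_left]
        rw [← b3 i hi2 x hx]; exact b1 x
    · rw [hK, t3 x (hx a (Finset.mem_insert_self _ _)),
        b4 x (fun i hi => hx i (Finset.mem_insert_of_mem hi)), max_self]

lemma tsupport_trCc {n : ℕ} (φ : Cc n) (z : Eucl n) {R : ℝ} (h : tsupport φ ⊆ ball 0 R) :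
    tsupport (trCc φ z) ⊆ ball z R := by
  have h1 : tsupport (trCc φ z) ⊆ (fun x => x - z) ⁻¹' tsupport φ := by
    refine closure_minimal (fun x hx => ?_) ((isClosed_tsupport _).preimage (by fun_prop))
    exact subset_tsupport _ hx
  intro x hx
  have := h (h1 hx)
  rwa [mem_ball_zero_iff, ← dist_eq_norm] at this

/-- grid points -/
def gp (n N : ℕ) (R : ℝ) (i : ℕ) (m : Fin n → Fin N) : Eucl n :=
  ((i : ℝ) + 1) • WithLp.toLp 2 (fun j => 2 * R * ((m j : ℝ) + 1))

lemma gp_sep {n N : ℕ} {R : ℝ} (hR : 0 < R) (i : ℕ) (m m' : Fin n → Fin N) (h : m ≠ m') :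
    2 * R ≤ ‖gp n N R i m - gp n N R i m'‖ := by
  obtain ⟨j, hj⟩ := Function.ne_iff.1 h
  refine le_trans ?_ (PiLp.norm_apply_le _ j)
  have : (gp n N R i m - gp n N R i m') j = ((i : ℝ) + 1) * (2 * R) * ((m j : ℝ) - (m' j : ℝ)) := by
    simp [gp]; ring
  rw [this, norm_mul, norm_of_nonneg (by positivity)]
  have h1 : (1 : ℝ) ≤ ‖(m j : ℝ) - (m' j : ℝ)‖ := by
    have : ((m j : ℕ) : ℤ) ≠ ((m' j : ℕ) : ℤ) := fun hh => hj (Fin.ext (by exact_mod_cast hh))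
    have h2 : (1 : ℤ) ≤ |((m j : ℕ) : ℤ) - ((m' j : ℕ) : ℤ)| := Int.one_le_abs (sub_ne_zero.2 this)
    rw [norm_eq_abs]; exact_mod_cast h2
  have h3 : 2 * R ≤ ((i : ℝ) + 1) * (2 * R) := by nlinarith [mul_nonneg (cast_nonneg (α := ℝ) i) hR.le]
  nlinarith [norm_nonneg ((m j : ℝ) - (m' j : ℝ))]

lemma norm_le_of_coord {n : ℕ} (x : Eucl n) {K : ℝ} (h : ∀ j, |x j| ≤ K) : ‖x‖ ≤ n * K := by
  rw [EuclideanSpace.norm_eq]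
  calc √(∑ i, ‖x i‖ ^ 2) ≤ ∑ i, √(‖x i‖ ^ 2) := by
        rw [Real.sqrt_le_left (sum_nonneg fun i _ => Real.sqrt_nonneg _)]
        calc ∑ i, ‖x i‖ ^ 2 = ∑ i, (√(‖x i‖ ^ 2)) ^ 2 :=
              sum_congr rfl fun i _ => by rw [Real.sq_sqrt (by positivity)]
          _ ≤ _ := Finset.sum_sq_le_sq_sum_of_nonneg fun i _ => Real.sqrt_nonneg _
    _ ≤ ∑ i : Fin n, K := Finset.sum_le_sum fun i _ => by
        rw [Real.sqrt_sq (norm_nonneg _)]; exact h i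
    _ = n * K := by simp

lemma gp_norm {n N : ℕ} {R : ℝ} (hR : 0 < R) (hN : (N : ℝ) * R ≤ 2) (i : ℕ) (m : Fin n → Fin N) :
    ‖gp n N R i m‖ ≤ n * (((i : ℝ) + 1) * 4) := by
  refine norm_le_of_coord _ fun j => ?_
  have h0 : (gp n N R i m) j = ((i : ℝ) + 1) * (2 * R * ((m j : ℝ) + 1)) := by simp [gp]
  rw [h0, abs_of_nonneg (by positivity)]
  have h1 : (m j : ℝ) + 1 ≤ N := by exact_mod_cast (m j).2
  refine mul_le_mul_of_nonneg_left ?_ (by positivity)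
  nlinarith

lemma per_core {n d : ℕ} {Ψ : ConvFn n → RadonMeasure n} (hΨ : MemPdLV d Ψ) (htr : TrInv Ψ) :
    ∃ c : ℕ → ℂ, ∀ (A : Eucl n →L[ℝ] Eucl n) (N : ℕ) (R : ℝ) (G : ConvFn n) (s : ℝ) (v : Eucl n)
      (φ : Cc n) (H : ℕ → ConvFn n), tsupport φ ⊆ ball 0 R →
      (∀ i m x, ‖x - gp n N R i m‖ < R → (H i).1 x = (addAffine (tl A G (gp n N R i m)) s v).1 x) →
      (N : ℂ) ^ n * (Ψ (addAffine G s v)).1 φ = ∑ i ∈ range (d * 2 + 1),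
        c i * (Ψ (H i)).1 (∑ m, trCc φ (gp n N R i m)) := by
  obtain ⟨c, hc⟩ := fd_line n d
  refine ⟨c, fun A N R G s v φ H hφ hH => ?_⟩
  obtain ⟨Q, hQ, hQe⟩ := hΨ.2.2 G φ
  have key : ∀ m : Fin n → Fin N, (Ψ (addAffine G s v)).1 φ = ∑ i ∈ range (d * 2 + 1),
      c i * (Ψ (H i)).1 (trCc φ (gp n N R i m)) := by
    intro m
    rw [hQe]
    let w : Eucl n := WithLp.toLp 2 (fun j => 2 * R * ((m j : ℝ) + 1))
    refine (hc Q hQ s (quadF A w) ⟪v, w⟫ v (A w)).trans ?_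
    refine sum_congr rfl fun i _ => ?_
    congr 1
    rw [hΨ.1 (H i) (addAffine (tl A G (gp n N R i m)) s v) (ball (gp n N R i m) R)
      isOpen_ball (fun x hx => hH i m x (by rwa [mem_ball, dist_eq_norm] at hx)) _
      (tsupport_trCc φ _ hφ), psi_tl htr, hQe]
    have e1 : gp n N R i m = ((i : ℝ) + 1) • w := rfl
    rw [e1, quadF_smul, map_smul, inner_smul_right]
    rfl
  have : ∑ m : Fin n → Fin N, (Ψ (addAffine G s v)).1 φ = (N : ℂ) ^ n * (Ψ (addAffine G s v)).1 φ := by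
    simp
  rw [← this, sum_congr rfl fun m _ => key m, sum_comm]
  refine sum_congr rfl fun i _ => ?_
  rw [map_sum, mul_sum]
end

section
lemma tend_aff {n : ℕ} {q : ConvFn n} {F : ℕ → ConvFn n} {s : ℕ → ℝ} {v : ℕ → Eucl n} {s0 : ℝ}
    {v0 : Eucl n} {e : ℕ → ℝ} (he : Tendsto e atTop (𝓝 0)) (hs : Tendsto s atTop (𝓝 s0))
    (hv : Tendsto v atTop (𝓝 v0))
    (h : ∀ j x, |(F j).1 x - (addAffine q (s j) (v j)).1 x| ≤ e j) :
    Tendsto F atTop (𝓝 (addAffine q s0 v0)) := by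
  apply conv_tendsto_of
  intro R hR ε hε
  have h1 : Tendsto (fun j => e j + ‖s j - s0‖ + ‖v j - v0‖ * R) atTop (𝓝 0) := by
    have a1 := (tendsto_iff_norm_sub_tendsto_zero.1 hs)
    have a2 := (tendsto_iff_norm_sub_tendsto_zero.1 hv)
    simpa using (he.add a1).add (a2.mul_const R)
  filter_upwards [h1.eventually_lt_const hε] with j hj x hx
  have h2 := h j x
  have h3 : (F j).1 x - (addAffine q s0 v0).1 x =
      ((F j).1 x - (addAffine q (s j) (v j)).1 x) + ((s j - s0) + ⟪v j - v0, x⟫) := by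
    simp only [addAffine_apply, inner_sub_left]; ring
  rw [h3]
  have h4 : |⟪v j - v0, x⟫| ≤ ‖v j - v0‖ * R :=
    (abs_real_inner_le_norm _ _).trans (mul_le_mul_of_nonneg_left hx (norm_nonneg _))
  rw [norm_eq_abs] at hj
  have h5 := abs_add_le ((F j).1 x - (addAffine q (s j) (v j)).1 x) ((s j - s0) + ⟪v j - v0, x⟫)
  have h6 := abs_add_le (s j - s0) ⟪v j - v0, x⟫
  linarith

lemma zero_of_tsupport {n : ℕ} {φ : Cc n} {R : ℝ} (h : tsupport φ ⊆ ball 0 R) (x : Eucl n)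
    (hx : R ≤ ‖x‖) : φ x = 0 := by
  by_contra hc
  have := h (subset_tsupport _ hc)
  rw [mem_ball_zero_iff] at this; linarith

lemma gpsum_apply {n N : ℕ} (R : ℝ) (i : ℕ) (φ : Cc n) (x : Eucl n) :
    (∑ m, trCc φ (gp n N R i m)) x = ∑ m, φ (x - gp n N R i m) := by
  rw [CompactlySupportedContinuousMap.coe_sum, Finset.sum_apply]; rfl

lemma gpsum_in {n N : ℕ} {R : ℝ} (hR : 0 < R) (i : ℕ) {φ : Cc n}
    (h : tsupport φ ⊆ ball 0 R) (x : Eucl n) (m : Fin n → Fin N)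
    (hx : ‖x - gp n N R i m‖ < R) : (∑ m, trCc φ (gp n N R i m)) x = φ (x - gp n N R i m) := by
  rw [gpsum_apply]
  refine sum_eq_single m (fun m' _ hm => zero_of_tsupport h _ ?_) (by simp)
  have := gp_sep hR i m' m hm
  have h4 : ‖gp n N R i m' - gp n N R i m‖ ≤ ‖x - gp n N R i m‖ + ‖x - gp n N R i m'‖ := by
    rw [show gp n N R i m' - gp n N R i m = (x - gp n N R i m) - (x - gp n N R i m') by abel]
    exact norm_sub_le _ _
  linarith

lemma gpsum_out {n N : ℕ} {R : ℝ} (i : ℕ) {φ : Cc n}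
    (h : tsupport φ ⊆ ball 0 R) (x : Eucl n)
    (hx : ∀ m, R ≤ ‖x - gp n N R i m‖) : (∑ m, trCc φ (gp n N R i m)) x = 0 := by
  rw [gpsum_apply]
  exact sum_eq_zero fun m _ => zero_of_tsupport h _ (hx m)

structure PerSeq {n : ℕ} (A : Eucl n →L[ℝ] Eucl n) (R e : ℕ → ℝ) (G : ℕ → ConvFn n) : Prop where
  lo : ∀ j x, quadF A x ≤ (G j).1 x
  up : ∀ j x, (G j).1 x ≤ quadF A x + e j
  off : ∀ j x, R j ≤ ‖x‖ → (G j).1 x = quadF A x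

def nR (R : ℝ) : ℕ := ⌈1 / R⌉₊

lemma nR_le {R : ℝ} (h : 0 < R) (h1 : R ≤ 1) : (nR R : ℝ) * R ≤ 2 := by
  have := (Nat.ceil_lt_add_one (show 0 ≤ 1 / R by positivity)).le
  calc (nR R : ℝ) * R ≤ (1 / R + 1) * R := mul_le_mul_of_nonneg_right this h.le
    _ = 1 + R := by field_simp
    _ ≤ 2 := by linarith

lemma nR_ge {R : ℝ} (h : 0 < R) : 1 ≤ (nR R : ℝ) * R := by
  have := Nat.le_ceil (1 / R)
  calc 1 = 1 / R * R := by field_simp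
    _ ≤ _ := mul_le_mul_of_nonneg_right this h.le

lemma per_H {n : ℕ} {A : Eucl n →L[ℝ] Eucl n} (hA : IsP A) {R e : ℕ → ℝ} {G : ℕ → ConvFn n}
    (hG : PerSeq A R e G) (hR : ∀ j, 0 < R j) (he0 : ∀ j, 0 ≤ e j)
    {s : ℕ → ℝ} {v : ℕ → Eucl n} {s0 : ℝ} {v0 : Eucl n}
    (he : Tendsto e atTop (𝓝 0)) (hs : Tendsto s atTop (𝓝 s0)) (hv : Tendsto v atTop (𝓝 v0)) :
    ∃ H : ℕ → ℕ → ConvFn n,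
      (∀ j i m x, ‖x - gp n (nR (R j)) (R j) i m‖ < R j →
        (H j i).1 x = (addAffine (tl A (G j) (gp n (nR (R j)) (R j) i m)) (s j) (v j)).1 x) ∧
      (∀ j i x, (∀ m, R j ≤ ‖x - gp n (nR (R j)) (R j) i m‖) →
        (H j i).1 x = quadF A x + (s j + ⟪v j, x⟫)) ∧
      ∀ i, Tendsto (fun j => H j i) atTop (𝓝 (addAffine (qd ⟨A, hA⟩) s0 v0)) := by
  have := fun j i => tile hA (gp n (nR (R j)) (R j) i) (he0 j) (gp_sep (hR j) i) (G j) (hG.lo j)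
    (hG.up j) (hG.off j) univ
  choose H0 h1 h2 h3 h4 using this
  refine ⟨fun j i => addAffine (H0 j i) (s j) (v j), fun j i m x hx => ?_, fun j i x hx => ?_,
    fun i => tend_aff he hs hv fun j x => ?_⟩
  · simp only [addAffine_apply, h3 j i m (Finset.mem_univ _) x hx]
  · simp only [addAffine_apply, h4 j i x (fun m _ => hx m)]
  · simp only [addAffine_apply, qd_apply]
    rw [abs_le]; constructor <;> linarith [h1 j i x, h2 j i x, he0 j]

lemma per1 {n d : ℕ} {Ψ : ConvFn n → RadonMeasure n} (hΨ : MemPdLV d Ψ) (htr : TrInv Ψ)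
    {A : Eucl n →L[ℝ] Eucl n} (hA : IsP A) {R e : ℕ → ℝ} {G : ℕ → ConvFn n}
    (hG : PerSeq A R e G) (hR : ∀ j, 0 < R j) (hR1 : ∀ j, R j ≤ 1) (he0 : ∀ j, 0 ≤ e j)
    {s : ℕ → ℝ} {v : ℕ → Eucl n} {s0 : ℝ} {v0 : Eucl n}
    (he : Tendsto e atTop (𝓝 0)) (hs : Tendsto s atTop (𝓝 s0)) (hv : Tendsto v atTop (𝓝 v0)) :
    ∃ C : ℝ, ∀ j (φ : Cc n), tsupport φ ⊆ ball 0 (R j) → (∀ x, ‖φ x‖ ≤ 1) →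
      ‖(Ψ (addAffine (G j) (s j) (v j))).1 φ‖ ≤ C * R j ^ n := by
  obtain ⟨H, hH1, hH2, hH3⟩ := per_H hA hG hR he0 he hs hv
  obtain ⟨c, hc⟩ := per_core hΨ htr
  have := fun i => conv_ub hΨ.2.1 (hH3 i) (n * (((i : ℝ) + 1) * 4) + 1)
  choose C hC0 hC using this
  refine ⟨∑ i ∈ range (d * 2 + 1), ‖c i‖ * C i, fun j φ hφ hb => ?_⟩
  have h1 := hc A (nR (R j)) (R j) (G j) (s j) (v j) φ (H j) hφ (hH1 j)
  have h2 : ‖((nR (R j) : ℕ) : ℂ) ^ n * (Ψ (addAffine (G j) (s j) (v j))).1 φ‖ ≤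
      ∑ i ∈ range (d * 2 + 1), ‖c i‖ * C i := by
    rw [h1]
    refine (norm_sum_le _ _).trans (Finset.sum_le_sum fun i _ => ?_)
    rw [norm_mul]
    refine mul_le_mul_of_nonneg_left ?_ (norm_nonneg _)
    refine (hC i j _ 1 zero_le_one (fun x => ?_) (fun x hx => ?_)).trans_eq (mul_one _)
    · by_cases hx : ∃ m, ‖x - gp n (nR (R j)) (R j) i m‖ < R j
      · obtain ⟨m, hm⟩ := hx
        rw [gpsum_in (hR j) i hφ x m hm]; exact hb _
      · push Not at hx
        rw [gpsum_out i hφ x hx]; simp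
    · refine gpsum_out i hφ x fun m => ?_
      have a1 := gp_norm (hR j) (nR_le (hR j) (hR1 j)) i m
      have a2 := norm_sub_norm_le x (gp n (nR (R j)) (R j) i m)
      have a3 := hR1 j
      linarith
  rw [norm_mul, norm_pow, Complex.norm_natCast] at h2
  have h3 : 1 ≤ ((nR (R j) : ℝ) * R j) ^ n := one_le_pow₀ (nR_ge (hR j))
  rw [mul_pow] at h3
  have h4 := mul_le_mul_of_nonneg_right h2 (pow_nonneg (hR j).le n)
  nlinarith [norm_nonneg ((Ψ (addAffine (G j) (s j) (v j))).1 φ)]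

lemma per2 {n d : ℕ} {Ψ : ConvFn n → RadonMeasure n} (hΨ : MemPdLV d Ψ) (htr : TrInv Ψ)
    {A : Eucl n →L[ℝ] Eucl n} (hA : IsP A) {R R' R'' e : ℕ → ℝ} {G G' : ℕ → ConvFn n}
    (hG : PerSeq A R e G) (hG' : PerSeq A R e G')
    (hR : ∀ j, 0 < R j) (hR1 : ∀ j, R j ≤ 1) (he0 : ∀ j, 0 ≤ e j)
    {s : ℕ → ℝ} {v : ℕ → Eucl n} {s0 : ℝ} {v0 : Eucl n}
    (he : Tendsto e atTop (𝓝 0)) (hs : Tendsto s atTop (𝓝 s0)) (hv : Tendsto v atTop (𝓝 v0))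
    (hR' : ∀ j, R' j ≤ R j) (hR'' : ∀ j, R'' j < R' j)
    (hGR : ∀ j x, R'' j < ‖x‖ → (G j).1 x = (G' j).1 x)
    {φ : ℕ → Cc n} (hφ : ∀ j, tsupport (φ j) ⊆ ball 0 (R j))
    (hφ1 : ∀ j x, ‖x‖ < R' j → φ j x = 1) :
    Tendsto (fun j => ‖(Ψ (addAffine (G j) (s j) (v j))).1 (φ j) -
      (Ψ (addAffine (G' j) (s j) (v j))).1 (φ j)‖ / R j ^ n) atTop (𝓝 0) := by
  obtain ⟨H, hH1, hH2, hH3⟩ := per_H hA hG hR he0 he hs hv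
  obtain ⟨H', hH1', hH2', hH3'⟩ := per_H hA hG' hR he0 he hs hv
  obtain ⟨c, hc⟩ := per_core hΨ htr
  let Φ : ℕ → Cc n := fun i => cutR n (n * (((i : ℝ) + 1) * 4) + 1)
  have hdiff : ∀ j i, (Ψ (H j i)).1 (∑ m, trCc (φ j) (gp n (nR (R j)) (R j) i m)) -
      (Ψ (H' j i)).1 (∑ m, trCc (φ j) (gp n (nR (R j)) (R j) i m)) =
      (Ψ (H j i)).1 (Φ i) - (Ψ (H' j i)).1 (Φ i) := by
    intro j i
    set S := ∑ m, trCc (φ j) (gp n (nR (R j)) (R j) i m) with hS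
    have hl : (Ψ (H j i)).1 (Φ i - S) = (Ψ (H' j i)).1 (Φ i - S) := by
      refine hΨ.1 _ _ {x | ∀ m, R'' j < ‖x - gp n (nR (R j)) (R j) i m‖} ?_ ?_ _ ?_
      · simp only [Set.ofPred_forall]
        exact isOpen_iInter_of_finite fun m => isOpen_lt (by fun_prop) (by fun_prop)
      · intro x hx
        by_cases h : ∃ m, ‖x - gp n (nR (R j)) (R j) i m‖ < R j
        · obtain ⟨m, hm⟩ := h
          rw [hH1 j i m x hm, hH1' j i m x hm, addAffine_apply, addAffine_apply, tl_apply hA,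
            tl_apply hA, hGR j _ (hx m)]
        · push Not at h
          rw [hH2 j i x h, hH2' j i x h]
      · have : tsupport (Φ i - S) ⊆ {x | ∀ m, R' j ≤ ‖x - gp n (nR (R j)) (R j) i m‖} := by
          refine closure_minimal (fun x hx m => ?_) ?_
          · by_contra hlt
            push Not at hlt
            apply hx
            show Φ i x - S x = 0
            rw [hS, gpsum_in (hR j) i (hφ j) x m (hlt.trans_le (hR' j)), hφ1 j _ hlt]
            have : Φ i x = 1 := cutR_one (by
              have a1 := gp_norm (hR j) (nR_le (hR j) (hR1 j)) i m
              have a2 := norm_sub_norm_le x (gp n (nR (R j)) (R j) i m)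
              have a3 := hR1 j
              have a4 := hR' j
              linarith)
            rw [this, sub_self]
          · simp only [Set.ofPred_forall]
            exact isClosed_iInter fun m => isClosed_le (by fun_prop) (by fun_prop)
        intro x hx m
        exact (hR'' j).trans_le (this hx m)
    rw [map_sub, map_sub] at hl
    linear_combination -hl
  have hlim : Tendsto (fun j => ∑ i ∈ range (d * 2 + 1),
      c i * ((Ψ (H j i)).1 (Φ i) - (Ψ (H' j i)).1 (Φ i))) atTop (𝓝 0) := by
    rw [show (0 : ℂ) = ∑ i ∈ range (d * 2 + 1), c i * 0 by simp]
    refine tendsto_finsetSum _ fun i _ => Tendsto.const_mul _ ?_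
    have a1 := ((hΨ.2.1 (Φ i)).tendsto _).comp (hH3 i)
    have a2 := ((hΨ.2.1 (Φ i)).tendsto _).comp (hH3' i)
    have := a1.sub a2
    rw [sub_self] at this
    exact this
  refine squeeze_zero (fun j => by have := hR j; positivity) (fun j => ?_) (tendsto_zero_iff_norm_tendsto_zero.1 hlim)
  have h1 := hc A (nR (R j)) (R j) (G j) (s j) (v j) (φ j) (H j) (hφ j) (hH1 j)
  have h2 := hc A (nR (R j)) (R j) (G' j) (s j) (v j) (φ j) (H' j) (hφ j) (hH1' j)
  have h3 : ((nR (R j) : ℕ) : ℂ) ^ n * ((Ψ (addAffine (G j) (s j) (v j))).1 (φ j) -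
      (Ψ (addAffine (G' j) (s j) (v j))).1 (φ j)) = ∑ i ∈ range (d * 2 + 1),
      c i * ((Ψ (H j i)).1 (Φ i) - (Ψ (H' j i)).1 (Φ i)) := by
    rw [mul_sub, h1, h2, ← sum_sub_distrib]
    refine sum_congr rfl fun i _ => ?_
    rw [← hdiff, mul_sub]
  rw [← h3, norm_mul, norm_pow, Complex.norm_natCast, div_le_iff₀ (pow_pos (hR j) n)]
  have h5 : 1 ≤ ((nR (R j) : ℝ) * R j) ^ n := one_le_pow₀ (nR_ge (hR j))
  rw [mul_pow] at h5
  nlinarith [norm_nonneg ((Ψ (addAffine (G j) (s j) (v j))).1 (φ j) -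
      (Ψ (addAffine (G' j) (s j) (v j))).1 (φ j))]
end

section
lemma isP_smul_id {n : ℕ} {c : ℝ} (hc : 0 ≤ c) :
    IsP (c • ContinuousLinearMap.id ℝ (Eucl n)) := by
  refine ⟨fun x y => ?_, fun x => ?_⟩
  · show ⟪c • x, y⟫ = ⟪c • y, x⟫
    rw [real_inner_smul_left, real_inner_smul_left, real_inner_comm]
  · simp only [smul_apply, id_apply, real_inner_smul_left]
    exact mul_nonneg hc real_inner_self_nonneg

lemma isP_add {n : ℕ} {A B : Eucl n →L[ℝ] Eucl n} (hA : IsP A) (hB : IsP B) : IsP (A + B) := by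
  refine ⟨fun x y => ?_, fun x => ?_⟩
  · simp only [add_apply, inner_add_left, hA.1 x y, hB.1 x y]
  · simp only [add_apply, inner_add_left]
    exact add_nonneg (hA.2 x) (hB.2 x)

lemma quadF_smul_id {n : ℕ} (c : ℝ) (x : Eucl n) :
    quadF (c • ContinuousLinearMap.id ℝ (Eucl n)) x = c * ‖x‖ ^ 2 / 2 := by
  simp only [quadF, smul_apply, id_apply,
    real_inner_smul_left, real_inner_self_eq_norm_sq]

lemma quadF_add {n : ℕ} (A B : Eucl n →L[ℝ] Eucl n) (x : Eucl n) :
    quadF (A + B) x = quadF A x + quadF B x := by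
  simp only [quadF, add_apply, inner_add_left]; ring

lemma norm_scale {n : ℕ} (μ : RadonMeasure n) {D : ℝ} (P : Cc n → Prop)
    (hP : ∀ (c : ℂ) φ, P φ → P (c • φ))
    (h : ∀ φ, P φ → (∀ x, ‖φ x‖ ≤ 1) → ‖μ.1 φ‖ ≤ D) (φ : Cc n) (hφ : P φ) {K : ℝ} (hK : 0 ≤ K)
    (hb : ∀ x, ‖φ x‖ ≤ K) : ‖μ.1 φ‖ ≤ D * K := by
  rcases hK.eq_or_lt with h0 | hpos
  · have : φ = 0 := cc_ext fun x => by
      have := hb x; rw [← h0] at this; simpa using this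
    simp [this, ← h0]
  · have h1 := h ((K : ℂ)⁻¹ • φ) (hP _ _ hφ) (fun x => by
        have : ((K : ℂ)⁻¹ • φ) x = (K : ℂ)⁻¹ * φ x := rfl
        rw [this, norm_mul, norm_inv, norm_real, norm_of_nonneg hK]
        rw [inv_mul_le_iff₀ hpos]; simpa using hb x)
    rw [map_smul, norm_smul, norm_inv, norm_real, norm_of_nonneg hK,
      inv_mul_le_iff₀ hpos] at h1
    linarith

lemma tsupport_smul {n : ℕ} (c : ℂ) (φ : Cc n) {U : Set (Eucl n)} (h : tsupport φ ⊆ U) :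
    tsupport (c • φ) ⊆ U :=
  (closure_mono (by intro x hx hc; apply hx; show c * φ x = 0; rw [show φ x = 0 from hc, mul_zero])).trans h

lemma star0 {n d : ℕ} {Ψ : ConvFn n → RadonMeasure n} (hΨ : MemPdLV d Ψ) (htr : TrInv Ψ)
    {Λ M : ℝ} (hΛ : 0 < Λ) :
    ∃ C ρ0 : ℝ, 0 < ρ0 ∧ ∀ ρ : ℝ, 0 < ρ → ρ < ρ0 → ∀ (g : ConvFn n) (s : ℝ) (v : Eucl n),
      (∀ x, ‖x‖ ≤ 2 * ρ → |g.1 x| ≤ Λ * ρ ^ 2) → |s| ≤ M → ‖v‖ ≤ M → ∀ φ : Cc n,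
      tsupport φ ⊆ ball 0 ρ → (∀ x, ‖φ x‖ ≤ 1) →
      ‖(Ψ (addAffine g s v)).1 φ‖ ≤ C * ρ ^ n := by
  by_contra hcon
  push Not at hcon
  have := fun j : ℕ => hcon j (1 / (2 * ((j : ℝ) + 1))) (by positivity)
  choose ρ hρ0 hρ g s v hg hs hv φ hφ hφ1 hbig using this
  have hρh : ∀ j, ρ j ≤ 1 / 2 := fun j => (hρ j).le.trans (by
    rw [div_le_div_iff₀ (by positivity) (by norm_num)]
    have : (0 : ℝ) ≤ j := cast_nonneg j
    linarith)
  have hρt : Tendsto ρ atTop (𝓝 0) := by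
    have h1 : Tendsto (fun j : ℕ => 1 / ((j : ℝ) + 1)) atTop (𝓝 0) := tendsto_one_div_add_atTop_nhds_zero_nat
    refine squeeze_zero (fun j => (hρ0 j).le) (fun j => (hρ j).le.trans ?_) h1
    rw [div_le_div_iff₀ (by positivity) (by positivity)]
    have : (0 : ℝ) ≤ j := cast_nonneg j
    linarith
  set A : Eucl n →L[ℝ] Eucl n := (4 * Λ) • ContinuousLinearMap.id ℝ (Eucl n) with hAdef
  have hA : IsP A := isP_smul_id (by positivity)
  have hq : ∀ x, quadF A x = 2 * Λ * ‖x‖ ^ 2 := fun x => by rw [hAdef, quadF_smul_id]; ring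
  have hgl : ∀ j, ∃ G : ConvFn n, (∀ x, ‖x‖ ≤ 2 * ρ j → G.1 x = max (quadF A x) ((g j).1 x + 3 * Λ * ρ j ^ 2)) ∧
      (∀ x, 3 / 2 * ρ j ≤ ‖x‖ → G.1 x = quadF A x) := by
    intro j
    obtain ⟨G, h1, h2⟩ := glue (addAffine (g j) (3 * Λ * ρ j ^ 2) 0) (qd ⟨A, hA⟩)
      (R1 := 3 / 2 * ρ j) (R2 := 2 * ρ j) (by linarith [hρ0 j]) (fun x hx1 hx2 => by
        rw [addAffine_apply, qd_apply, hq, inner_zero_left, add_zero]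
        have := (abs_le.1 (hg j x hx2)).2
        have h3 : (3 / 2 * ρ j) ^ 2 ≤ ‖x‖ ^ 2 := pow_le_pow_left₀ (by linarith [hρ0 j]) hx1 2
        nlinarith [sq_nonneg (ρ j)])
    refine ⟨G, fun x hx => ?_, h2⟩
    rw [h1 x hx, addAffine_apply, inner_zero_left, add_zero]; rfl
  choose G hG1 hG2 using hgl
  have hPer : PerSeq A (fun j => 2 * ρ j) (fun j => 4 * Λ * ρ j ^ 2) G := by
    refine ⟨fun j x => ?_, fun j x => ?_, fun j x hx => hG2 j x (by linarith [hρ0 j])⟩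
    · rcases le_total ‖x‖ (2 * ρ j) with h | h
      · rw [hG1 j x h]; exact le_max_left _ _
      · rw [hG2 j x (by linarith [hρ0 j])]
    · have hp : 0 ≤ Λ * ρ j ^ 2 := by positivity
      rcases le_total ‖x‖ (2 * ρ j) with h | h
      · rw [hG1 j x h]
        have := (abs_le.1 (hg j x h)).2
        have h4 := hA.2 x
        have h5 : 0 ≤ quadF A x := by unfold quadF; positivity
        exact max_le (by linarith) (by linarith)
      · rw [hG2 j x (by linarith [hρ0 j])]; linarith
  obtain ⟨p, -, θ, hθ, hlim⟩ := tendsto_subseq_of_bounded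
    (Metric.isBounded_closedBall (x := (0 : ℝ × Eucl n)) (r := M)) (x := fun j => (s j, v j))
    (fun j => by
      rw [mem_closedBall_zero_iff, Prod.norm_def]
      exact max_le (hs j) (hv j))
  have hρθ : Tendsto (fun j => ρ (θ j)) atTop (𝓝 0) := hρt.comp hθ.tendsto_atTop
  have hρθ2 : ∀ c : ℝ, Tendsto (fun j => c * ρ (θ j) ^ 2) atTop (𝓝 0) := fun c => by
    simpa using (hρθ.pow 2).const_mul c
  obtain ⟨C, hC⟩ := per1 hΨ htr hA (R := fun j => 2 * ρ (θ j)) (e := fun j => 4 * Λ * ρ (θ j) ^ 2)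
    (G := fun j => G (θ j)) ⟨fun j => hPer.lo _, fun j => hPer.up _, fun j => hPer.off _⟩
    (fun j => by linarith [hρ0 (θ j)]) (fun j => by linarith [hρh (θ j)])
    (fun j => by have := hρ0 (θ j); positivity) (s := fun j => s (θ j) - 3 * Λ * ρ (θ j) ^ 2)
    (v := fun j => v (θ j)) (s0 := p.1) (v0 := p.2) (hρθ2 _)
    (by simpa using ((continuous_fst.tendsto p).comp hlim).sub (hρθ2 (3 * Λ)))
    ((continuous_snd.tendsto p).comp hlim)
  obtain ⟨j, hj⟩ := exists_nat_ge (C * 2 ^ n)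
  have hb := hbig (θ j)
  have hb2 := hC j (φ (θ j)) ((hφ (θ j)).trans (Metric.ball_subset_ball (by linarith [hρ0 (θ j)])))
    (hφ1 _)
  rw [← hΨ.1 (addAffine (g (θ j)) (s (θ j)) (v (θ j))) _ (ball 0 (ρ (θ j))) isOpen_ball
    (fun x hx => ?_) _ (hφ _)] at hb2
  · have h6 : (j : ℝ) ≤ θ j := by exact_mod_cast hθ.le_apply
    have h7 := pow_pos (hρ0 (θ j)) n
    rw [mul_pow] at hb2
    nlinarith
  · rw [mem_ball_zero_iff] at hx
    have hp := hρ0 (θ j)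
    rw [addAffine_apply, addAffine_apply, hG1 _ x (by linarith), max_eq_right]
    · ring
    · have := (abs_le.1 (hg (θ j) x (by linarith))).1
      rw [hq]
      have h3 : ‖x‖ ^ 2 ≤ (ρ (θ j)) ^ 2 := pow_le_pow_left₀ (norm_nonneg _) hx.le 2
      nlinarith

lemma star {n d : ℕ} {Ψ : ConvFn n → RadonMeasure n} (hΨ : MemPdLV d Ψ) (htr : TrInv Ψ)
    (Λ M : ℝ) :
    ∃ C ρ0 : ℝ, 0 ≤ C ∧ 0 < ρ0 ∧ ∀ ρ : ℝ, 0 < ρ → ρ < ρ0 → ∀ (h : ConvFn n) (a : Eucl n) (s : ℝ)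
      (v : Eucl n), (∀ x, ‖x‖ ≤ 2 * ρ → |h.1 (a + x) - (s + ⟪v, x⟫)| ≤ Λ * ρ ^ 2) →
      |s| ≤ M → ‖v‖ ≤ M → ∀ (φ : Cc n) (K : ℝ), 0 ≤ K →
      tsupport φ ⊆ ball 0 ρ → (∀ x, ‖φ x‖ ≤ K) →
      ‖(Ψ h).1 (trCc φ a)‖ ≤ C * ρ ^ n * K := by
  obtain ⟨C, ρ0, hρ0, hC⟩ := star0 hΨ htr (M := M) (show 0 < |Λ| + 1 by positivity)
  refine ⟨max C 0, ρ0, le_max_right _ _, hρ0, fun ρ h1 h2 h a s v hh hs hv φ K hK hφ hb => ?_⟩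
  set g := addAffine (trF h (-a)) (-s) (-v) with hg
  have e1 : trF (addAffine g s v) a = h := by
    apply conv_ext; intro x
    simp only [hg, trF_apply, addAffine_apply, inner_neg_left]
    rw [sub_neg_eq_add, sub_add_cancel]; ring
  have e2 := htr a (addAffine g s v) φ
  rw [e1] at e2
  rw [e2]
  refine norm_scale _
    (fun ψ => tsupport ψ ⊆ ball 0 ρ) (fun c ψ hψ => tsupport_smul c ψ hψ) (fun ψ hψ hψ1 => ?_) φ hφ hK hb
  refine (hC ρ h1 h2 g s v (fun x hx => ?_) hs hv ψ hψ hψ1).trans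
    (mul_le_mul_of_nonneg_right (le_max_left _ _) (by positivity))
  have e3 : g.1 x = h.1 (a + x) - (s + ⟪v, x⟫) := by
    simp only [hg, trF_apply, addAffine_apply, inner_neg_left, sub_neg_eq_add]
    rw [add_comm x a]; ring
  rw [e3]
  refine (hh x hx).trans (mul_le_mul_of_nonneg_right ?_ (by positivity))
  linarith [le_abs_self Λ]
end

section
def tent {n : ℕ} (x : Eucl n) : ℝ := max 0 (1 / 2 - ‖x‖)

lemma tent_cont {n : ℕ} : Continuous (tent (n := n)) := by unfold tent; fun_prop

lemma tent_zero {n : ℕ} {x : Eucl n} (h : 1 / 2 ≤ ‖x‖) : tent x = 0 := max_eq_left (by linarith)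

lemma tent_nonneg {n : ℕ} (x : Eucl n) : 0 ≤ tent x := le_max_left _ _

lemma tent_le {n : ℕ} (x : Eucl n) : tent x ≤ 1 := max_le (by norm_num) (by
  have := norm_nonneg x; linarith)

lemma tent_cs {n : ℕ} : HasCompactSupport (tent (n := n)) := by
  refine HasCompactSupport.intro (isCompact_closedBall 0 1) fun x hx => tent_zero ?_
  rw [mem_closedBall_zero_iff] at hx; push Not at hx; linarith

def tI (n : ℕ) : ℝ := ∫ x : Eucl n, tent x

lemma tI_pos (n : ℕ) : 0 < tI n := by
  refine tent_cont.integral_pos_of_hasCompactSupport_nonneg_nonzero tent_cs tent_nonneg (x := 0) ?_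
  simp [tent]

/-- radial kernel of mass one at scale `r` -/
def kapR {n : ℕ} (r : ℝ) (x : Eucl n) : ℝ := (r ^ n)⁻¹ * (tI n)⁻¹ * tent (r⁻¹ • x)

lemma kapR_cont {n : ℕ} (r : ℝ) : Continuous (kapR (n := n) r) := by
  unfold kapR; exact continuous_const.mul (tent_cont.comp (by fun_prop))

lemma kapR_zero {n : ℕ} {r : ℝ} (hr : 0 < r) {x : Eucl n} (h : r / 2 ≤ ‖x‖) : kapR r x = 0 := by
  unfold kapR; rw [tent_zero, mul_zero]
  rw [norm_smul, norm_inv, norm_of_nonneg hr.le, inv_mul_eq_div, le_div_iff₀ hr]; linarith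

lemma kapR_nonneg {n : ℕ} {r : ℝ} (hr : 0 < r) (x : Eucl n) : 0 ≤ kapR r x := by
  have := tI_pos n
  have := tent_nonneg (r⁻¹ • x)
  unfold kapR; positivity

lemma kapR_le {n : ℕ} {r : ℝ} (hr : 0 < r) (x : Eucl n) : kapR r x ≤ (r ^ n)⁻¹ * (tI n)⁻¹ := by
  have := tI_pos n
  exact mul_le_of_le_one_right (by positivity) (tent_le _)

lemma kapR_int {n : ℕ} {r : ℝ} (hr : 0 < r) : ∫ x : Eucl n, kapR r x = 1 := by
  have h0 := tI_pos n
  unfold kapR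
  rw [integral_const_mul, Measure.integral_comp_inv_smul_of_nonneg _ _ hr.le, finrank_euclideanSpace_fin]
  show _ * (r ^ n * tI n) = 1
  field_simp

lemma kapR_rot {n : ℕ} (r : ℝ) (ρ : Eucl n ≃ₗᵢ[ℝ] Eucl n) (x : Eucl n) :
    kapR r (ρ x) = kapR r x := by
  unfold kapR tent; rw [← map_smul, LinearIsometryEquiv.norm_map]

def kap {n : ℕ} (r : ℝ) : Cc n :=
  if hr : 0 < r then ccMk (fun x => (kapR r x : ℂ)) (by have := kapR_cont (n := n) r; fun_prop) r
    (fun x hx => by rw [kapR_zero hr (by linarith)]; simp) else 0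

lemma kap_apply {n : ℕ} {r : ℝ} (hr : 0 < r) (x : Eucl n) : kap r x = (kapR r x : ℂ) := by
  unfold kap; rw [dif_pos hr]; rfl

lemma kap_tsupp {n : ℕ} {r : ℝ} (hr : 0 < r) : tsupport (kap (n := n) r) ⊆ ball 0 r := by
  refine (closure_minimal ?_ (isClosed_closedBall (x := (0 : Eucl n)) (ε := r / 2))).trans
    (Metric.closedBall_subset_ball (by linarith))
  intro x hx
  by_contra hc
  rw [mem_closedBall_zero_iff] at hc; push Not at hc
  exact hx (by rw [kap_apply hr, kapR_zero hr hc.le]; simp)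

lemma kap_norm {n : ℕ} {r : ℝ} (hr : 0 < r) (x : Eucl n) : ‖kap r x‖ = kapR r x := by
  rw [kap_apply hr, norm_real, norm_of_nonneg (kapR_nonneg hr x)]

lemma kap_int {n : ℕ} {r : ℝ} (hr : 0 < r) : ∫ x : Eucl n, kap r x = 1 := by
  simp_rw [kap_apply hr]
  rw [integral_complex_ofReal, kapR_int hr]; simp

lemma cc_integrable {n : ℕ} (φ : Cc n) : Integrable φ :=
  φ.continuous.integrable_of_hasCompactSupport φ.hasCompactSupport'

lemma cconv_ex {n : ℕ} (κ : Cc n) (w : Eucl n → ℂ)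
    (hw : Integrable w) {R : ℝ} (hwR : ∀ x, R < ‖x‖ → w x = 0) :
    ∃ ψ : Cc n, ∀ x, ψ x = ∫ a, w a * κ (x - a) := by
  obtain ⟨r, hr, hκ⟩ := cc_supp κ
  obtain ⟨M, hM0, hM⟩ := cc_bdd κ
  have hint : Integrable (fun a => w a • trB κ a) := by
    refine Integrable.mono' (hw.norm.mul_const M)
      (hw.aestronglyMeasurable.smul (trB_cont κ).aestronglyMeasurable) (ae_of_all _ fun a => ?_)
    rw [norm_smul]
    exact mul_le_mul_of_nonneg_left ((BoundedContinuousFunction.norm_le hM0).2 fun x => hM _)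
      (norm_nonneg _)
  have h1 : ∀ x, (∫ a, w a • trB κ a) x = ∫ a, w a * κ (x - a) := by
    intro x
    have := integral_comp_comm (BoundedContinuousFunction.evalCLM ℂ x) hint
    simp only [BoundedContinuousFunction.evalCLM_apply] at this
    rw [← this]
    rfl
  refine ⟨ccMk (⇑(∫ a, w a • trB κ a : Eucl n →ᵇ ℂ)) (BoundedContinuousFunction.continuous _) (R + r) (fun x hx => ?_), h1⟩
  rw [h1]
  have : ∀ a, w a * κ (x - a) = 0 := fun a => by
    rcases le_or_gt ‖a‖ R with h | h
    · rw [hκ _ (by have := norm_sub_norm_le x a; linarith), mul_zero]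
    · rw [hwR a h, zero_mul]
  simp [this]

lemma cconv_close {n : ℕ} {φ χ : Cc n} {r ε : ℝ} (hχ : ∫ x, χ x = 1)
    (hr : ∀ y, r < ‖y‖ → χ y = 0) (h : ∀ x y, ‖x - y‖ ≤ r → ‖φ y - φ x‖ ≤ ε) (x : Eucl n) :
    ‖(∫ a, φ a * χ (x - a)) - φ x‖ ≤ ε * ∫ y, ‖χ y‖ := by
  have hi := cc_integrable χ
  have h1 : Integrable fun a => χ (x - a) := hi.comp_sub_left x
  have e1 : ∫ a, χ (x - a) = 1 := by rw [integral_sub_left_eq_self (fun a => χ a)]; exact hχ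
  have e2 : ∫ y, ‖χ y‖ = ∫ a, ‖χ (x - a)‖ := by rw [integral_sub_left_eq_self (fun a => ‖χ a‖)]
  have h2 : Integrable fun a => φ a * χ (x - a) := by
    obtain ⟨M, hM0, hM⟩ := cc_bdd φ
    exact h1.bdd_mul φ.continuous.aestronglyMeasurable (ae_of_all _ hM)
  have : (∫ a, φ a * χ (x - a)) - φ x = ∫ a, (φ a - φ x) * χ (x - a) := by
    simp_rw [sub_mul]
    rw [integral_sub h2 (h1.const_mul _), integral_const_mul, e1, mul_one]
  rw [this, e2, ← integral_const_mul]
  refine norm_integral_le_of_norm_le (h1.norm.const_mul _) (ae_of_all _ fun a => ?_)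
  rw [norm_mul]
  rcases le_or_gt ‖x - a‖ r with hx | hx
  · exact mul_le_mul_of_nonneg_right (h x a hx) (norm_nonneg _)
  · simp [hr _ hx]

/-- approximate identity -/
lemma cconv_tendsto {n : ℕ} {Ψ : ConvFn n → RadonMeasure n} (hc : IsContinuousFunctional Ψ)
    {f : ConvFn n} (φ : Cc n) {χ : ℕ → Cc n} {r : ℕ → ℝ} (hr : Tendsto r atTop (𝓝 0))
    (hr1 : ∀ i, r i ≤ 1)
    {C : ℝ} (hC : ∀ i, ∫ y, ‖χ i y‖ ≤ C) (hχ : ∀ i, ∫ x, χ i x = 1)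
    (hs : ∀ i y, r i < ‖y‖ → χ i y = 0) :
    Tendsto (fun i => ∫ a, φ a * (Ψ f).1 (trCc (χ i) a)) atTop (𝓝 ((Ψ f).1 φ)) := by
  obtain ⟨R, hR, hφ⟩ := cc_supp φ
  have hex := fun i => cconv_ex (χ i) φ (cc_integrable φ) hφ
  choose ψ hψ using hex
  have hz : ∀ i x, R + 1 < ‖x‖ → ψ i x = 0 := by
    intro i x hx
    rw [hψ]
    have : ∀ a, φ a * χ i (x - a) = 0 := fun a => by
      rcases le_or_gt ‖a‖ R with h | h
      · rw [hs i _ (by have := norm_sub_norm_le x a; linarith [hr1 i]), mul_zero]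
      · rw [hφ a h, zero_mul]
    simp [this]
  have hC0 : 0 ≤ C := le_trans (integral_nonneg fun _ => norm_nonneg _) (hC 0)
  have hu : UniformContinuous φ :=
    φ.hasCompactSupport'.uniformContinuous_of_continuous φ.continuous
  have key : ∀ ε > 0, ∀ᶠ i in atTop, ∀ x, ‖ψ i x - φ x‖ ≤ ε := by
    intro ε hε
    obtain ⟨δ, hδ, h⟩ := Metric.uniformContinuous_iff.1 hu (ε / (C + 1)) (by positivity)
    filter_upwards [hr.eventually_lt_const hδ] with i hi x
    rw [hψ]
    refine (cconv_close (ε := ε / (C + 1)) (hχ i) (hs i) (fun x y hxy => ?_) x).trans ?_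
    · rw [← dist_eq_norm]; exact (h (by rw [dist_comm, dist_eq_norm]; linarith)).le
    · rw [div_mul_eq_mul_div, div_le_iff₀ (by positivity)]
      exact mul_le_mul_of_nonneg_left ((hC i).trans (by linarith)) hε.le
  obtain ⟨D, hD0, hD⟩ := conv_ub hc (tendsto_const_nhds (x := f) (f := atTop (α := ℕ))) (R + 1)
  have e : ∀ i, ∫ a, φ a * (Ψ f).1 (trCc (χ i) a) = (Ψ f).1 (ψ i) := fun i =>
    (radon_integral _ (χ i) (ψ i) φ (cc_integrable φ) hφ (hψ i)).symm
  simp_rw [e]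
  rw [Metric.tendsto_atTop']
  intro ε hε
  obtain ⟨N, hN⟩ := eventually_atTop.1 (key (ε / (D + 1) / 2) (by positivity))
  refine ⟨N, fun i hi => ?_⟩
  rw [dist_eq_norm, ← map_sub]
  have := hD 0 (ψ i - φ) (ε / (D + 1) / 2) (by positivity) (hN i hi.le) (fun x hx => by
    simp [hz i x hx, hφ x (by linarith)])
  refine this.trans_lt ?_
  have : D / (D + 1) < 1 := by rw [div_lt_one (by positivity)]; linarith
  calc D * (ε / (D + 1) / 2) = D / (D + 1) * (ε / 2) := by ring
    _ ≤ 1 * (ε / 2) := by gcongr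
    _ < ε := by linarith
end

section
lemma sv_ext_poly {n : ℕ} {p q : MvPolynomial (Fin (n + 1)) ℂ}
    (h : ∀ (s : ℝ) (v : Eucl n), eval (sv s v) p = eval (sv s v) q) :
    p = q := by
  refine MvPolynomial.funext_set (fun _ => Set.range (fun t : ℝ => (t : ℂ)))
    (fun _ => infinite_range_of_injective Complex.ofReal_injective) fun x hx => ?_
  have hx' : ∀ i, ∃ t : ℝ, (t : ℂ) = x i := fun i => hx i (mem_univ i)
  choose t ht using hx'
  have : x = sv (t 0) (WithLp.toLp 2 fun i => t i.succ) := by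
    funext i
    refine Fin.cases ?_ (fun j => ?_) i
    · simp [sv, ht]
    · simp [sv, ht]
  rw [this]; exact h _ _

lemma coefrep (n d : ℕ) (m : Fin (n + 1) →₀ ℕ) : ∃ c : (ℝ × Eucl n) →₀ ℂ,
    ∀ Q : MvPolynomial (Fin (n + 1)) ℂ, Q.totalDegree ≤ d →
      Q.coeff m = c.sum fun p b => b * eval (sv p.1 p.2) Q := by
  let V := MvPolynomial.restrictTotalDegree (Fin (n + 1)) ℂ d
  let ev : (ℝ × Eucl n) → Module.Dual ℂ V := fun p =>
    (aeval (R := ℂ) (sv p.1 p.2)).toLinearMap ∘ₗ V.subtype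
  have hev : ∀ p (Q : V), ev p Q = eval (sv p.1 p.2) Q.1 := fun p Q => by
    simp [ev]
  have htop : Submodule.span ℂ (Set.range ev) = ⊤ := by
    rw [← Subspace.dualCoannihilator_dualAnnihilator_eq (W := Submodule.span ℂ (Set.range ev))]
    have : (Submodule.span ℂ (Set.range ev)).dualCoannihilator = ⊥ := by
      rw [eq_bot_iff]
      intro Q hQ
      rw [Submodule.mem_dualCoannihilator] at hQ
      rw [Submodule.mem_bot]
      apply Subtype.ext
      apply sv_ext_poly
      intro s v
      have := hQ (ev (s, v)) (Submodule.subset_span ⟨_, rfl⟩)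
      rw [hev] at this
      simpa using this
    rw [this]; simp
  have hm : (MvPolynomial.lcoeff ℂ m ∘ₗ V.subtype : Module.Dual ℂ V) ∈
    Submodule.span ℂ (Set.range ev) := htop ▸ Submodule.mem_top
  obtain ⟨c, hc⟩ := Finsupp.mem_span_range_iff_exists_finsupp.1 hm
  refine ⟨c, fun Q hQ => ?_⟩
  have := congrArg (fun l : Module.Dual ℂ V => l ⟨Q, (MvPolynomial.mem_restrictTotalDegree _ _ _).2 hQ⟩) hc
  simp only [LinearMap.comp_apply] at this
  change _ = Q.coeff m at this
  rw [← this, Finsupp.sum, Finsupp.sum, LinearMap.sum_apply]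
  refine sum_congr rfl fun p _ => ?_
  rw [LinearMap.smul_apply, hev, smul_eq_mul]

lemma interp (n d : ℕ) : ∃ (T : Finset (ℝ × Eucl n)) (L : ℝ × Eucl n → MvPolynomial (Fin (n + 1)) ℂ),
    (∀ p, (L p).totalDegree ≤ d) ∧ ∀ Q : MvPolynomial (Fin (n + 1)) ℂ, Q.totalDegree ≤ d →
      ∀ s v, eval (sv s v) Q =
        ∑ p ∈ T, eval (sv s v) (L p) * eval (sv p.1 p.2) Q := by
  classical
  choose c hc using coefrep n d
  let S : Finset (Fin (n + 1) →₀ ℕ) := (Finsupp.finite_of_degree_le (σ := Fin (n + 1)) d).toFinset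
  have hS : ∀ m, m ∈ S ↔ m.degree ≤ d := fun m => by simp [S]
  refine ⟨S.biUnion fun m => (c m).support, fun p => ∑ m ∈ S, MvPolynomial.monomial m (c m p),
    fun p => ?_, fun Q hQ s v => ?_⟩
  · refine totalDegree_finsetSum_le fun m hm => ?_
    exact (MvPolynomial.totalDegree_monomial_le _ _).trans ((hS m).1 hm)
  · have h1 : Q = ∑ m ∈ S, MvPolynomial.monomial m (Q.coeff m) := by
      conv_lhs => rw [Q.as_sum]
      refine sum_subset (fun m hm => (hS m).2 ?_) fun m _ hm => ?_
      · exact (MvPolynomial.le_totalDegree hm).trans hQ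
      · rw [MvPolynomial.notMem_support_iff.1 hm]; simp
    conv_lhs => rw [h1]
    simp only [map_sum, sum_mul]
    rw [sum_comm]
    refine sum_congr rfl fun m hm => ?_
    rw [hc m Q hQ, MvPolynomial.eval_monomial, Finsupp.sum, sum_mul]
    rw [sum_subset (Finset.subset_biUnion_of_mem (fun m => (c m).support) hm)]
    · refine sum_congr rfl fun p _ => ?_
      rw [MvPolynomial.eval_monomial]; ring
    · intro p _ hp
      rw [Finsupp.notMem_support_iff.1 hp]; simp

lemma sv_cont {n : ℕ} {X : Type*} [TopologicalSpace X]
    {f : X → ℝ} {g : X → Eucl n} (hf : Continuous f) (hg : Continuous g) :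
    Continuous fun x => sv (f x) (g x) := by
  refine continuous_pi fun i => ?_
  refine Fin.cases ?_ (fun j => ?_) i
  · simp only [sv, Fin.cons_zero]; fun_prop
  · simp only [sv, Fin.cons_succ]; fun_prop

lemma eval_sv_cont {n : ℕ} {X : Type*} [TopologicalSpace X] (Q : MvPolynomial (Fin (n + 1)) ℂ)
    {f : X → ℝ} {g : X → Eucl n} (hf : Continuous f) (hg : Continuous g) :
    Continuous fun x => eval (sv (f x) (g x)) Q := by
  have h1 := sv_cont hf hg
  generalize hw : (fun x => sv (f x) (g x)) = w at h1
  have : (fun x => eval (sv (f x) (g x)) Q) = fun x => eval (w x) Q := by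
    rw [← hw]
  rw [this]
  exact (MvPolynomial.continuous_eval Q).comp h1

lemma uf_bdd {U : Ultrafilter ℕ} {u : ℕ → ℂ} {C : ℝ} (h : ∀ᶠ i in (U : Filter ℕ), ‖u i‖ ≤ C) :
    ∃ x, Tendsto u U (𝓝 x) := by
  obtain ⟨x, _, hx⟩ := (isCompact_closedBall (0 : ℂ) C).ultrafilter_le_nhds (U.map u) (by
    rw [le_principal_iff]
    change u ⁻¹' _ ∈ U
    filter_upwards [h] with i hi
    simpa using hi)
  exact ⟨x, hx⟩

abbrev PM (n : ℕ) := {A : Eucl n →L[ℝ] Eucl n // IsP A}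

def rj (j : ℕ) : ℝ := 1 / ((j : ℝ) + 1)

lemma rj_pos (j : ℕ) : 0 < rj j := Nat.one_div_pos_of_nat
lemma rj_le (j : ℕ) : rj j ≤ 1 := by
  unfold rj; rw [div_le_one (by positivity)]; linarith [(cast_nonneg j : (0 : ℝ) ≤ j)]
lemma rj_lim : Tendsto rj atTop (𝓝 0) := tendsto_one_div_add_atTop_nhds_zero_nat

def P0 {n : ℕ} (Ψ : ConvFn n → RadonMeasure n) (A : PM n) (s : ℝ) (v : Eucl n) : ℂ :=
  limUnder (hyperfilter ℕ : Filter ℕ) fun j => (Ψ (addAffine (qd A) s v)).1 (kap (rj j))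

lemma quad_le {n : ℕ} (A : Eucl n →L[ℝ] Eucl n) (x : Eucl n) : |quadF A x| ≤ ‖A‖ * ‖x‖ ^ 2 := by
  unfold quadF
  have h1 : |⟪A x, x⟫| ≤ ‖A x‖ * ‖x‖ := abs_real_inner_le_norm _ _
  have h2 := A.le_opNorm x
  have : ‖A x‖ * ‖x‖ ≤ ‖A‖ * ‖x‖ * ‖x‖ := by gcongr
  rw [abs_div, abs_two]
  have := abs_nonneg ⟪A x, x⟫
  rw [show ‖A‖ * ‖x‖ ^ 2 = ‖A‖ * ‖x‖ * ‖x‖ by ring]; linarith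

variable {n d : ℕ} {Ψ : ConvFn n → RadonMeasure n}

lemma trCc_zero (φ : Cc n) : trCc φ 0 = φ := cc_ext fun x => by simp

lemma qk_bound (hΨ : MemPdLV d Ψ) (htr : TrInv Ψ) (N M : ℝ) : ∃ C, 0 ≤ C ∧ ∀ᶠ j in atTop,
    ∀ (A : PM n) (s : ℝ) (v : Eucl n), ‖A.1‖ ≤ N → |s| ≤ M → ‖v‖ ≤ M →
      ‖(Ψ (addAffine (qd A) s v)).1 (kap (rj j))‖ ≤ C := by
  obtain ⟨C, ρ0, hC, hρ0, h⟩ := star hΨ htr (N * 4) M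
  have hI := tI_pos n
  refine ⟨C * (tI n)⁻¹, by positivity, ?_⟩
  filter_upwards [rj_lim.eventually_lt_const hρ0] with j hj A s v hA hs hv
  have hr := rj_pos j
  have := h (rj j) hr hj (addAffine (qd A) s v) 0 s v (fun x hx => by
    rw [addAffine_apply, qd_apply, zero_add, add_sub_cancel_right]
    refine (quad_le _ _).trans ?_
    have : ‖x‖ ^ 2 ≤ (2 * rj j) ^ 2 := by gcongr
    calc ‖A.1‖ * ‖x‖ ^ 2 ≤ N * (2 * rj j) ^ 2 := by
          apply mul_le_mul hA this (by positivity) ((norm_nonneg _).trans hA)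
      _ = N * 4 * rj j ^ 2 := by ring) hs hv (kap (rj j)) ((rj j ^ n)⁻¹ * (tI n)⁻¹) (by positivity)
    (kap_tsupp hr) (fun x => by rw [kap_norm hr]; exact kapR_le hr x)
  rw [trCc_zero] at this
  refine this.trans (le_of_eq ?_)
  field_simp

lemma P0_tendsto (hΨ : MemPdLV d Ψ) (htr : TrInv Ψ) (A : PM n) (s : ℝ) (v : Eucl n) :
    Tendsto (fun j => (Ψ (addAffine (qd A) s v)).1 (kap (rj j))) (hyperfilter ℕ) (𝓝 (P0 Ψ A s v)) := by
  obtain ⟨C, _, h⟩ := qk_bound hΨ htr ‖A.1‖ (max |s| ‖v‖)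
  refine tendsto_nhds_limUnder (uf_bdd (C := C) ?_)
  have := h.filter_mono hyperfilter_le_atTop
  filter_upwards [this] with j hj
  exact hj A s v le_rfl (le_max_left _ _) (le_max_right _ _)

lemma P0_bound (hΨ : MemPdLV d Ψ) (htr : TrInv Ψ) (N M : ℝ) : ∃ C, 0 ≤ C ∧
    ∀ (A : PM n) (s : ℝ) (v : Eucl n), ‖A.1‖ ≤ N → |s| ≤ M → ‖v‖ ≤ M → ‖P0 Ψ A s v‖ ≤ C := by
  obtain ⟨C, hC, h⟩ := qk_bound hΨ htr N M
  refine ⟨C, hC, fun A s v hA hs hv => le_of_tendsto (P0_tendsto hΨ htr A s v).norm ?_⟩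
  filter_upwards [h.filter_mono hyperfilter_le_atTop] with j hj
  exact hj A s v hA hs hv

lemma P0_interp (hΨ : MemPdLV d Ψ) (htr : TrInv Ψ) {T : Finset (ℝ × Eucl n)}
    {L : ℝ × Eucl n → MvPolynomial (Fin (n + 1)) ℂ}
    (hL : ∀ Q : MvPolynomial (Fin (n + 1)) ℂ, Q.totalDegree ≤ d →
      ∀ s v, eval (sv s v) Q =
        ∑ p ∈ T, eval (sv s v) (L p) * eval (sv p.1 p.2) Q)
    (A : PM n) (s : ℝ) (v : Eucl n) :
    P0 Ψ A s v = ∑ p ∈ T, eval (sv s v) (L p) * P0 Ψ A p.1 p.2 := by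
  refine tendsto_nhds_unique (P0_tendsto hΨ htr A s v) ?_
  have : Tendsto (fun j => ∑ p ∈ T, eval (sv s v) (L p) *
      (Ψ (addAffine (qd A) p.1 p.2)).1 (kap (rj j))) (hyperfilter ℕ)
      (𝓝 (∑ p ∈ T, eval (sv s v) (L p) * P0 Ψ A p.1 p.2)) :=
    tendsto_finsetSum _ fun p _ => (P0_tendsto hΨ htr A p.1 p.2).const_mul _
  refine this.congr fun j => ?_
  obtain ⟨Q, hQ, h⟩ := hΨ.2.2 (qd A) (kap (rj j))
  simp_rw [h]
  exact (hL Q hQ s v).symm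

lemma P0_poly (hΨ : MemPdLV d Ψ) (htr : TrInv Ψ) (A : PM n) :
    ∃ Q : MvPolynomial (Fin (n + 1)) ℂ, Q.totalDegree ≤ d ∧
      ∀ s v, P0 Ψ A s v = eval (sv s v) Q := by
  obtain ⟨T, L, hLd, hL⟩ := interp n d
  refine ⟨∑ p ∈ T, L p * MvPolynomial.C (P0 Ψ A p.1 p.2), ?_, fun s v => ?_⟩
  · refine totalDegree_finsetSum_le fun p _ => ?_
    refine (MvPolynomial.totalDegree_mul _ _).trans ?_
    simpa using hLd p
  · rw [P0_interp hΨ htr hL]; simp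

lemma qd_jet_int (hΨ : MemPdLV d Ψ) (htr : TrInv Ψ) (A : PM n) (s : ℝ) (v : Eucl n) (φ : Cc n) :
    (Ψ (addAffine (qd A) s v)).1 φ =
      ∫ x, φ x * P0 Ψ A (s + quadF A.1 x + ⟪v, x⟫) (v + A.1 x) := by
  obtain ⟨T, L, hLd, hL⟩ := interp n d
  have htl : ∀ z, tl A.1 (qd A) z = qd A := fun z => conv_ext fun x => by
    rw [tl_apply A.2, qd_apply, qd_apply]; ring
  have hjc : Continuous fun x => (s + quadF A.1 x + ⟪v, x⟫, v + A.1 x) := by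
    have := quadF_cont A.1
    fun_prop
  have hint : ∀ p, Integrable fun x => φ x *
      eval (sv (s + quadF A.1 x + ⟪v, x⟫) (v + A.1 x)) (L p) := fun p => by
    have h1 : Continuous fun x =>
        eval (sv (s + quadF A.1 x + ⟪v, x⟫) (v + A.1 x)) (L p) :=
      eval_sv_cont (L p) hjc.fst hjc.snd
    exact (φ.continuous.mul h1).integrable_of_hasCompactSupport (HasCompactSupport.mul_right φ.2)
  have key : ∀ j, ∫ a, φ a * (Ψ (addAffine (qd A) s v)).1 (trCc (kap (rj j)) a) =
      ∑ p ∈ T, (∫ x, φ x * eval (sv (s + quadF A.1 x + ⟪v, x⟫) (v + A.1 x)) (L p)) *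
        (Ψ (addAffine (qd A) p.1 p.2)).1 (kap (rj j)) := by
    intro j
    simp_rw [← integral_mul_const]
    rw [← integral_finsetSum _ (fun p _ => (hint p).mul_const _)]
    congr 1; ext a
    have := psi_tl htr A.1 (qd A) a s v (kap (rj j))
    rw [htl] at this
    rw [this]
    obtain ⟨Q, hQ, h⟩ := hΨ.2.2 (qd A) (kap (rj j))
    simp_rw [h]
    have h2 := hL Q hQ (s + quadF A.1 a + ⟪v, a⟫) (v + A.1 a)
    simp only [sv] at h2 ⊢
    rw [h2, mul_sum]
    refine sum_congr rfl fun p _ => by ring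
  have h1 : Tendsto (fun j => ∫ a, φ a * (Ψ (addAffine (qd A) s v)).1 (trCc (kap (rj j)) a)) atTop
      (𝓝 ((Ψ (addAffine (qd A) s v)).1 φ)) := by
    refine cconv_tendsto hΨ.2.1 φ rj_lim rj_le (C := 1) (fun i => ?_) (fun i => kap_int (rj_pos i))
      (fun i y hy => ?_)
    · simp_rw [kap_norm (rj_pos i)]; exact (kapR_int (rj_pos i)).le
    · rw [kap_apply (rj_pos i), kapR_zero (rj_pos i) (by linarith [rj_pos i])]; simp
  have h2 : Tendsto (fun j => ∫ a, φ a * (Ψ (addAffine (qd A) s v)).1 (trCc (kap (rj j)) a))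
      (hyperfilter ℕ) (𝓝 (∑ p ∈ T, (∫ x, φ x * eval
        (sv (s + quadF A.1 x + ⟪v, x⟫) (v + A.1 x)) (L p)) * P0 Ψ A p.1 p.2)) := by
    simp_rw [key]
    exact tendsto_finsetSum _ fun p _ => (P0_tendsto hΨ htr A p.1 p.2).const_mul _
  rw [tendsto_nhds_unique (h1.mono_left hyperfilter_le_atTop) h2]
  simp_rw [← integral_mul_const]
  rw [← integral_finsetSum _ (fun p _ => (hint p).mul_const _)]
  congr 1; ext a
  rw [P0_interp hΨ htr hL, mul_sum]
  refine sum_congr rfl fun p _ => by ring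
end

section
variable {n d k : ℕ} {Ψ : ConvFn n → RadonMeasure n}

lemma qd_cont (s : ℝ) (v : Eucl n) : Continuous fun A : PM n => addAffine (qd A) s v := by
  rw [continuous_iff_continuousAt]
  intro A0
  refine conv_tendsto_of fun R hR ε hε => ?_
  filter_upwards [ball_mem_nhds A0 (ε := ε / R ^ 2) (by positivity)] with A hA x hx
  rw [addAffine_apply, addAffine_apply, qd_apply, qd_apply, add_sub_add_right_eq_sub]
  have e : quadF A.1 x - quadF A0.1 x = quadF (A.1 - A0.1) x := by
    simp only [quadF, sub_apply, inner_sub_left]; ring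
  have h1 : ‖A.1 - A0.1‖ ≤ ε / R ^ 2 := by
    rw [mem_ball, Subtype.dist_eq, dist_eq_norm] at hA; exact hA.le
  rw [e]
  calc _ ≤ ‖A.1 - A0.1‖ * ‖x‖ ^ 2 := quad_le _ _
    _ ≤ ε / R ^ 2 * R ^ 2 := by gcongr
    _ = ε := by field_simp

lemma P0_contA (hΨ : MemPdLV d Ψ) (htr : TrInv Ψ) (s : ℝ) (v : Eucl n) :
    Continuous fun A : PM n => P0 Ψ A s v := by
  obtain ⟨T, L, hLd, hL⟩ := interp n d
  rw [continuous_iff_continuousAt]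
  intro A0
  -- uniform bound on node values
  obtain ⟨M, hM⟩ : ∃ M : ℝ, ∀ p ∈ T, |p.1| ≤ M ∧ ‖p.2‖ ≤ M := by
    refine ⟨∑ p ∈ T, (|p.1| + ‖p.2‖), fun p hp => ?_⟩
    have := Finset.single_le_sum (f := fun p : ℝ × Eucl n => |p.1| + ‖p.2‖)
      (fun _ _ => by positivity) hp
    constructor <;> linarith [abs_nonneg p.1, norm_nonneg p.2]
  obtain ⟨C, hC, hb⟩ := P0_bound hΨ htr (‖A0.1‖ + 1) M
  refine continuousAt_of_locally_uniform_approx_of_continuousAt fun u hu => ?_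
  obtain ⟨ε, hε, hεu⟩ := Metric.mem_uniformity_dist.1 hu
  set N : ℝ := T.card * C + 1 with hN
  have hN0 : 0 < N := by positivity
  set ε1 := ε / N / 2 with hε1
  have hε10 : 0 < ε1 := by positivity
  have hLc : ∀ p, Continuous fun y : PM n × Eucl n =>
      eval (sv (s + quadF y.1.1 y.2 + ⟪v, y.2⟫) (v + y.1.1 y.2)) (L p) := by
    intro p
    have h1 : Continuous fun y : PM n × Eucl n => y.1.1 y.2 :=
      (continuous_subtype_val.comp continuous_fst).clm_apply continuous_snd
    refine eval_sv_cont (L p) ?_ ?_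
    · unfold quadF; fun_prop
    · fun_prop
  have hev : ∀ᶠ y : PM n × Eucl n in 𝓝 A0 ×ˢ 𝓝 0, ∀ p ∈ T,
      ‖eval (sv (s + quadF y.1.1 y.2 + ⟪v, y.2⟫) (v + y.1.1 y.2)) (L p)
        - eval (sv s v) (L p)‖ < ε1 := by
    rw [← nhds_prod_eq]
    refine (Filter.eventually_all_finset T).2 fun p _ => ?_
    have := (hLc p).continuousAt (x := (A0, 0))
    have := (Metric.tendsto_nhds.1 this) ε1 hε10
    simpa [dist_eq_norm, quadF] using this
  obtain ⟨pA, hpA, px, hpx, hev⟩ := Filter.eventually_prod_iff.1 hev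
  obtain ⟨r0, hr0, hr⟩ := Metric.eventually_nhds_iff.1 hpx
  refine ⟨{A | pA A} ∩ ball A0 1, inter_mem hpA (ball_mem_nhds _ one_pos),
    fun A => (Ψ (addAffine (qd A) s v)).1 (kap r0),
    ((hΨ.2.1 _).comp (qd_cont s v)).continuousAt, fun A hA => hεu ?_⟩
  have hAn : ‖A.1‖ ≤ ‖A0.1‖ + 1 := by
    have h1 := hA.2
    rw [mem_ball, Subtype.dist_eq, dist_eq_norm] at h1
    have := norm_sub_norm_le A.1 A0.1; linarith
  have hk := cc_integrable (kap (n := n) r0)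
  have hki : Integrable fun x => kap r0 x * P0 Ψ A (s + quadF A.1 x + ⟪v, x⟫) (v + A.1 x) := by
    obtain ⟨Q, _, hQ⟩ := P0_poly hΨ htr A
    simp_rw [hQ]
    have h1 : Continuous fun x =>
        eval (sv (s + quadF A.1 x + ⟪v, x⟫) (v + A.1 x)) Q := by
      have := quadF_cont A.1
      exact eval_sv_cont Q (by fun_prop) (by fun_prop)
    exact ((kap r0).continuous.mul h1).integrable_of_hasCompactSupport
      (HasCompactSupport.mul_right (kap r0).2)
  rw [dist_comm, dist_eq_norm]
  beta_reduce
  rw [qd_jet_int hΨ htr]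
  have e : (∫ x, kap r0 x * P0 Ψ A (s + quadF A.1 x + ⟪v, x⟫) (v + A.1 x)) - P0 Ψ A s v =
      ∫ x, kap r0 x * (P0 Ψ A (s + quadF A.1 x + ⟪v, x⟫) (v + A.1 x) - P0 Ψ A s v) := by
    simp_rw [mul_sub]
    rw [integral_sub hki (hk.mul_const _), integral_mul_const, kap_int hr0, one_mul]
  rw [e]
  have hfin : ‖∫ x, kap r0 x * (P0 Ψ A (s + quadF A.1 x + ⟪v, x⟫) (v + A.1 x) - P0 Ψ A s v)‖
      ≤ ∫ x : Eucl n, kapR r0 x * (N * ε1) := by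
    refine norm_integral_le_of_norm_le ?_ (ae_of_all _ fun x => ?_)
    · have := hk.norm
      simp_rw [kap_norm hr0] at this
      exact this.mul_const _
    · rw [norm_mul, kap_norm hr0]
      rcases le_or_gt (r0 / 2) ‖x‖ with hx | hx
      · rw [kapR_zero hr0 hx]; simp
      refine mul_le_mul_of_nonneg_left ?_ (kapR_nonneg hr0 x)
      rw [P0_interp hΨ htr hL, P0_interp hΨ htr hL A s v, ← sum_sub_distrib]
      calc _ ≤ ∑ p ∈ T, ε1 * C := norm_sum_le_of_le _ fun p hp => by
            rw [← sub_mul, norm_mul]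
            have := hev hA.1 (hr (y := x) (by rw [dist_zero_right]; linarith)) p hp
            exact mul_le_mul this.le (hb A _ _ hAn (hM p hp).1 (hM p hp).2) (norm_nonneg _) hε10.le
        _ ≤ N * ε1 := by
            rw [Finset.sum_const, nsmul_eq_mul, hN]; nlinarith
  rw [integral_mul_const, kapR_int hr0, one_mul] at hfin
  refine hfin.trans_lt ?_
  rw [hε1, show N * (ε / N / 2) = ε / 2 by field_simp]; linarith

lemma P0_cont (hΨ : MemPdLV d Ψ) (htr : TrInv Ψ) {X : Type*} [TopologicalSpace X] {A : X → PM n}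
    {s : X → ℝ} {v : X → Eucl n} (hA : Continuous A) (hs : Continuous s) (hv : Continuous v) :
    Continuous fun x => P0 Ψ (A x) (s x) (v x) := by
  obtain ⟨T, L, hLd, hL⟩ := interp n d
  have : (fun x => P0 Ψ (A x) (s x) (v x)) = fun x => ∑ p ∈ T,
      eval (sv (s x) (v x)) (L p) * P0 Ψ (A x) p.1 p.2 := by
    funext x; exact P0_interp hΨ htr hL _ _ _
  rw [this]
  refine continuous_finsetSum _ fun p _ => ?_
  exact (eval_sv_cont (L p) hs hv).mul ((P0_contA hΨ htr p.1 p.2).comp hA)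

lemma P0_rot (hrig : IsRigidMotionInvariant Ψ) (ρ : Eucl n ≃ₗᵢ[ℝ] Eucl n)
    (hρ : LinearMap.det (ρ.toLinearEquiv : Eucl n →ₗ[ℝ] Eucl n) = 1) {A A' : PM n} (s : ℝ)
    {v v' : Eucl n} (hA : ∀ x, quadF A'.1 x = quadF A.1 (ρ x)) (hv : ∀ x, ⟪v', x⟫ = ⟪v, ρ x⟫) :
    P0 Ψ A' s v' = P0 Ψ A s v := by
  unfold P0
  congr 1; ext j
  rw [← hrig ρ hρ 0 (addAffine (qd A) s v) (kap (rj j))]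
  congr 2
  · congr 1
    apply conv_ext; intro x
    show quadF A'.1 x + (s + ⟪v', x⟫) = quadF A.1 (ρ x + 0) + (s + ⟪v, ρ x + 0⟫)
    rw [add_zero, hA, hv]
  · apply cc_ext; intro x
    show _ = kap (rj j) (ρ x + 0)
    rw [add_zero, kap_apply (rj_pos j), kap_apply (rj_pos j), kapR_rot]

lemma P0_hom (hΨ : MemPdLV d Ψ) (htr : TrInv Ψ) (hhom : IsHomogeneousDeg k Ψ) (t : ℝ≥0) {A A' : PM n} (s : ℝ)
    (v : Eucl n) (hA : A'.1 = (t : ℝ) • A.1) :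
    P0 Ψ A' (t * s) ((t : ℝ) • v) = ((t : ℝ) : ℂ) ^ k * P0 Ψ A s v := by
  refine tendsto_nhds_unique (P0_tendsto hΨ htr _ _ _) ?_
  refine ((P0_tendsto hΨ htr A s v).const_mul _).congr fun j => ?_
  have h1 : addAffine (qd A') (t * s) ((t : ℝ) • v) = smulConv t (addAffine (qd A) s v) := by
    apply conv_ext; intro x
    show quadF A'.1 x + (t * s + ⟪(t : ℝ) • v, x⟫) = (t : ℝ) * (quadF A.1 x + (s + ⟪v, x⟫))
    rw [hA, real_inner_smul_left]
    simp only [quadF, smul_apply, real_inner_smul_left]; ring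
  rw [h1, hhom]; rfl
end

section
variable {n d k : ℕ} {Ψ : ConvFn n → RadonMeasure n}

def indB (n : ℕ) (ρ : ℝ) : Eucl n → ℂ := (closedBall 0 ρ).indicator 1

lemma indB_int (ρ : ℝ) : Integrable (indB n ρ) := by
  refine IntegrableOn.integrable_indicator ?_ isClosed_closedBall.measurableSet
  exact integrableOn_const measure_closedBall_lt_top.ne

lemma indB_zero {ρ : ℝ} {x : Eucl n} (h : ρ < ‖x‖) : indB n ρ x = 0 :=
  indicator_of_notMem (by simpa using h) _

lemma indB_one {ρ : ℝ} {x : Eucl n} (h : ‖x‖ ≤ ρ) : indB n ρ x = 1 :=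
  indicator_of_mem (s := closedBall 0 ρ) (by simpa using h) _

def chi (ρ θ : ℝ) : Cc n := (cconv_ex (kap θ) (indB n ρ) (indB_int ρ) (fun _ => indB_zero)).choose

lemma chi_apply (ρ θ : ℝ) (x : Eucl n) : chi ρ θ x = ∫ a, indB n ρ a * kap θ (x - a) :=
  (cconv_ex (kap θ) (indB n ρ) (indB_int ρ) (fun _ => indB_zero)).choose_spec x

lemma chi_zero {ρ θ : ℝ} (hθ : 0 < θ) {x : Eucl n} (h : ρ + θ / 2 ≤ ‖x‖) : chi ρ θ x = 0 := by
  rw [chi_apply]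
  have : ∀ a, indB n ρ a * kap θ (x - a) = 0 := fun a => by
    rcases le_or_gt ‖a‖ ρ with h1 | h1
    · rw [kap_apply hθ, kapR_zero hθ]; · simp
      have := norm_sub_norm_le x a; linarith
    · rw [indB_zero h1, zero_mul]
  simp [this]

lemma chi_one {ρ θ : ℝ} (hθ : 0 < θ) {x : Eucl n} (h : ‖x‖ + θ / 2 ≤ ρ) : chi ρ θ x = 1 := by
  rw [chi_apply]
  have : ∀ a, indB n ρ a * kap θ (x - a) = kap θ (x - a) := fun a => by
    rcases le_or_gt ‖a‖ ρ with h1 | h1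
    · rw [indB_one h1, one_mul]
    · rw [kap_apply hθ, kapR_zero hθ]; · simp
      have := norm_sub_norm_le a x; rw [norm_sub_rev] at this; linarith
  simp_rw [this]
  rw [integral_sub_left_eq_self (fun a => kap θ a), kap_int hθ]

lemma chi_real {ρ θ : ℝ} (hθ : 0 < θ) (x : Eucl n) : ∃ t : ℝ, 0 ≤ t ∧ t ≤ 1 ∧ chi ρ θ x = (t : ℂ) := by
  have h : ∀ a, indB n ρ a * kap θ (x - a) =
      (((closedBall (0 : Eucl n) ρ).indicator (fun a => kapR θ (x - a)) a : ℝ) : ℂ) := fun a => by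
    rw [kap_apply hθ]
    by_cases h1 : a ∈ closedBall (0 : Eucl n) ρ
    · simp [indB, indicator_of_mem h1]
    · simp [indB, indicator_of_notMem h1]
  have hi : Integrable fun a => kapR θ (x - a) := by
    have := ((cc_integrable (kap (n := n) θ)).norm).comp_sub_left x
    simp_rw [kap_norm hθ] at this
    exact this
  refine ⟨∫ a, (closedBall (0 : Eucl n) ρ).indicator (fun a => kapR θ (x - a)) a, ?_, ?_, ?_⟩
  · exact integral_nonneg fun a => indicator_nonneg (fun _ _ => kapR_nonneg hθ _) _
  · rw [← kapR_int (n := n) hθ, ← integral_sub_left_eq_self (fun a => kapR θ a) volume x]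
    refine integral_mono (hi.indicator isClosed_closedBall.measurableSet) hi fun a => ?_
    exact Set.indicator_le_self' (fun _ _ => kapR_nonneg hθ _) _
  · rw [chi_apply, ← integral_complex_ofReal]
    congr 1; ext a; exact h a

lemma chi_tsupp {ρ θ R : ℝ} (hθ : 0 < θ) (hR : ρ + θ / 2 < R) :
    tsupport (chi (n := n) ρ θ) ⊆ ball 0 R := by
  refine (closure_minimal ?_ (isClosed_closedBall (x := (0 : Eucl n)) (ε := ρ + θ / 2))).trans
    (Metric.closedBall_subset_ball hR)
  intro x hx
  by_contra hc
  rw [mem_closedBall_zero_iff] at hc; push Not at hc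
  exact hx (chi_zero hθ hc.le)

lemma isP_add_smul {A : Eucl n →L[ℝ] Eucl n} (hA : IsP A) {c : ℝ} (hc : 0 ≤ c) :
    IsP (A + c • ContinuousLinearMap.id ℝ (Eucl n)) := isP_add hA (isP_smul_id hc)

lemma quadF_add_smul (A : Eucl n →L[ℝ] Eucl n) (c : ℝ) (x : Eucl n) :
    quadF (A + c • ContinuousLinearMap.id ℝ (Eucl n)) x = quadF A x + c * ‖x‖ ^ 2 / 2 := by
  rw [quadF_add, quadF_smul_id]

lemma buildG (A : PM n) (g : ConvFn n) {ρ δ : ℝ} (hδ : 0 < δ) (hδ1 : δ ≤ 1 / 10) (hρ : 0 < ρ)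
    (herr : ∀ x, ‖x‖ ≤ 2 * ρ → |g.1 x - quadF A.1 x| ≤ δ ^ 3 * ρ ^ 2) :
    ∃ G : ConvFn n,
      (∀ x, quadF (A.1 + (2 * δ ^ 2) • ContinuousLinearMap.id ℝ (Eucl n)) x ≤ G.1 x) ∧
      (∀ x, G.1 x ≤ quadF (A.1 + (2 * δ ^ 2) • ContinuousLinearMap.id ℝ (Eucl n)) x + 2 * ρ ^ 2) ∧
      (∀ x, (1 + 3 * δ) * ρ ≤ ‖x‖ →
        G.1 x = quadF (A.1 + (2 * δ ^ 2) • ContinuousLinearMap.id ℝ (Eucl n)) x) ∧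
      (∀ x, ‖x‖ < (1 + 2 * δ) * ρ → G.1 x = g.1 x + δ ^ 2 * (1 + 5 * δ / 2) ^ 2 * ρ ^ 2) ∧
      (∀ x, ‖x‖ ≤ 2 * ρ →
        |G.1 x - δ ^ 2 * (1 + 5 * δ / 2) ^ 2 * ρ ^ 2 - quadF A.1 x| ≤ 4 * δ ^ 2 * ρ ^ 2) := by
  set B := A.1 + (2 * δ ^ 2) • ContinuousLinearMap.id ℝ (Eucl n) with hB
  have hBP : IsP B := isP_add_smul A.2 (by positivity)
  have hBx : ∀ x, quadF B x = quadF A.1 x + δ ^ 2 * ‖x‖ ^ 2 := fun x => by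
    rw [hB, quadF_add_smul]; ring
  set m := δ ^ 2 * (1 + 5 * δ / 2) ^ 2 * ρ ^ 2 with hm
  have hg' : ∀ x, (addAffine g m 0).1 x = g.1 x + m := fun x => by
    rw [addAffine_apply, inner_zero_left, add_zero]
  have hd3 : δ ^ 3 ≤ δ ^ 2 * (1 / 10) := by
    rw [pow_succ]; gcongr
  have hρ2 : 0 < ρ ^ 2 := by positivity
  have hcmp1 : ∀ x, (1 + 3 * δ) * ρ ≤ ‖x‖ → ‖x‖ ≤ 2 * ρ → (addAffine g m 0).1 x ≤ (qd ⟨B, hBP⟩).1 x := by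
    intro x h1 h2
    rw [hg', qd_apply, hBx]
    have h3 := (abs_le.1 (herr x h2)).2
    have h4 : ((1 + 3 * δ) * ρ) ^ 2 ≤ ‖x‖ ^ 2 := by gcongr
    have h5 : m + δ ^ 3 * ρ ^ 2 ≤ δ ^ 2 * ((1 + 3 * δ) * ρ) ^ 2 := by
      rw [hm]
      have : 0 ≤ δ ^ 2 * ρ ^ 2 * (δ ^ 2 * (11 / 4)) := by positivity
      nlinarith
    have h6 : δ ^ 2 * ((1 + 3 * δ) * ρ) ^ 2 ≤ δ ^ 2 * ‖x‖ ^ 2 := by gcongr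
    linarith
  have hcmp2 : ∀ x, ‖x‖ < (1 + 2 * δ) * ρ → (qd ⟨B, hBP⟩).1 x ≤ (addAffine g m 0).1 x := by
    intro x h1
    rw [hg', qd_apply, hBx]
    have h2 : ‖x‖ ≤ 2 * ρ := h1.le.trans (by gcongr; linarith)
    have h3 := (abs_le.1 (herr x h2)).1
    have h4 : ‖x‖ ^ 2 ≤ ((1 + 2 * δ) * ρ) ^ 2 := by gcongr
    have h5 : δ ^ 2 * ((1 + 2 * δ) * ρ) ^ 2 + δ ^ 3 * ρ ^ 2 ≤ m := by
      rw [hm]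
      have : 0 ≤ δ ^ 2 * ρ ^ 2 * (δ ^ 2 * (9 / 4)) := by positivity
      nlinarith
    have h6 : δ ^ 2 * ‖x‖ ^ 2 ≤ δ ^ 2 * ((1 + 2 * δ) * ρ) ^ 2 := by gcongr
    linarith
  obtain ⟨G, hG1, hG2⟩ := glue (addAffine g m 0) (qd ⟨B, hBP⟩) (R1 := (1 + 3 * δ) * ρ) (R2 := 2 * ρ)
    (by gcongr; linarith) hcmp1
  have hm0 : 0 ≤ m := by positivity
  have hm1 : m ≤ 2 * δ ^ 2 * ρ ^ 2 := by
    have : (1 + 5 * δ / 2) ^ 2 ≤ 2 := by nlinarith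
    calc m ≤ δ ^ 2 * 2 * ρ ^ 2 := by rw [hm]; gcongr
      _ = _ := by ring
  have hd2 : δ ^ 2 ≤ 1 / 100 := by nlinarith
  refine ⟨G, fun x => ?_, fun x => ?_, fun x hx => ?_, fun x hx => ?_, fun x hx => ?_⟩
  · rcases le_or_gt ‖x‖ (2 * ρ) with h | h
    · rw [hG1 x h]; exact le_max_left _ _
    · rw [hG2 x (le_trans (by gcongr; linarith) h.le)]; rfl
  · rcases le_or_gt ‖x‖ (2 * ρ) with h | h
    · rw [hG1 x h]
      refine max_le ?_ ?_
      · rw [qd_apply]; change quadF B x ≤ _; linarith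
      · rw [hg', hBx]
        have h3 := (abs_le.1 (herr x h)).2
        have : 0 ≤ δ ^ 2 * ‖x‖ ^ 2 := by positivity
        nlinarith
    · rw [hG2 x (le_trans (by gcongr; linarith) h.le), qd_apply]
      change quadF B x ≤ _; linarith
  · rw [hG2 x hx]; rfl
  · rw [hG1 x (hx.le.trans (by gcongr; linarith)), max_eq_right (hcmp2 x hx), hg']
  · rw [hG1 x hx, hg', qd_apply]
    change |max (quadF B x) _ - _ - _| ≤ _
    have h3 := abs_le.1 (herr x hx)
    have hx2 : ‖x‖ ^ 2 ≤ (2 * ρ) ^ 2 := by gcongr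
    have h6 : δ ^ 2 * ‖x‖ ^ 2 ≤ δ ^ 2 * (2 * ρ) ^ 2 := by gcongr
    have h7 : δ ^ 3 * ρ ^ 2 ≤ δ ^ 2 * (1 / 10) * ρ ^ 2 := by gcongr
    have h8 : 0 < δ ^ 2 * ρ ^ 2 := by positivity
    rw [abs_le]
    constructor
    · have := le_max_right (quadF B x) (g.1 x + m)
      linarith
    · have : max (quadF B x) (g.1 x + m) ≤ quadF A.1 x + m + 4 * δ ^ 2 * ρ ^ 2 := by
        refine max_le ?_ ?_
        · rw [hBx]; linarith
        · linarith
      linarith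
end

section
variable {n d k : ℕ} {Ψ : ConvFn n → RadonMeasure n}

lemma quadF_tangent {A : Eucl n →L[ℝ] Eucl n} (hA : IsP A) (a x : Eucl n) :
    quadF A (a + x) = quadF A a + ⟪A a, x⟫ + quadF A x := by
  have := quadF_sub hA x (-a)
  rw [sub_neg_eq_add, add_comm x a] at this
  rw [this]
  have e : quadF A (-a) = quadF A a := by simp [quadF]
  rw [e, map_neg, inner_neg_left]; ring

lemma annulus (hΨ : MemPdLV d Ψ) (htr : TrInv Ψ) (N M : ℝ) : ∃ C ρ0 : ℝ, 0 ≤ C ∧ 0 < ρ0 ∧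
    ∀ (A : PM n) (s : ℝ) (v : Eucl n) (δ ρ : ℝ) (H : ConvFn n), ‖A.1‖ ≤ N → |s| ≤ M → ‖v‖ ≤ M →
      0 < δ → δ ≤ 1 / 10 → 0 < ρ → ρ < ρ0 →
      (∀ x, ‖x‖ ≤ 2 * ρ → |H.1 x - (quadF A.1 x + (s + ⟪v, x⟫))| ≤ 4 * δ ^ 2 * ρ ^ 2) →
      ‖(Ψ H).1 (chi ((1 + 5 * δ) * ρ) (δ * ρ)) - (Ψ H).1 (chi ρ (δ * ρ))‖ ≤
        C * ((1 + 5 * δ) ^ n - 1) * ρ ^ n := by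
  obtain ⟨C, ρ1, hC, hρ1, hst⟩ := star hΨ htr (N * 4 + 4) (2 * M + N)
  have hI := tI_pos n
  set ω := volume.real (ball (0 : Eucl n) 1) with hω
  refine ⟨C * (tI n)⁻¹ * ω, min ρ1 (1 / 2), by positivity, by positivity, ?_⟩
  intro A s v δ ρ H hA hs hv hδ hδ1 hρ hρ0 hH
  have hθ : 0 < δ * ρ := by positivity
  have hρ12 : ρ < 1 / 2 := hρ0.trans_le (min_le_right _ _)
  have hθρ : δ * ρ < ρ1 := by
    have : δ * ρ ≤ 1 * ρ := by gcongr; linarith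
    linarith [hρ0.trans_le (min_le_left _ _)]
  have hN0 := (norm_nonneg _).trans hA
  have hM0 := (norm_nonneg _).trans hv
  have hpt : ∀ a : Eucl n, ‖a‖ ≤ (1 + 5 * δ) * ρ →
      ‖(Ψ H).1 (trCc (kap (δ * ρ)) a)‖ ≤ C * (tI n)⁻¹ := by
    intro a ha
    have ha1 : ‖a‖ ≤ 1 := ha.trans (by nlinarith)
    have := hst (δ * ρ) hθ hθρ H a (quadF A.1 a + (s + ⟪v, a⟫)) (v + A.1 a) (fun x hx => by
      have h1 : ‖a + x‖ ≤ 2 * ρ := by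
        refine (norm_add_le _ _).trans ?_
        nlinarith
      have h2 := hH _ h1
      rw [quadF_tangent A.2, inner_add_right] at h2
      rw [inner_add_left]
      have h3 := quad_le A.1 x
      have h4 : ‖A.1‖ * ‖x‖ ^ 2 ≤ N * (2 * (δ * ρ)) ^ 2 := by gcongr
      calc _ = |(H.1 (a + x) - (quadF A.1 a + ⟪A.1 a, x⟫ + quadF A.1 x + (s + (⟪v, a⟫ + ⟪v, x⟫))))
            + quadF A.1 x| := by congr 1; ring
        _ ≤ 4 * δ ^ 2 * ρ ^ 2 + N * (2 * (δ * ρ)) ^ 2 :=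
            (abs_add_le _ _).trans (add_le_add h2 (h3.trans h4))
        _ = _ := by ring) (by
      have h1 := quad_le A.1 a
      have h2 := abs_real_inner_le_norm v a
      have h3 : ‖v‖ * ‖a‖ ≤ M * 1 := by gcongr
      have h4 : ‖A.1‖ * ‖a‖ ^ 2 ≤ N * 1 ^ 2 := by gcongr
      calc _ ≤ |quadF A.1 a| + (|s| + |⟪v, a⟫|) :=
            (abs_add_le _ _).trans (add_le_add le_rfl (abs_add_le _ _))
        _ ≤ _ := by linarith) (by
      have h1 := A.1.le_opNorm a
      have h4 : ‖A.1‖ * ‖a‖ ≤ N * 1 := by gcongr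
      refine (norm_add_le _ _).trans ?_
      linarith) (kap (δ * ρ)) (((δ * ρ) ^ n)⁻¹ * (tI n)⁻¹) (by positivity)
      (kap_tsupp hθ) (fun x => by rw [kap_norm hθ]; exact kapR_le hθ x)
    refine this.trans (le_of_eq ?_)
    field_simp
  have hle : ρ ≤ (1 + 5 * δ) * ρ := by nlinarith
  have hrad : ∀ r : ℝ, (Ψ H).1 (chi r (δ * ρ)) = ∫ a, indB n r a * (Ψ H).1 (trCc (kap (δ * ρ)) a) :=
    fun r => radon_integral _ _ _ _ (indB_int r) (fun _ => indB_zero) (chi_apply r _)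
  have hii : ∀ r : ℝ, r ≤ (1 + 5 * δ) * ρ →
      Integrable fun a => indB n r a * (Ψ H).1 (trCc (kap (δ * ρ)) a) := by
    intro r hr
    refine Integrable.mono' ((indB_int (n := n) r).norm.mul_const (C * (tI n)⁻¹))
      ((indB_int r).aestronglyMeasurable.mul (radon_tr_cont _ _).aestronglyMeasurable)
      (ae_of_all _ fun a => ?_)
    rw [norm_mul]
    rcases le_or_gt ‖a‖ r with h | h
    · exact mul_le_mul_of_nonneg_left (hpt a (h.trans hr)) (norm_nonneg _)
    · simp [indB_zero h]
  rw [hrad, hrad, ← integral_sub (hii _ le_rfl) (hii _ hle)]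
  set S := closedBall (0 : Eucl n) ((1 + 5 * δ) * ρ) \ closedBall 0 ρ with hS
  have hSm : MeasurableSet S := isClosed_closedBall.measurableSet.diff
    isClosed_closedBall.measurableSet
  have hvol : ∀ r : ℝ, 0 ≤ r → volume.real (closedBall (0 : Eucl n) r) = r ^ n * ω := by
    intro r hr
    rw [Measure.addHaar_real_closedBall _ _ hr, finrank_euclideanSpace_fin]
  have hSv : volume.real S = (((1 + 5 * δ) ^ n - 1) * ρ ^ n) * ω := by
    rw [hS, measureReal_sdiff (Metric.closedBall_subset_closedBall hle)
      isClosed_closedBall.measurableSet measure_closedBall_lt_top.ne, hvol _ hρ.le,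
      hvol _ (by positivity), mul_pow]; ring
  have hfin : ‖∫ a, (indB n ((1 + 5 * δ) * ρ) a * (Ψ H).1 (trCc (kap (δ * ρ)) a) -
      indB n ρ a * (Ψ H).1 (trCc (kap (δ * ρ)) a))‖ ≤ ∫ a, S.indicator (fun _ => C * (tI n)⁻¹) a := by
    refine norm_integral_le_of_norm_le ?_ (ae_of_all _ fun a => ?_)
    · refine IntegrableOn.integrable_indicator (integrableOn_const ?_) hSm
      exact ((measure_mono Set.sdiff_subset).trans_lt measure_closedBall_lt_top).ne
    · by_cases h1 : ‖a‖ ≤ (1 + 5 * δ) * ρ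
      · by_cases h2 : ‖a‖ ≤ ρ
        · rw [indB_one h1, indB_one h2, sub_self, norm_zero]
          exact indicator_nonneg (fun _ _ => by positivity) _
        · push Not at h2
          rw [indB_one h1, indB_zero h2, indicator_of_mem (by
            simp only [hS, Set.mem_sdiff, mem_closedBall_zero_iff]; exact ⟨h1, not_le.2 h2⟩)]
          simpa using hpt a h1
      · push Not at h1
        rw [indB_zero h1, indB_zero (hle.trans_lt h1)]
        simp only [zero_mul, sub_self, norm_zero]
        exact indicator_nonneg (fun _ _ => by positivity) _
  refine hfin.trans (le_of_eq ?_)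
  rw [integral_indicator_const _ hSm, hSv, smul_eq_mul]; ring

def rh (j : ℕ) : ℝ := rj j / 2

lemma rh_pos (j : ℕ) : 0 < rh j := half_pos (rj_pos j)
lemma rh_le (j : ℕ) : rh j ≤ 1 / 2 := by unfold rh; linarith [rj_le j]
lemma rh_lim : Tendsto rh atTop (𝓝 0) := by
  have := rj_lim.div_const 2; rw [zero_div] at this; exact this

lemma lemN (hΨ : MemPdLV d Ψ) (htr : TrInv Ψ) (N M : ℝ) : ∃ C : ℝ, 0 ≤ C ∧
    ∀ (A : PM n) (s : ℝ) (v : Eucl n) (δ : ℝ) (g : ConvFn n), ‖A.1‖ ≤ N → |s| ≤ M → ‖v‖ ≤ M →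
      0 < δ → δ ≤ 1 / 10 →
      (∀ ε > 0, ∀ᶠ x in 𝓝 0, |g.1 x - quadF A.1 x| ≤ ε * ‖x‖ ^ 2) →
      ∀ᶠ j in atTop, ‖(Ψ (addAffine g s v)).1 (chi (rh j) (δ * rh j)) -
        (Ψ (addAffine (qd A) s v)).1 (chi (rh j) (δ * rh j))‖ ≤
        (C * ((1 + 5 * δ) ^ n - 1) + δ) * rh j ^ n := by
  obtain ⟨C, ρ0, hC, hρ0, han⟩ := annulus hΨ htr N M
  refine ⟨2 * C, by positivity, fun A s v δ g hA hs hv hδ hδ1 hg => ?_⟩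
  obtain ⟨r, hr, hgr⟩ := Metric.eventually_nhds_iff.1 (hg (δ ^ 3 / 4) (by positivity))
  have hev : ∀ᶠ j in atTop, rh j < ρ0 ∧ 2 * rh j < r :=
    (rh_lim.eventually_lt_const hρ0).and (by
      have := rh_lim.const_mul 2; rw [mul_zero] at this
      exact this.eventually_lt_const hr)
  obtain ⟨J, hJ⟩ := eventually_atTop.1 hev
  have hbase : ∀ ρ, 0 < ρ → 2 * ρ < r → ∀ x : Eucl n, ‖x‖ ≤ 2 * ρ →
      |g.1 x - quadF A.1 x| ≤ δ ^ 3 * ρ ^ 2 := by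
    intro ρ hρ h1 x hx
    refine (hgr (by rw [dist_zero_right]; linarith)).trans ?_
    calc δ ^ 3 / 4 * ‖x‖ ^ 2 ≤ δ ^ 3 / 4 * (2 * ρ) ^ 2 := by gcongr
      _ = _ := by ring
  have hG := fun j => buildG A g hδ hδ1 (rh_pos (j + J)) (hbase _ (rh_pos _) (hJ (j + J) (by omega)).2)
  have hG' := fun j => buildG A (qd A) hδ hδ1 (rh_pos (j + J)) (fun x _ => by
    rw [qd_apply, sub_self, abs_zero]; have := rh_pos (j + J); positivity)
  choose G g1 g2 g3 g4 g5 using hG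
  choose G' g1' g2' g3' g4' g5' using hG'
  set m : ℕ → ℝ := fun j => δ ^ 2 * (1 + 5 * δ / 2) ^ 2 * rh (j + J) ^ 2 with hm
  have hlJ : Tendsto (fun j => rh (j + J)) atTop (𝓝 0) := (tendsto_add_atTop_iff_nat J).2 rh_lim
  have hl2 : Tendsto (fun j => 2 * rh (j + J) ^ 2) atTop (𝓝 0) := by
    simpa using (hlJ.pow 2).const_mul 2
  have hml : Tendsto m atTop (𝓝 0) := by
    simpa [hm] using (hlJ.pow 2).const_mul (δ ^ 2 * (1 + 5 * δ / 2) ^ 2)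
  have hPS : ∀ j x, (2 * rh (j + J)) ≤ ‖x‖ → (1 + 3 * δ) * rh (j + J) ≤ ‖(x : Eucl n)‖ :=
    fun j x hx => le_trans (by have := rh_pos (j + J); gcongr; linarith) hx
  have hp2 := per2 hΨ htr (isP_add_smul A.2 (show 0 ≤ 2 * δ ^ 2 by positivity))
    (R := fun j => 2 * rh (j + J)) (R' := fun j => (1 + 4 * δ) * rh (j + J))
    (R'' := fun j => (1 + 3 * δ) * rh (j + J)) (e := fun j => 2 * rh (j + J) ^ 2) (G := G) (G' := G')
    ⟨g1, g2, fun j x hx => g3 j x (hPS j x hx)⟩ ⟨g1', g2', fun j x hx => g3' j x (hPS j x hx)⟩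
    (fun j => by have := rh_pos (j + J); positivity) (fun j => by have := rh_le (j + J); linarith)
    (fun j => by positivity) (s := fun j => s - m j) (v := fun _ => v) hl2
    (by simpa using hml.const_sub s) tendsto_const_nhds
    (fun j => by have := rh_pos (j + J); gcongr; linarith)
    (fun j => by have := rh_pos (j + J); gcongr; linarith)
    (fun j x hx => by rw [g3 j x hx.le, g3' j x hx.le])
    (φ := fun j => chi ((1 + 5 * δ) * rh (j + J)) (δ * rh (j + J)))
    (fun j => by
      have := rh_pos (j + J)
      exact chi_tsupp (by positivity) (by nlinarith))
    (fun j x hx => by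
      have := rh_pos (j + J)
      exact chi_one (by positivity) (by nlinarith))
  have hloc : ∀ (h : ConvFn n) (H : ℕ → ConvFn n), (∀ j x, ‖x‖ < (1 + 2 * δ) * rh (j + J) →
      (H j).1 x = h.1 x + m j) → ∀ j, (Ψ (addAffine (H j) (s - m j) v)).1 (chi (rh (j + J)) (δ * rh (j + J)))
        = (Ψ (addAffine h s v)).1 (chi (rh (j + J)) (δ * rh (j + J))) := by
    intro h H hH j
    have := rh_pos (j + J)
    refine hΨ.1 _ _ (ball 0 ((1 + 2 * δ) * rh (j + J))) isOpen_ball (fun x hx => ?_) _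
      (chi_tsupp (by positivity) (by nlinarith))
    rw [mem_ball_zero_iff] at hx
    rw [addAffine_apply, addAffine_apply, hH j x hx]; ring
  have hann : ∀ (H : ℕ → ConvFn n), (∀ j x, ‖x‖ ≤ 2 * rh (j + J) →
      |(H j).1 x - m j - quadF A.1 x| ≤ 4 * δ ^ 2 * rh (j + J) ^ 2) → ∀ j,
      ‖(Ψ (addAffine (H j) (s - m j) v)).1 (chi ((1 + 5 * δ) * rh (j + J)) (δ * rh (j + J))) -
        (Ψ (addAffine (H j) (s - m j) v)).1 (chi (rh (j + J)) (δ * rh (j + J)))‖ ≤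
        C * ((1 + 5 * δ) ^ n - 1) * rh (j + J) ^ n := by
    intro H hH j
    refine han A s v δ (rh (j + J)) _ hA hs hv hδ hδ1 (rh_pos _) (hJ (j + J) (by omega)).1
      fun x hx => ?_
    refine le_trans (le_of_eq ?_) (hH j x hx)
    rw [addAffine_apply]; congr 1; ring
  have h1 := hp2.eventually_lt_const (show (0 : ℝ) < δ / 2 ^ n by positivity)
  rw [← map_add_atTop_eq_nat J, eventually_map]
  filter_upwards [h1] with j hj
  have hρ := rh_pos (j + J)
  rw [div_lt_iff₀ (by positivity), mul_pow, ← mul_assoc, div_mul_cancel₀ _ (by positivity)] at hj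
  have a1 := hann G g5 j
  have a2 := hann G' g5' j
  rw [hloc g G g4 j] at a1
  rw [hloc (qd A) G' g4' j] at a2
  generalize (Ψ (addAffine g s v)).1 (chi (rh (j + J)) (δ * rh (j + J))) = u1 at *
  generalize (Ψ (addAffine (qd A) s v)).1 (chi (rh (j + J)) (δ * rh (j + J))) = u2 at *
  generalize (Ψ (addAffine (G j) (s - m j) v)).1
    (chi ((1 + 5 * δ) * rh (j + J)) (δ * rh (j + J))) = w1 at *
  generalize (Ψ (addAffine (G' j) (s - m j) v)).1
    (chi ((1 + 5 * δ) * rh (j + J)) (δ * rh (j + J))) = w2 at *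
  calc ‖u1 - u2‖ = ‖-(w1 - u1) + (w1 - w2) + (w2 - u2)‖ := by congr 1; ring
    _ ≤ ‖w1 - u1‖ + ‖w1 - w2‖ + ‖w2 - u2‖ := by
        refine (norm_add₃_le).trans ?_
        rw [norm_neg]
    _ ≤ _ := by linarith
end

section
variable {n d k : ℕ} {Ψ : ConvFn n → RadonMeasure n}

structure Jet (f : ConvFn n) (v : Eucl n → Eucl n) (A : Eucl n → PM n) : Prop where
  hv : Continuous v
  hA : Continuous A
  ht : ∀ R ε : ℝ, 0 < ε → ∃ r > 0, ∀ a x : Eucl n, ‖a‖ ≤ R → ‖x‖ ≤ r →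
    |f.1 (a + x) - (f.1 a + ⟪v a, x⟫) - quadF (A a).1 x| ≤ ε * ‖x‖ ^ 2

lemma chi_avg {δ : ℝ} (hδ : 0 < δ) (hδ1 : δ ≤ 1 / 10) (j : ℕ) : ∃ m : ℝ,
    volume.real (ball (0 : Eucl n) 1) * (rh j / 2) ^ n ≤ m ∧
    (∫ x, chi (n := n) (rh j) (δ * rh j) x = m) ∧ ∫ x, ‖chi (n := n) (rh j) (δ * rh j) x‖ = m := by
  have hr := rh_pos j
  have hθ : 0 < δ * rh j := by positivity
  choose t ht0 ht1 ht using fun x : Eucl n => chi_real (ρ := rh j) hθ x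
  have hi : Integrable t := by
    have := (cc_integrable (chi (n := n) (rh j) (δ * rh j))).re
    refine this.congr (ae_of_all _ fun x => ?_)
    simp [ht]
  refine ⟨∫ x, t x, ?_, ?_, ?_⟩
  · have h1 : volume.real (closedBall (0 : Eucl n) (rh j / 2)) =
        (rh j / 2) ^ n * volume.real (ball (0 : Eucl n) 1) := by
      rw [Measure.addHaar_real_closedBall _ _ (by positivity), finrank_euclideanSpace_fin]
    rw [mul_comm, ← h1, ← integral_indicator_one isClosed_closedBall.measurableSet]
    refine integral_mono (IntegrableOn.integrable_indicator (integrableOn_const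
      measure_closedBall_lt_top.ne) isClosed_closedBall.measurableSet) hi fun x => ?_
    by_cases h : x ∈ closedBall (0 : Eucl n) (rh j / 2)
    · rw [indicator_of_mem h]
      rw [mem_closedBall_zero_iff] at h
      have : chi (rh j) (δ * rh j) x = 1 := chi_one hθ (by nlinarith)
      rw [ht] at this
      exact (by exact_mod_cast this.symm : (1 : ℝ) = t x).le
    · rw [indicator_of_notMem h]; exact ht0 x
  · simp_rw [ht]; exact integral_complex_ofReal
  · simp_rw [ht, norm_real, norm_of_nonneg (ht0 _)]

lemma chi_pt {δ : ℝ} (hδ : 0 < δ) (hδ1 : δ ≤ 1 / 10) {p : Eucl n → ℂ} (hp : Continuous p) {ε : ℝ}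
    (hε : 0 < ε) : ∀ᶠ j in atTop, ‖(∫ x, chi (n := n) (rh j) (δ * rh j) x * p x) -
      (∫ x, chi (n := n) (rh j) (δ * rh j) x) * p 0‖ ≤ ε * ∫ x, ‖chi (n := n) (rh j) (δ * rh j) x‖ := by
  obtain ⟨r, hr, h⟩ := Metric.continuousAt_iff.1 hp.continuousAt ε hε
  have h2 : Tendsto (fun j => 2 * rh j) atTop (𝓝 0) := by simpa using rh_lim.const_mul 2
  filter_upwards [h2.eventually_lt_const hr] with j hj
  have hr := rh_pos j
  set c := chi (n := n) (rh j) (δ * rh j) with hc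
  have hi := cc_integrable c
  have hz : ∀ x, r ≤ ‖x‖ → c x = 0 := fun x hx => chi_zero (by positivity) (by nlinarith)
  have hi2 : Integrable fun x => c x * p x :=
    (c.continuous.mul hp).integrable_of_hasCompactSupport c.hasCompactSupport'.mul_right
  rw [← integral_mul_const, ← integral_sub hi2 (hi.mul_const _), ← integral_const_mul]
  refine norm_integral_le_of_norm_le (hi.norm.const_mul _) (ae_of_all _ fun x => ?_)
  rw [← mul_sub, norm_mul, mul_comm ε]
  rcases lt_or_ge ‖x‖ r with h1 | h1
  · have := h (x := x) (by rwa [dist_zero_right])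
    rw [dist_eq_norm] at this
    gcongr
  · simp [hz x h1]

lemma jet_close (hΨ : MemPdLV d Ψ) (htr : TrInv Ψ) {f : ConvFn n} {v : Eucl n → Eucl n}
    {A : Eucl n → PM n} (hJ : Jet f v A) (φ : Cc n) : ∃ C : ℝ, 0 ≤ C ∧ ∀ δ, 0 < δ → δ ≤ 1 / 10 →
    ‖(Ψ f).1 φ - ∫ x, φ x * P0 Ψ (A x) (f.1 x) (v x)‖ ≤ C * ((1 + 5 * δ) ^ n - 1 + δ) := by
  obtain ⟨R, hR, hφ⟩ := cc_supp φ
  have hpc : Continuous fun x => P0 Ψ (A x) (f.1 x) (v x) := P0_cont hΨ htr hJ.hA f.1.continuous hJ.hv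
  have hbd : ∀ {Y : Type} [NormedAddCommGroup Y] (g : Eucl n → Y), Continuous g →
      ∃ C, 0 ≤ C ∧ ∀ a, ‖a‖ ≤ R → ‖g a‖ ≤ C := fun g hg => by
    obtain ⟨C, hC⟩ := (isCompact_closedBall (0 : Eucl n) R).exists_bound_of_continuousOn hg.continuousOn
    exact ⟨max C 0, le_max_right _ _, fun a ha => (hC a (by simpa using ha)).trans (le_max_left _ _)⟩
  obtain ⟨N, hN0, hN⟩ := hbd (fun a => (A a).1) (continuous_subtype_val.comp hJ.hA)
  obtain ⟨M1, hM10, hM1⟩ := hbd v hJ.hv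
  obtain ⟨M2, hM20, hM2⟩ := hbd f.1 f.1.continuous
  obtain ⟨B, hB0, hB⟩ := hbd _ hpc
  obtain ⟨C1, hC1, hlN⟩ := lemN hΨ htr N (M1 + M2)
  obtain ⟨C2, ρ0, hC2, hρ0, hst⟩ := star hΨ htr (4 * (N + 1)) (M1 + M2)
  obtain ⟨r0, hr0, hT0⟩ := hJ.ht R 1 one_pos
  set ω := volume.real (ball (0 : Eucl n) 1) with hω
  have hω0 : 0 < ω := by
    rw [hω, measureReal_def]
    exact ENNReal.toReal_pos (Metric.measure_ball_pos _ _ one_pos).ne' measure_ball_lt_top.ne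
  set q : ℝ := 2 ^ n / ω with hq
  have hq0 : 0 ≤ q := by positivity
  set L := ∫ x, ‖φ x‖ with hL
  have hL0 : 0 ≤ L := integral_nonneg fun _ => norm_nonneg _
  refine ⟨(q * (C1 + 1) + 1) * L, by positivity, fun δ hδ hδ1 => ?_⟩
  choose m hm1 hm2 hm3 using fun j => chi_avg (n := n) hδ hδ1 j
  have hm : ∀ j, 0 < m j := fun j => lt_of_lt_of_le (by have := rh_pos j; positivity) (hm1 j)
  have hmc : ∀ j, (m j : ℂ) ≠ 0 := fun j => by exact_mod_cast (hm j).ne'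
  have hmr : ∀ j, rh j ^ n / m j ≤ q := fun j => by
    rw [div_le_iff₀ (hm j), hq, div_mul_eq_mul_div, le_div_iff₀ hω0]
    have := hm1 j
    rw [div_pow, mul_div_assoc', div_le_iff₀ (by positivity)] at this
    linarith
  set χ : ℕ → Cc n := fun j => (m j : ℂ)⁻¹ • chi (rh j) (δ * rh j) with hχ
  have hχa : ∀ j x, χ j x = (m j : ℂ)⁻¹ * chi (rh j) (δ * rh j) x := fun j x => rfl
  have hχΨ : ∀ j a, (Ψ f).1 (trCc (χ j) a) =
      (m j : ℂ)⁻¹ * (Ψ f).1 (trCc (chi (rh j) (δ * rh j)) a) := fun j a => by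
    rw [← smul_eq_mul, ← map_smul]; congr 1
  have hlim := cconv_tendsto hΨ.2.1 (f := f) φ (χ := χ) (r := fun j => 2 * rh j) (C := 1)
    (by simpa using rh_lim.const_mul 2) (fun j => by linarith [rh_le j])
    (fun j => by
      simp_rw [hχa, norm_mul]
      rw [integral_const_mul, hm3, norm_inv, norm_real, norm_of_nonneg (hm j).le,
        inv_mul_cancel₀ (hm j).ne'])
    (fun j => by
      simp_rw [hχa]
      rw [integral_const_mul, hm2, inv_mul_cancel₀ (hmc j)])
    (fun j y hy => by
      have := rh_pos j
      rw [hχa, chi_zero (by positivity) (by nlinarith), mul_zero])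
  set e : ℕ → Eucl n → ℝ := fun j a =>
    ‖(Ψ f).1 (trCc (χ j) a) - P0 Ψ (A a) (f.1 a) (v a)‖ with he
  have hec : ∀ j, Continuous (e j) := fun j => ((radon_tr_cont _ _).sub hpc).norm
  set K := q * (C1 * ((1 + 5 * δ) ^ n - 1) + δ) + δ with hK
  -- pointwise
  have hpt : ∀ a, ‖a‖ ≤ R → ∀ᶠ j in atTop, e j a ≤ K := by
    intro a ha
    have h1 := hlN (A a) (f.1 a) (v a) δ (addAffine (trF f (-a)) (-f.1 a) (-v a)) (hN a ha)
      ((hM2 a ha).trans (by linarith)) ((hM1 a ha).trans (by linarith)) hδ hδ1 (fun ε hε => by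
        obtain ⟨r, hr, h⟩ := hJ.ht R ε hε
        filter_upwards [Metric.closedBall_mem_nhds (0 : Eucl n) hr] with x hx
        refine le_trans (le_of_eq ?_) (h a x ha (by simpa using hx))
        rw [addAffine_apply, trF_apply, inner_neg_left, sub_neg_eq_add, add_comm x]
        congr 1; ring)
    have h2 := chi_pt hδ hδ1 (p := fun x => P0 Ψ (A a) (f.1 a + quadF (A a).1 x + ⟪v a, x⟫) (v a + (A a).1 x))
      (P0_cont hΨ htr continuous_const ((continuous_const.add (quadF_cont _)).add (by fun_prop))
        (by fun_prop)) hδ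
    filter_upwards [h1, h2] with j h1 h2
    rw [← qd_jet_int hΨ htr, hm2, hm3] at h2
    have e1 : addAffine (addAffine (trF f (-a)) (-f.1 a) (-v a)) (f.1 a) (v a) = trF f (-a) :=
      conv_ext fun x => by
        rw [addAffine_apply, addAffine_apply, inner_neg_left]; ring
    have e2 : (Ψ (trF f (-a))).1 (chi (rh j) (δ * rh j)) =
        (Ψ f).1 (trCc (chi (rh j) (δ * rh j)) a) := by
      rw [← htr (-a) f]
      congr 1
      exact cc_ext fun x => by simp
    have e3 : P0 Ψ (A a) (f.1 a + quadF (A a).1 0 + ⟪v a, 0⟫) (v a + (A a).1 0) = P0 Ψ (A a) (f.1 a) (v a) := by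
      simp [quadF]
    rw [e1, e2] at h1
    rw [e3] at h2
    simp only [he]
    rw [hχΨ]
    generalize (Ψ f).1 (trCc (chi (rh j) (δ * rh j)) a) = u1 at *
    generalize (Ψ (addAffine (qd (A a)) (f.1 a) (v a))).1 (chi (rh j) (δ * rh j)) = u2 at *
    generalize P0 Ψ (A a) (f.1 a) (v a) = u3 at *
    have e4 : (m j : ℂ)⁻¹ * u1 - u3 = (m j : ℂ)⁻¹ * ((u1 - u2) + (u2 - m j * u3)) := by
      have := hmc j; field_simp; ring
    rw [e4, norm_mul, norm_inv, norm_real, norm_of_nonneg (hm j).le, inv_mul_le_iff₀ (hm j)]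
    refine (norm_add_le _ _).trans ((add_le_add h1 h2).trans ?_)
    have h5 := (div_le_iff₀ (hm j)).1 (hmr j)
    have h6 : 0 ≤ C1 * ((1 + 5 * δ) ^ n - 1) + δ := by
      have : (1 : ℝ) ≤ (1 + 5 * δ) ^ n := one_le_pow₀ (by linarith)
      have : 0 ≤ (1 + 5 * δ) ^ n - 1 := by linarith
      positivity
    have := mul_le_mul_of_nonneg_left h5 h6
    rw [hK]; linarith
  have h0K : 0 ≤ K := by
    have : (1 : ℝ) ≤ (1 + 5 * δ) ^ n := one_le_pow₀ (by linarith)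
    have : 0 ≤ (1 + 5 * δ) ^ n - 1 := by linarith
    positivity
  -- uniform bound
  have hub : ∀ᶠ j in atTop, ∀ a, ‖a‖ ≤ R → e j a ≤ C2 * 2 ^ n * q + B := by
    have h2 : Tendsto (fun j => 4 * rh j) atTop (𝓝 0) := by simpa using rh_lim.const_mul 4
    filter_upwards [h2.eventually_lt_const hρ0, h2.eventually_lt_const hr0] with j hj1 hj2 a ha
    have hr := rh_pos j
    have h1 := hst (2 * rh j) (by positivity) (by linarith) f a (f.1 a) (v a) (fun x hx => by
      have h3 := hT0 a x ha (by linarith)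
      have h4 := quad_le (A a).1 x
      have h5 : ‖(A a).1‖ * ‖x‖ ^ 2 ≤ N * ‖x‖ ^ 2 := by gcongr; exact hN a ha
      have h6 : ‖x‖ ^ 2 ≤ (2 * (2 * rh j)) ^ 2 := by gcongr
      have h7 := mul_le_mul_of_nonneg_left h6 (by linarith : 0 ≤ N + 1)
      rw [abs_le] at h3 h4 ⊢
      constructor <;> linarith) ((hM2 a ha).trans (by linarith)) ((hM1 a ha).trans (by linarith))
      (chi (rh j) (δ * rh j)) 1 zero_le_one (chi_tsupp (by positivity) (by nlinarith)) (fun x => by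
        obtain ⟨t, t0, t1, ht⟩ := chi_real (ρ := rh j) (show 0 < δ * rh j by positivity) x
        rw [ht, norm_real, norm_of_nonneg t0]; exact t1)
    refine (norm_sub_le _ _).trans (add_le_add ?_ (hB a ha))
    rw [hχΨ, norm_mul, norm_inv, norm_real, norm_of_nonneg (hm j).le]
    calc _ ≤ (m j)⁻¹ * (C2 * (2 * rh j) ^ n * 1) := by
          have := hm j; gcongr
      _ = C2 * 2 ^ n * (rh j ^ n / m j) := by rw [mul_pow]; field_simp
      _ ≤ _ := by have := hmr j; gcongr
  have hdct : Tendsto (fun j => ∫ a, ‖φ a‖ * max (e j a - K) 0) atTop (𝓝 (∫ _ : Eucl n, (0 : ℝ))) := by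
    refine tendsto_integral_filter_of_dominated_convergence
      (fun a => ‖φ a‖ * (C2 * 2 ^ n * q + B)) ?_ ?_ ((cc_integrable φ).norm.mul_const _) ?_
    · refine Eventually.of_forall fun j => Continuous.aestronglyMeasurable ?_
      have := hec j; have := φ.continuous; fun_prop
    · filter_upwards [hub] with j hj
      refine ae_of_all _ fun a => ?_
      rw [norm_mul, norm_norm]
      rcases le_or_gt ‖a‖ R with h | h
      · refine mul_le_mul_of_nonneg_left ?_ (norm_nonneg _)
        rw [norm_of_nonneg (le_max_right _ _)]
        exact max_le (by linarith [hj a h]) (by positivity)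
      · simp [hφ a h]
    · refine ae_of_all _ fun a => ?_
      rcases le_or_gt ‖a‖ R with h | h
      · refine tendsto_const_nhds.congr' ?_
        filter_upwards [hpt a h] with j hj
        rw [max_eq_right (by linarith), mul_zero]
      · simp [hφ a h]
  rw [integral_zero] at hdct
  have hmain : ‖(Ψ f).1 φ - ∫ x, φ x * P0 Ψ (A x) (f.1 x) (v x)‖ ≤ K * L := by
    refine le_of_tendsto_of_tendsto (hlim.sub_const _).norm (g := fun j => K * L +
      ∫ a, ‖φ a‖ * max (e j a - K) 0) (by simpa using hdct.const_add (K * L)) (Eventually.of_forall fun j => ?_)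
    have hcs : ∀ {g : Eucl n → ℂ}, Continuous g → Integrable fun x => φ x * g x := fun hg =>
      (φ.continuous.mul hg).integrable_of_hasCompactSupport φ.hasCompactSupport'.mul_right
    have hcs' : Integrable fun a => ‖φ a‖ * max (e j a - K) 0 :=
      (φ.continuous.norm.mul (((hec j).sub continuous_const).max continuous_const)).integrable_of_hasCompactSupport
        (φ.hasCompactSupport'.norm.mul_right)
    show ‖(∫ a, φ a * (Ψ f).1 (trCc (χ j) a)) - _‖ ≤ K * L + ∫ a, ‖φ a‖ * max (e j a - K) 0
    rw [← integral_sub (hcs (radon_tr_cont _ _)) (hcs hpc), hL, ← integral_const_mul,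
      ← integral_add ((cc_integrable φ).norm.const_mul _) hcs']
    refine norm_integral_le_of_norm_le (((cc_integrable φ).norm.const_mul _).add hcs') (ae_of_all _ fun a => ?_)
    rw [← mul_sub, norm_mul]
    show ‖φ a‖ * e j a ≤ K * ‖φ a‖ + _
    have := mul_le_mul_of_nonneg_left (le_max_left (e j a - K) 0) (norm_nonneg (φ a))
    linarith
  refine hmain.trans ?_
  have h1 : (1 : ℝ) ≤ (1 + 5 * δ) ^ n := one_le_pow₀ (by linarith)
  have h2 : K ≤ (q * (C1 + 1) + 1) * ((1 + 5 * δ) ^ n - 1 + δ) := by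
    have a1 : 0 ≤ q * C1 * δ := by positivity
    have a2 : 0 ≤ (q + 1) * ((1 + 5 * δ) ^ n - 1) := mul_nonneg (by positivity) (by linarith)
    rw [hK]; linarith
  calc K * L ≤ ((q * (C1 + 1) + 1) * ((1 + 5 * δ) ^ n - 1 + δ)) * L := by gcongr
    _ = _ := by ring

theorem jet_int (hΨ : MemPdLV d Ψ) (htr : TrInv Ψ) {f : ConvFn n} {v : Eucl n → Eucl n}
    {A : Eucl n → PM n} (hJ : Jet f v A) (φ : Cc n) :
    (Ψ f).1 φ = ∫ x, φ x * P0 Ψ (A x) (f.1 x) (v x) := by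
  obtain ⟨C, hC, h⟩ := jet_close hΨ htr hJ φ
  rw [← sub_eq_zero, ← norm_le_zero_iff]
  have hl : Tendsto (fun δ : ℝ => C * ((1 + 5 * δ) ^ n - 1 + δ)) (𝓝[>] 0) (𝓝 0) := by
    have : Continuous fun δ : ℝ => C * ((1 + 5 * δ) ^ n - 1 + δ) := by fun_prop
    simpa using (this.tendsto 0).mono_left (nhdsWithin_le_nhds (s := Set.Ioi 0))
  refine ge_of_tendsto hl ?_
  filter_upwards [Ioc_mem_nhdsGT (show (0 : ℝ) < 1 / 10 by norm_num)] with δ hδ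
  exact h δ hδ.1 hδ.2
end

section
variable {n d k : ℕ} {Ψ : ConvFn n → RadonMeasure n}

def tD (n : ℕ) : (Eucl n →L[ℝ] ℝ) ≃L[ℝ] Eucl n :=
  (InnerProductSpace.toDual ℝ (Eucl n)).symm.toContinuousLinearEquiv

lemma tD_inner (l : Eucl n →L[ℝ] ℝ) (x : Eucl n) : ⟪tD n l, x⟫ = l x :=
  InnerProductSpace.toDual_symm_apply

def vG (f : Eucl n → ℝ) (a : Eucl n) : Eucl n := tD n (fderiv ℝ f a)

def aH (f : Eucl n → ℝ) (a : Eucl n) : Eucl n →L[ℝ] Eucl n :=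
  (tD n).toContinuousLinearMap ∘L fderiv ℝ (fderiv ℝ f) a

lemma vG_inner (f : Eucl n → ℝ) (a x : Eucl n) : ⟪vG f a, x⟫ = fderiv ℝ f a x := tD_inner _ _

lemma aH_inner (f : Eucl n → ℝ) (a x y : Eucl n) : ⟪aH f a x, y⟫ = fderiv ℝ (fderiv ℝ f) a x y :=
  tD_inner _ _

lemma taylor2 {f : Eucl n → ℝ} (hf : ContDiff ℝ 2 f) (hsym : ∀ a x y, ⟪aH f a x, y⟫ = ⟪aH f a y, x⟫)
    (R ε : ℝ) (hε : 0 < ε) : ∃ r > 0, ∀ a x : Eucl n, ‖a‖ ≤ R → ‖x‖ ≤ r →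
    |f (a + x) - (f a + ⟪vG f a, x⟫) - quadF (aH f a) x| ≤ ε * ‖x‖ ^ 2 := by
  have hd1 : Differentiable ℝ f := hf.differentiable (by norm_num)
  have hc1 : ContDiff ℝ 1 (fderiv ℝ f) := hf.fderiv_right (by norm_num)
  have hd2 : Differentiable ℝ (fderiv ℝ f) := hc1.differentiable (by norm_num)
  have hc2 : Continuous (fderiv ℝ (fderiv ℝ f)) := hc1.continuous_fderiv (by norm_num)
  have huc := (isCompact_closedBall (0 : Eucl n) (R + 1)).uniformContinuousOn_of_continuous hc2.continuousOn
  obtain ⟨r, hr, hu⟩ := (Metric.uniformContinuousOn_iff_le (α := Eucl n)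
    (β := Eucl n →L[ℝ] Eucl n →L[ℝ] ℝ)).1 huc ε hε
  refine ⟨min r 1, by positivity, fun a x ha hx => ?_⟩
  have hx1 := hx.trans (min_le_left _ _)
  have hx2 := hx.trans (min_le_right _ _)
  set l := fderiv ℝ (fderiv ℝ f) a with hl
  have hin : ∀ y ∈ closedBall (0 : Eucl n) ‖x‖, ‖y‖ ≤ ‖x‖ := fun y hy => by simpa using hy
  have hcv := convex_closedBall (0 : Eucl n) ‖x‖
  have h0 : (0 : Eucl n) ∈ closedBall (0 : Eucl n) ‖x‖ := by simp
  have hxx : x ∈ closedBall (0 : Eucl n) ‖x‖ := by simp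
  have hsh : ∀ y : Eucl n, HasFDerivAt (fun y => a + y) (ContinuousLinearMap.id ℝ (Eucl n)) y :=
    fun y => (hasFDerivAt_id y).const_add a
  have h1 : ∀ y ∈ closedBall (0 : Eucl n) ‖x‖, ‖fderiv ℝ f (a + y) - fderiv ℝ f a - l y‖ ≤ ε * ‖x‖ := by
    intro y hy
    have hD : ∀ z ∈ closedBall (0 : Eucl n) ‖x‖, HasFDerivWithinAt
        (fun z => fderiv ℝ f (a + z) - fderiv ℝ f a - l z)
        (fderiv ℝ (fderiv ℝ f) (a + z) - l) (closedBall (0 : Eucl n) ‖x‖) z := fun z _ =>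
      (((((hd2 (a + z)).hasFDerivAt).comp z (hsh z)).sub_const _).sub l.hasFDerivAt).hasFDerivWithinAt
    have hb := hcv.norm_image_sub_le_of_norm_hasFDerivWithin_le hD (C := ε) (fun z hz => by
      have hz' := hin z hz
      have := hu (a + z) (by
        rw [mem_closedBall_zero_iff]; exact (norm_add_le _ _).trans (by linarith)) a (by
        rw [mem_closedBall_zero_iff]; linarith) (by
        rw [dist_eq_norm, add_sub_cancel_left]; linarith)
      exact (dist_eq_norm (fderiv ℝ (fderiv ℝ f) (a + z)) _).symm.le.trans this) h0 hy
    simp only [add_zero, sub_self, map_zero, sub_zero] at hb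
    exact hb.trans (mul_le_mul_of_nonneg_left (hin y hy) hε.le)
  have hD : ∀ z ∈ closedBall (0 : Eucl n) ‖x‖, HasFDerivWithinAt
      (fun z => f (a + z) - (f a + ⟪vG f a, z⟫) - quadF (aH f a) z)
      (fderiv ℝ f (a + z) - fderiv ℝ f a - l z) (closedBall (0 : Eucl n) ‖x‖) z := fun z _ => by
    have e1 := (hd1 (a + z)).hasFDerivAt.comp z (hsh z)
    have e2 : HasFDerivAt (fun z => f a + ⟪vG f a, z⟫) (fderiv ℝ f a) z := by
      simp_rw [vG_inner]; exact ((fderiv ℝ f a).hasFDerivAt).const_add _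
    have e3 : HasFDerivAt (fun z => quadF (aH f a) z) (l z) z := by
      have h := (((aH f a).hasFDerivAt (x := z)).inner ℝ (hasFDerivAt_id z)).const_mul (1 / 2)
      have : (fun z => quadF (aH f a) z) = fun y => 1 / 2 * ⟪aH f a y, id y⟫ := by
        funext y; simp [quadF]; ring
      rw [this]
      refine h.congr_fderiv ?_
      ext w
      simp only [smul_apply, comp_apply, ContinuousLinearMap.prod_apply,
        fderivInnerCLM_apply, smul_eq_mul, id_apply, id]
      rw [hsym a w z, aH_inner]; ring
    exact ((e1.sub e2).sub e3).hasFDerivWithinAt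
  have hb := hcv.norm_image_sub_le_of_norm_hasFDerivWithin_le hD h1 h0 hxx
  have h00 : quadF (aH f a) 0 = 0 := by simp [quadF]
  simp only [add_zero, h00, inner_zero_right, sub_self, sub_zero] at hb
  rw [norm_eq_abs] at hb
  exact hb.trans (le_of_eq (by ring))

lemma aH_sym {f : Eucl n → ℝ} (hf : ContDiff ℝ 2 f) (a x y : Eucl n) : ⟪aH f a x, y⟫ = ⟪aH f a y, x⟫ := by
  rw [aH_inner, aH_inner]
  exact (hf.contDiffAt.isSymmSndFDerivAt (by simp)) x y

lemma aH_isP (f : ConvFn n) (hf : ContDiff ℝ 2 f.1) (a : Eucl n) : IsP (aH f.1 a) := by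
  refine ⟨aH_sym hf a, fun x => ?_⟩
  by_contra hneg
  push Not at hneg
  have hx : 0 < ‖x‖ := norm_pos_iff.2 fun h => by simp [h] at hneg
  obtain ⟨r, hr, h⟩ := taylor2 hf (aH_sym hf) ‖a‖ (-⟪aH f.1 a x, x⟫ / (4 * ‖x‖ ^ 2))
    (by have := neg_pos.2 hneg; positivity)
  set t := r / ‖x‖ with ht
  have ht0 : 0 < t := by positivity
  have htx : ‖t • x‖ = r := by rw [norm_smul, norm_of_nonneg ht0.le, ht]; field_simp
  have h1 := h a (t • x) le_rfl htx.le
  have h2 := h a (-(t • x)) le_rfl (by rw [norm_neg, htx])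
  have e1 : quadF (aH f.1 a) (-(t • x)) = quadF (aH f.1 a) (t • x) := by simp [quadF]
  have e2 : quadF (aH f.1 a) (t • x) = t ^ 2 * (⟪aH f.1 a x, x⟫ / 2) := quadF_smul _ _ _
  have e3 : -⟪aH f.1 a x, x⟫ / (4 * ‖x‖ ^ 2) * ‖t • x‖ ^ 2 = -(t ^ 2 * ⟪aH f.1 a x, x⟫ / 4) := by
    rw [norm_smul, norm_of_nonneg ht0.le]; field_simp
  rw [e1, norm_neg, inner_neg_right] at h2
  rw [e3, e2] at h1 h2
  have hcv := f.2.2 (mem_univ (a + t • x)) (mem_univ (a + -(t • x))) (show (0 : ℝ) ≤ 1 / 2 by norm_num)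
    (show (0 : ℝ) ≤ 1 / 2 by norm_num) (by norm_num)
  have e4 : (1 / 2 : ℝ) • (a + t • x) + (1 / 2 : ℝ) • (a + -(t • x)) = a := by module
  rw [e4, smul_eq_mul, smul_eq_mul] at hcv
  have h3 := (abs_le.1 h1).2
  have h4 := (abs_le.1 h2).2
  have : t ^ 2 * ⟪aH f.1 a x, x⟫ < 0 := mul_neg_of_pos_of_neg (by positivity) hneg
  linarith

def aP (f : ConvFn n) (hf : ContDiff ℝ 2 f.1) (a : Eucl n) : PM n := ⟨aH f.1 a, aH_isP f hf a⟩

lemma c2_jet (f : ConvFn n) (hf : ContDiff ℝ 2 f.1) : Jet f (vG f.1) (aP f hf) := by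
  have hc1 : ContDiff ℝ 1 (fderiv ℝ f.1) := hf.fderiv_right (by norm_num)
  exact {
    hv := (tD n).continuous.comp hc1.continuous
    hA := by
      refine Continuous.subtype_mk ?_ _
      have := hc1.continuous_fderiv (by norm_num)
      unfold aH
      fun_prop
    ht := taylor2 hf (aH_sym hf) }
end

section
variable {n d k : ℕ} {Ψ : ConvFn n → RadonMeasure n}

def mE (M : Matrix (Fin n) (Fin n) ℝ) : Eucl n →L[ℝ] Eucl n := Matrix.toEuclideanCLM (𝕜 := ℝ) M

lemma mE_cont : Continuous (mE (n := n)) :=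
  LinearMap.continuous_of_finiteDimensional
    ((Matrix.toEuclideanCLM (n := Fin n) (𝕜 := ℝ)).toAlgEquiv.toLinearMap)

lemma mE_diag (t : Fin n → ℝ) (x : Eucl n) (i : Fin n) : mE (Matrix.diagonal t) x i = t i * x i := by
  show (Matrix.diagonal t).mulVec _ i = _
  rw [Matrix.mulVec_diagonal]; rfl

lemma dg_inner (t : Fin n → ℝ) (x y : Eucl n) : ⟪mE (Matrix.diagonal t) x, y⟫ = ∑ i, t i * x i * y i := by
  rw [PiLp.inner_apply]
  refine sum_congr rfl fun i _ => ?_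
  rw [mE_diag]; simp [mul_comm]

/-- the diagonal operator with entries the positive parts of `t` -/
def dP (t : Fin n → ℝ) : PM n := ⟨mE (Matrix.diagonal fun i => max (t i) 0), fun x y => by
    simp only [dg_inner]; exact sum_congr rfl fun i _ => by ring, fun x => by
    rw [dg_inner]
    exact sum_nonneg fun i _ => by
      rw [mul_assoc]; exact mul_nonneg (le_max_right _ _) (mul_self_nonneg _)⟩

lemma dP_cont : Continuous (dP (n := n)) := by
  refine Continuous.subtype_mk (mE_cont.comp ?_) _
  exact Continuous.matrix_diagonal (by fun_prop)

lemma dP_quad {t : Fin n → ℝ} (ht : ∀ i, 0 ≤ t i) (x : Eucl n) :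
    quadF (dP t).1 x = (∑ i, t i * x i ^ 2) / 2 := by
  unfold quadF dP
  rw [dg_inner]
  congr 1
  exact sum_congr rfl fun i _ => by rw [max_eq_left (ht i)]; ring

lemma dP_app {t : Fin n → ℝ} (ht : ∀ i, 0 ≤ t i) (x : Eucl n) (i : Fin n) :
    (dP t).1 x i = t i * x i := by
  unfold dP; rw [mE_diag, max_eq_left (ht i)]

lemma mv_max {D : ℝ → ℝ} (hD : Continuous D) {L : ℝ} (hL : 0 < L) (h0 : D 0 = 0) (h1 : D L = 0)
    (hmv : ∀ τ a, 0 ≤ a → a ≤ τ → τ + a ≤ L → ∫ θ in (0 : ℝ)..1, D (τ + a * cos (2 * Real.pi * θ)) = D τ) :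
    ∀ τ ∈ Icc 0 L, D τ ≤ 0 := by
  obtain ⟨x0, hx0, hmax⟩ := isCompact_Icc.exists_isMaxOn (Set.nonempty_Icc.2 hL.le) hD.continuousOn
  by_contra hc
  push Not at hc
  obtain ⟨τ, hτ, hτ0⟩ := hc
  have hM : 0 < D x0 := hτ0.trans_le (hmax hτ)
  have hK : IsCompact (Icc 0 L ∩ {x | D x = D x0}) :=
    isCompact_Icc.inter_right (isClosed_eq hD continuous_const)
  obtain ⟨z, ⟨hz, hzx⟩, hzl⟩ := hK.exists_isLeast ⟨x0, hx0, rfl⟩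
  have hzx : D z = D x0 := hzx
  have hz0 : 0 < z := lt_of_le_of_ne hz.1 fun h => by rw [← h, h0] at hzx; linarith
  have hzL : z < L := lt_of_le_of_ne hz.2 fun h => by rw [h, h1] at hzx; linarith
  set a := min z (L - z) with ha
  have ha0 : 0 < a := lt_min hz0 (by linarith)
  have ha1 : a ≤ z := min_le_left _ _
  have ha2 : a ≤ L - z := min_le_right _ _
  have hmv1 := hmv z a ha0.le ha1 (by linarith)
  have hin : ∀ θ : ℝ, z + a * cos (2 * Real.pi * θ) ∈ Icc 0 L := fun θ => by
    have h1 := Real.cos_le_one (2 * Real.pi * θ)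
    have h2 := neg_one_le_cos (2 * Real.pi * θ)
    constructor <;> nlinarith
  have hcont : Continuous fun θ : ℝ => D z - D (z + a * cos (2 * Real.pi * θ)) := by fun_prop
  have hpos : 0 < ∫ θ in (0 : ℝ)..1, (D z - D (z + a * cos (2 * Real.pi * θ))) := by
    refine intervalIntegral.integral_pos zero_lt_one hcont.continuousOn
      (fun θ _ => by rw [hzx]; exact sub_nonneg.2 (hmax (hin θ))) ⟨1 / 2, by norm_num, ?_⟩
    have e : cos (2 * Real.pi * (1 / 2)) = -1 := by
      rw [show 2 * Real.pi * (1 / 2) = Real.pi by ring]; exact Real.cos_pi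
    have hm := hin (1 / 2)
    rw [e] at hm ⊢
    have hle : D (z + a * -1) ≤ D z := by rw [hzx]; exact hmax hm
    refine sub_pos.2 (lt_of_le_of_ne hle fun h => ?_)
    have := hzl ⟨hm, h.trans hzx⟩
    linarith
  rw [intervalIntegral.integral_sub (by simp) (Continuous.intervalIntegrable (by fun_prop) _ _), hmv1] at hpos
  simp at hpos

lemma mv_affine {D : ℝ → ℝ} (hD : Continuous D)
    (hmv : ∀ τ a, 0 ≤ a → a ≤ τ → ∫ θ in (0 : ℝ)..1, D (τ + a * cos (2 * Real.pi * θ)) = D τ)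
    {τ : ℝ} (hτ : 0 ≤ τ) : D τ = D 0 + τ * (D 1 - D 0) := by
  have hcos : ∫ θ in (0 : ℝ)..1, cos (2 * Real.pi * θ) = 0 := by
    rw [intervalIntegral.integral_comp_mul_left (fun x => cos x) (by positivity)]; simp
  have key : ∀ L, 0 < L → ∀ τ ∈ Icc 0 L, ∀ σ : ℝ, σ * (D τ - (D 0 + τ / L * (D L - D 0))) ≤ 0 := by
    intro L hL τ hτ σ
    refine mv_max (D := fun τ => σ * (D τ - (D 0 + τ / L * (D L - D 0)))) (by fun_prop) hL (by simp)
      (by field_simp; ring) (fun τ a h0 h1 _ => ?_) τ hτ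
    have e : ∀ θ : ℝ, σ * (D (τ + a * cos (2 * Real.pi * θ)) - (D 0 + (τ + a * cos (2 * Real.pi * θ)) / L * (D L - D 0)))
      = σ * D (τ + a * cos (2 * Real.pi * θ)) - (σ * (D 0 + τ / L * (D L - D 0)) +
        σ * a / L * (D L - D 0) * cos (2 * Real.pi * θ)) := fun θ => by ring
    simp_rw [e]
    rw [intervalIntegral.integral_sub (Continuous.intervalIntegrable (by fun_prop) _ _)
      (Continuous.intervalIntegrable (by fun_prop) _ _), intervalIntegral.integral_add (by simp)
      (Continuous.intervalIntegrable (by fun_prop) _ _), intervalIntegral.integral_const_mul,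
      intervalIntegral.integral_const, intervalIntegral.integral_const_mul, hcos, hmv τ a h0 h1]
    simp; ring
  have key2 : ∀ L, 0 < L → ∀ τ ∈ Icc 0 L, D τ = D 0 + τ / L * (D L - D 0) := fun L hL τ hτ => by
    have h1 := key L hL τ hτ 1
    have h2 := key L hL τ hτ (-1)
    linarith
  have h1 := key2 (τ + 1) (by linarith) τ ⟨hτ, by linarith⟩
  have h2 := key2 (τ + 1) (by linarith) 1 ⟨by norm_num, by linarith⟩
  rw [h1, h2]; field_simp; ring

lemma cc_zero {p : Eucl n → ℂ} (hp : Continuous p) (h : ∀ φ : Cc n, ∫ x, φ x * p x = 0) : p 0 = 0 := by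
  rw [← norm_le_zero_iff]
  refine le_of_forall_pos_le_add fun ε hε => ?_
  obtain ⟨j, hj⟩ := (chi_pt (δ := 1 / 10) (by norm_num) le_rfl hp hε).exists
  obtain ⟨m, h1, h2, h3⟩ := chi_avg (n := n) (δ := 1 / 10) (by norm_num) le_rfl j
  have hm : 0 < m := lt_of_lt_of_le (mul_pos (by
    rw [measureReal_def]
    exact ENNReal.toReal_pos (Metric.measure_ball_pos _ _ one_pos).ne' measure_ball_lt_top.ne)
    (by have := rh_pos j; positivity)) h1
  rw [h, h2, h3, zero_sub, norm_neg, norm_mul, norm_real, norm_of_nonneg hm.le, mul_comm ε] at hj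
  linarith [le_of_mul_le_mul_left hj hm]
end

section
variable {n d k : ℕ} {Ψ : ConvFn n → RadonMeasure n}

lemma dP_upd {t : Fin n → ℝ} (ht : ∀ i, 0 ≤ t i) (i : Fin n) {τ : ℝ} (hτ : 0 ≤ τ) (x : Eucl n) :
    quadF (dP (update t i τ)).1 x = quadF (dP t).1 x + (τ - t i) * x i ^ 2 / 2 := by
  rw [dP_quad ht, dP_quad fun j => by
    rcases eq_or_ne j i with rfl | h
    · simpa using hτ
    · simpa [h] using ht j]
  have : ∀ j, update t i τ j * x j ^ 2 = t j * x j ^ 2 + if j = i then (τ - t i) * x i ^ 2 else 0 := by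
    intro j
    rcases eq_or_ne j i with rfl | h
    · simp; ring
    · simp [h]
  simp_rw [this]
  rw [sum_add_distrib, Finset.sum_ite_eq' univ i]
  simp; ring

lemma osc_convex {τ a r : ℝ} (ha : 0 ≤ a) (hτ : a ≤ τ) (hr : 0 < r) (θ : ℝ) : ConvexOn ℝ Set.univ
    fun u : ℝ => τ * u ^ 2 / 2 - r ^ 2 * a / (4 * Real.pi ^ 2) * cos (2 * Real.pi * (u / r + θ)) := by
  have hπ := Real.pi_pos
  have hb : ∀ u, HasDerivAt (fun u : ℝ => 2 * Real.pi * (u / r + θ)) (2 * Real.pi / r) u := fun u => by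
    have := (((hasDerivAt_id u).div_const r).add_const θ).const_mul (2 * Real.pi)
    exact this.congr_deriv (by ring)
  have h1 : ∀ u, HasDerivAt (fun u : ℝ => τ * u ^ 2 / 2 - r ^ 2 * a / (4 * Real.pi ^ 2) *
      cos (2 * Real.pi * (u / r + θ)))
      (τ * u + r * a / (2 * Real.pi) * sin (2 * Real.pi * (u / r + θ))) u := fun u => by
    have e1 := (((hasDerivAt_pow 2 u).const_mul τ).div_const 2)
    have e2 := ((hb u).cos).const_mul (r ^ 2 * a / (4 * Real.pi ^ 2))
    refine (e1.sub e2).congr_deriv ?_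
    field_simp; ring
  have h2 : ∀ u, HasDerivAt (fun u => τ * u + r * a / (2 * Real.pi) * sin (2 * Real.pi * (u / r + θ)))
      (τ + a * cos (2 * Real.pi * (u / r + θ))) u := fun u => by
    have e1 := (hasDerivAt_id u).const_mul τ
    have e2 := ((hb u).sin).const_mul (r * a / (2 * Real.pi))
    refine (e1.add e2).congr_deriv ?_
    field_simp
  refine Monotone.convexOn_univ_of_deriv (fun u => (h1 u).differentiableAt) ?_
  rw [show deriv _ = _ from funext fun u => (h1 u).deriv]
  refine monotone_of_deriv_nonneg (fun u => (h2 u).differentiableAt) fun u => ?_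
  rw [(h2 u).deriv]
  nlinarith [neg_one_le_cos (2 * Real.pi * (u / r + θ))]

lemma osc_ex {t : Fin n → ℝ} (ht : ∀ i, 0 ≤ t i) (i : Fin n) {a : ℝ} (ha : 0 ≤ a) (hat : a ≤ t i)
    (s : ℝ) (v : Eucl n) {r : ℝ} (hr : 0 < r) (θ : ℝ) : ∃ f : ConvFn n, ∀ x, f.1 x =
      quadF (dP t).1 x + (s + ⟪v, x⟫) - r ^ 2 * a / (4 * Real.pi ^ 2) *
        cos (2 * Real.pi * (x i / r + θ)) := by
  have h1 := (osc_convex ha hat hr θ).comp_linearMap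
    (proj i : Eucl n →L[ℝ] ℝ).toLinearMap
  have h2 := ((addAffine (qd (dP (update t i 0))) s v).2).add h1
  refine ⟨⟨⟨_, ?_⟩, h2⟩, fun x => ?_⟩
  · refine (ContinuousMap.continuous _).add ?_
    have : Continuous fun x : Eucl n => x i := (proj (𝕜 := ℝ) i).continuous
    show Continuous fun x : Eucl n => t i * (x i) ^ 2 / 2 - r ^ 2 * a / (4 * Real.pi ^ 2) * cos (2 * Real.pi * (x i / r + θ))
    fun_prop
  · show (addAffine (qd (dP (update t i 0))) s v).1 x + (t i * (x i) ^ 2 / 2 - r ^ 2 * a / (4 * Real.pi ^ 2) * cos (2 * Real.pi * (x i / r + θ))) = _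
    rw [addAffine_apply, qd_apply, dP_upd ht i le_rfl]; ring

lemma cos_taylor (b : ℝ) {y : ℝ} (hy : |y| ≤ 1) :
    |cos (b + y) - cos b + y * sin b + y ^ 2 / 2 * cos b| ≤ |y| ^ 3 := by
  have h1 := Real.cos_bound hy
  have h2 := Real.sin_bound hy
  have e : cos (b + y) - cos b + y * sin b + y ^ 2 / 2 * cos b =
      cos b * (cos y - (1 - y ^ 2 / 2)) - sin b * ((sin y - (y - y ^ 3 / 6)) - y ^ 3 / 6) := by
    rw [Real.cos_add]; ring
  have hy0 := abs_nonneg y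
  have h3 : |y| ^ 4 ≤ |y| ^ 3 := pow_le_pow_of_le_one hy0 hy (by norm_num)
  have h3' : |y| ^ 5 ≤ |y| ^ 3 := pow_le_pow_of_le_one hy0 hy (by norm_num)
  have h4 : |(sin y - (y - y ^ 3 / 6)) - y ^ 3 / 6| ≤ |y| ^ 3 / 2 := by
    refine (abs_sub _ _).trans ?_
    have : |y ^ 3 / 6| = |y| ^ 3 / 6 := by rw [abs_div, abs_pow]; norm_num
    rw [this]; linarith [pow_nonneg hy0 3, pow_nonneg hy0 5]
  rw [e]
  refine (abs_sub _ _).trans ?_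
  rw [abs_mul, abs_mul]
  have h5 := mul_le_mul (Real.abs_cos_le_one b) h1 (abs_nonneg _) zero_le_one
  have h6 := mul_le_mul (Real.abs_sin_le_one b) h4 (abs_nonneg _) zero_le_one
  linarith [pow_nonneg hy0 3]

lemma osc_jet {t : Fin n → ℝ} (ht : ∀ i, 0 ≤ t i) (i : Fin n) {a : ℝ} (ha : 0 ≤ a) (hat : a ≤ t i)
    (s : ℝ) (v : Eucl n) {r : ℝ} (hr : 0 < r) (θ : ℝ) {f : ConvFn n} (hf : ∀ x, f.1 x =
      quadF (dP t).1 x + (s + ⟪v, x⟫) - r ^ 2 * a / (4 * Real.pi ^ 2) *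
        cos (2 * Real.pi * (x i / r + θ))) :
    Jet f (fun x => v + (dP t).1 x + (r * a / (2 * Real.pi) * sin (2 * Real.pi * (x i / r + θ))) •
      single i (1 : ℝ))
      (fun x => dP (update t i (t i + a * cos (2 * Real.pi * (x i / r + θ))))) := by
  have hπ := Real.pi_pos
  have hx : Continuous fun x : Eucl n => x i := (proj (𝕜 := ℝ) i).continuous
  refine ⟨by fun_prop, dP_cont.comp ?_, fun R ε hε => ?_⟩
  · exact Continuous.update continuous_const _ (by fun_prop)
  · refine ⟨min (r / (2 * Real.pi)) (ε * r / (2 * Real.pi * a + 1)), by positivity, fun x y _ hy => ?_⟩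
    have hy1 := hy.trans (min_le_left _ _)
    have hy2 := hy.trans (min_le_right _ _)
    have hyi : |y i| ≤ ‖y‖ := by simpa using PiLp.norm_apply_le y i
    set b := 2 * Real.pi * (x i / r + θ) with hb
    set η := 2 * Real.pi / r * y i with hη
    have hηa : |η| = 2 * Real.pi / r * |y i| := by rw [hη, abs_mul, abs_of_pos (by positivity)]
    have hη1 : |η| ≤ 1 := by
      rw [hηa]
      calc _ ≤ 2 * Real.pi / r * (r / (2 * Real.pi)) := by gcongr; exact hyi.trans hy1
        _ = 1 := by field_simp
    have hc := cos_taylor b hη1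
    have hcos := neg_one_le_cos b
    have e0 : 2 * Real.pi * ((x + y) i / r + θ) = b + η := by
      simp only [PiLp.add_apply, hb, hη]; ring
    rw [hf, hf, e0, quadF_tangent (dP t).2, dP_upd ht i (by nlinarith), inner_add_right, inner_add_left,
      inner_add_left, real_inner_smul_left, inner_single_left, ← hb]
    have e1 : quadF (dP t).1 x + ⟪(dP t).1 x, y⟫ + quadF (dP t).1 y + (s + (⟪v, x⟫ + ⟪v, y⟫)) -
        r ^ 2 * a / (4 * Real.pi ^ 2) * cos (b + η) -
        (quadF (dP t).1 x + (s + ⟪v, x⟫) - r ^ 2 * a / (4 * Real.pi ^ 2) * cos b +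
        (⟪v, y⟫ + ⟪(dP t).1 x, y⟫ + r * a / (2 * Real.pi) * sin b * ((starRingEnd ℝ) 1 * y i))) -
        (quadF (dP t).1 y + (t i + a * cos b - t i) * y i ^ 2 / 2) =
        -(r ^ 2 * a / (4 * Real.pi ^ 2)) *
          (cos (b + η) - cos b + η * sin b + η ^ 2 / 2 * cos b) := by
      simp only [hη, map_one]; field_simp; ring
    rw [e1, abs_mul, abs_neg, abs_of_nonneg (by positivity)]
    calc _ ≤ r ^ 2 * a / (4 * Real.pi ^ 2) * |η| ^ 3 := by gcongr
      _ = 2 * Real.pi * a / r * |y i| * |y i| ^ 2 := by rw [hηa]; field_simp; ring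
      _ ≤ 2 * Real.pi * a / r * (ε * r / (2 * Real.pi * a + 1)) * ‖y‖ ^ 2 := by
          gcongr; exact hyi.trans hy2
      _ = (2 * Real.pi * a / (2 * Real.pi * a + 1)) * ε * ‖y‖ ^ 2 := by field_simp
      _ ≤ 1 * ε * ‖y‖ ^ 2 := by
          gcongr; rw [div_le_one (by positivity)]; linarith
      _ = _ := by ring
end

section
variable {n d k : ℕ} {Ψ : ConvFn n → RadonMeasure n}

lemma par_cont (φ : Cc n) {X : Type*} [TopologicalSpace X] [FirstCountableTopology X]
    [LocallyCompactSpace X] {g : X → Eucl n → ℂ} (hg : Continuous fun p : X × Eucl n => g p.1 p.2) :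
    Continuous fun r => ∫ x, φ x * g r x := by
  have h := continuous_parametric_integral_of_continuous (μ := (volume : Measure (Eucl n)))
    (f := fun r x => φ x * g r x) ((φ.continuous.comp continuous_snd).mul hg)
    (s := tsupport φ) φ.hasCompactSupport'
  refine h.congr fun r => setIntegral_eq_integral_of_forall_compl_eq_zero fun x hx => ?_
  rw [image_eq_zero_of_notMem_tsupport hx, zero_mul]

lemma osc_fub (φ : Cc n) {H : Eucl n → ℝ → ℂ} (hH : Continuous fun p : Eucl n × ℝ => H p.1 p.2)
    (hp : ∀ x, Function.Periodic (H x) 1) (i : Fin n) (r : ℝ) :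
    ∫ θ in (0 : ℝ)..1, ∫ x, φ x * H x (x i / r + θ) = ∫ x, φ x * ∫ θ in (0 : ℝ)..1, H x θ := by
  have hx : Continuous fun x : Eucl n => x i := (proj (𝕜 := ℝ) i).continuous
  have hc : Continuous fun p : ℝ × Eucl n => φ p.2 * H p.2 (p.2 i / r + p.1) :=
    (φ.continuous.comp continuous_snd).mul
      (hH.comp (by fun_prop : Continuous fun p : ℝ × Eucl n => (p.2, p.2 i / r + p.1)))
  rw [intervalIntegral_integral_swap]
  · refine integral_congr_ae (ae_of_all _ fun x => ?_)
    simp only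
    rw [intervalIntegral.integral_const_mul, intervalIntegral.integral_comp_add_left (H x)]
    have := (hp x).intervalIntegral_add_eq (x i / r) 0
    rw [add_zero, this, zero_add]
  · rw [Set.uIoc_of_le zero_le_one]
    have h2 := (hc.continuousOn (s := Icc (0 : ℝ) 1 ×ˢ tsupport φ)).integrableOn_compact
      (μ := volume) (isCompact_Icc.prod φ.hasCompactSupport')
    have h3 : IntegrableOn (fun p : ℝ × Eucl n => φ p.2 * H p.2 (p.2 i / r + p.1))
        (Icc (0 : ℝ) 1 ×ˢ Set.univ) volume := by
      refine h2.of_forall_sdiff_eq_zero (measurableSet_Icc.prod MeasurableSet.univ) fun p hp => ?_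
      have : p.2 ∉ tsupport φ := fun h => hp.2 ⟨hp.1.1, h⟩
      rw [image_eq_zero_of_notMem_tsupport this, zero_mul]
    have h4 := h3.mono_set (Set.prod_mono_left (t := Set.univ) (Set.Ioc_subset_Icc_self))
    rw [IntegrableOn, Measure.volume_eq_prod, ← Measure.prod_restrict, Measure.restrict_univ] at h4
    exact h4

lemma avg_lim {G : ℕ → ℝ → ℂ} {L : ℂ} (hc : ∀ j, Continuous (G j))
    (h : ∀ θ : ℕ → ℝ, Tendsto (fun j => G j (θ j)) atTop (𝓝 L)) :
    Tendsto (fun j => ∫ θ in (0 : ℝ)..1, G j θ) atTop (𝓝 L) := by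
  have : ∀ j, ∃ θ, ‖(∫ θ in (0 : ℝ)..1, G j θ) - L‖ ≤ 2 * ‖G j θ - L‖ := by
    intro j
    by_contra! hcon
    have e : (∫ θ in (0 : ℝ)..1, G j θ) - L = ∫ θ in (0 : ℝ)..1, (G j θ - L) := by
      rw [intervalIntegral.integral_sub ((hc j).intervalIntegrable _ _) (by simp)]; simp
    have h1 := intervalIntegral.norm_integral_le_of_norm_le_const (a := (0 : ℝ)) (b := 1)
      (f := fun θ => G j θ - L) (C := ‖(∫ θ in (0 : ℝ)..1, G j θ) - L‖ / 2)
      (fun θ _ => by linarith [hcon θ])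
    rw [← e] at h1
    have := hcon 0
    have h0 := norm_nonneg (G j 0 - L)
    norm_num at h1
    linarith
  choose θ hθ using this
  rw [tendsto_iff_norm_sub_tendsto_zero]
  refine squeeze_zero (fun _ => norm_nonneg _) hθ ?_
  simpa using ((tendsto_iff_norm_sub_tendsto_zero.1 (h θ)).const_mul 2)

set_option maxHeartbeats 400000 in
lemma mvP (hΨ : MemPdLV d Ψ) (htr : TrInv Ψ) {t : Fin n → ℝ} (ht : ∀ i, 0 ≤ t i) (i : Fin n) {a : ℝ}
    (ha : 0 ≤ a) (hat : a ≤ t i) (s : ℝ) (v : Eucl n) :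
    ∫ θ in (0 : ℝ)..1, P0 Ψ (dP (update t i (t i + a * cos (2 * Real.pi * θ)))) s v =
      P0 Ψ (dP t) s v := by
  obtain ⟨H, hH⟩ : ∃ H : ℝ → Eucl n → ℝ → ℂ, H = fun r x u =>
    P0 Ψ (dP (update t i (t i + a * cos (2 * Real.pi * u))))
      (quadF (dP t).1 x + (s + ⟪v, x⟫) - r ^ 2 * a / (4 * Real.pi ^ 2) * cos (2 * Real.pi * u))
      (v + (dP t).1 x + (r * a / (2 * Real.pi) * sin (2 * Real.pi * u)) •
      single i (1 : ℝ)) := ⟨_, rfl⟩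
  have hx : Continuous fun x : Eucl n => x i := (proj (𝕜 := ℝ) i).continuous
  have hHc : Continuous fun p : ℝ × Eucl n × ℝ => H p.1 p.2.1 p.2.2 := by
    have hq : Continuous fun p : ℝ × Eucl n × ℝ => quadF (dP t).1 p.2.1 :=
      (quadF_cont _).comp (by fun_prop)
    rw [hH]
    refine P0_cont hΨ htr (dP_cont.comp (Continuous.update continuous_const _ (by fun_prop))) ?_ ?_ <;> fun_prop
  have hHp : ∀ r x, Function.Periodic (H r x) 1 := fun r x u => by
    simp only [hH, mul_add, mul_one, Real.cos_add_two_pi, Real.sin_add_two_pi]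
  obtain ⟨K, hK⟩ : ∃ K : ℝ → Eucl n → ℂ, K = fun r x => ∫ θ in (0 : ℝ)..1, H r x θ := ⟨_, rfl⟩
  have hKc : Continuous fun p : ℝ × Eucl n => K p.1 p.2 := by
    rw [hK]
    exact intervalIntegral.continuous_parametric_intervalIntegral_of_continuous'
      (f := fun (p : ℝ × Eucl n) θ => H p.1 p.2 θ)
      (hHc.comp (by fun_prop : Continuous fun p : (ℝ × Eucl n) × ℝ => (p.1.1, p.1.2, p.2))) _ _
  have hpc : Continuous fun x => K 0 x - P0 Ψ (dP t) (s + quadF (dP t).1 x + ⟪v, x⟫) (v + (dP t).1 x) := by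
    refine (hKc.comp (by fun_prop : Continuous fun x : Eucl n => ((0 : ℝ), x))).sub
      (P0_cont hΨ htr continuous_const ?_ (by fun_prop))
    exact (continuous_const.add (quadF_cont _)).add (by fun_prop)
  have key := cc_zero hpc (fun φ => ?_)
  · have e : K 0 0 = ∫ θ in (0 : ℝ)..1, P0 Ψ (dP (update t i (t i + a * cos (2 * Real.pi * θ)))) s v := by
      simp [hK, hH, quadF]
    rw [e, sub_eq_zero] at key
    rw [key]; simp [quadF]
  have hcs : ∀ {g : Eucl n → ℂ}, Continuous g → Integrable fun x => φ x * g x := fun hg =>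
    (φ.continuous.mul hg).integrable_of_hasCompactSupport φ.hasCompactSupport'.mul_right
  have hK0 : Continuous (K 0) := hKc.comp (by fun_prop : Continuous fun x : Eucl n => ((0 : ℝ), x))
  have hP : Continuous fun x => P0 Ψ (dP t) (s + quadF (dP t).1 x + ⟪v, x⟫) (v + (dP t).1 x) :=
    (hK0.sub hpc).congr fun x => sub_sub_cancel _ _
  simp_rw [mul_sub]
  rw [integral_sub (hcs hK0) (hcs hP), ← qd_jet_int hΨ htr, sub_eq_zero]
  -- the functions
  choose f hf using fun (r : ℝ) (hr : 0 < r) (θ : ℝ) => osc_ex ht i ha hat s v hr θ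
  have hfΨ : ∀ r hr θ, (Ψ (f r hr θ)).1 φ = ∫ x, φ x * H r x (x i / r + θ) := fun r hr θ => by
    rw [jet_int hΨ htr (osc_jet ht i ha hat s v hr θ (hf r hr θ))]
    simp_rw [hf, hH]
  have hHr : ∀ r, Continuous fun p : Eucl n × ℝ => H r p.1 p.2 := fun r =>
    hHc.comp (by fun_prop : Continuous fun p : Eucl n × ℝ => (r, p.1, p.2))
  have hav : ∀ r hr, ∫ θ in (0 : ℝ)..1, (Ψ (f r hr θ)).1 φ = ∫ x, φ x * K r x := fun r hr => by
    simp_rw [hfΨ, hK]; exact osc_fub φ (hHr r) (hHp r) i r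
  have l1 : Tendsto (fun j => ∫ x, φ x * K (rj j) x) atTop (𝓝 (∫ x, φ x * K 0 x)) :=
    ((par_cont φ (g := K) hKc).tendsto 0).comp rj_lim
  refine tendsto_nhds_unique l1 ?_
  simp_rw [← fun j => hav (rj j) (rj_pos j)]
  refine avg_lim (fun j => ?_) fun θ => ?_
  · simp_rw [hfΨ]
    exact par_cont φ (g := fun θ x => H (rj j) x (x i / rj j + θ))
      ((hHr _).comp (by fun_prop : Continuous fun p : ℝ × Eucl n => (p.2, p.2 i / rj j + p.1)))
  · refine ((hΨ.2.1 φ).tendsto _).comp (conv_tendsto_of fun R hR ε hε => ?_)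
    have l2 : Tendsto (fun j => rj j ^ 2 * a / (4 * Real.pi ^ 2)) atTop (𝓝 0) := by
      simpa using ((rj_lim.pow 2).mul_const a).div_const (4 * Real.pi ^ 2)
    filter_upwards [l2.eventually (Iic_mem_nhds hε)] with j hj x _
    have hj : rj j ^ 2 * a / (4 * Real.pi ^ 2) ≤ ε := hj
    rw [hf, addAffine_apply, qd_apply, sub_sub_cancel_left, abs_neg, abs_mul, abs_of_nonneg (by positivity)]
    exact (mul_le_of_le_one_right (by positivity) (Real.abs_cos_le_one _)).trans hj

lemma P0_aff (hΨ : MemPdLV d Ψ) (htr : TrInv Ψ) {t : Fin n → ℝ} (ht : ∀ i, 0 ≤ t i) (i : Fin n)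
    (s : ℝ) (v : Eucl n) {τ : ℝ} (hτ : 0 ≤ τ) :
    P0 Ψ (dP (update t i τ)) s v = P0 Ψ (dP (update t i 0)) s v +
      τ * (P0 Ψ (dP (update t i 1)) s v - P0 Ψ (dP (update t i 0)) s v) := by
  set D : ℝ → ℂ := fun τ => P0 Ψ (dP (update t i τ)) s v with hD
  have hDc : Continuous D := P0_cont hΨ htr
    (dP_cont.comp (Continuous.update continuous_const _ continuous_id)) continuous_const continuous_const
  have hm : ∀ τ a, 0 ≤ a → a ≤ τ → ∫ θ in (0 : ℝ)..1, D (τ + a * cos (2 * Real.pi * θ)) = D τ := by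
    intro τ a ha hat
    have := mvP hΨ htr (t := update t i τ) (fun j => by
      rcases eq_or_ne j i with rfl | h
      · simpa using ha.trans hat
      · simpa [h] using ht j) i ha (by simpa using hat) s v
    simpa [hD] using this
  have hi : ∀ τ a, IntervalIntegrable (fun θ => D (τ + a * cos (2 * Real.pi * θ))) volume 0 1 :=
    fun τ a => (hDc.comp (by fun_prop)).intervalIntegrable _ _
  have h1 := mv_affine (D := fun τ => (D τ).re) (Complex.continuous_re.comp hDc) (fun τ a h h' => by
    have := Complex.reCLM.intervalIntegral_comp_comm (hi τ a)
    rw [hm τ a h h'] at this; exact this) hτ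
  have h2 := mv_affine (D := fun τ => (D τ).im) (Complex.continuous_im.comp hDc) (fun τ a h h' => by
    have := Complex.imCLM.intervalIntegral_comp_comm (hi τ a)
    rw [hm τ a h h'] at this; exact this) hτ
  apply Complex.ext <;> simp [hD] at h1 h2 ⊢ <;> assumption
end

section
variable {n d k : ℕ} {Ψ : ConvFn n → RadonMeasure n}
def rf (u : Eucl n) : Eucl n ≃ₗᵢ[ℝ] Eucl n := (ℝ ∙ u)ᗮ.reflection

lemma rf_apply (u x : Eucl n) : rf u x = x - (2 * (⟪u, x⟫ / ‖u‖ ^ 2)) • u := by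
  unfold rf
  rw [Submodule.reflection_orthogonal_apply, Submodule.reflection_singleton_apply]
  simp [two_smul, mul_smul, sub_eq_add_neg]

lemma rf_det {u : Eucl n} (hu : u ≠ 0) :
    LinearMap.det ((rf u).toLinearEquiv : Eucl n →ₗ[ℝ] Eucl n) = -1 := by
  have := Submodule.det_reflection (ℝ ∙ u)ᗮ
  rw [Submodule.orthogonal_orthogonal, finrank_span_singleton hu, pow_one] at this
  exact this

lemma rf_quad {t : Fin n → ℝ} (ht : ∀ i, 0 ≤ t i) {u : Eucl n} {τ : ℝ} (hu : ∀ i, t i * u i = τ * u i)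
    (x : Eucl n) : quadF (dP t).1 (rf u x) = quadF (dP t).1 x := by
  rw [dP_quad ht, dP_quad ht, rf_apply]
  set c := 2 * (⟪u, x⟫ / ‖u‖ ^ 2) with hc
  have e1 : c * ‖u‖ ^ 2 = 2 * ⟪u, x⟫ := by
    rcases eq_or_ne u 0 with rfl | h
    · simp
    · rw [hc]; field_simp
  have e2 : ⟪u, x⟫ = ∑ i, x i * u i := by simp [PiLp.inner_apply]
  have e3 : ‖u‖ ^ 2 = ∑ i, u i ^ 2 := real_norm_sq_eq u
  have : ∀ i, t i * (x - c • u) i ^ 2 = t i * x i ^ 2 - 2 * c * τ * (x i * u i) + c ^ 2 * τ * u i ^ 2 := by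
    intro i
    simp only [PiLp.sub_apply, PiLp.smul_apply, smul_eq_mul]
    linear_combination (-2 * c * x i + c ^ 2 * u i) * hu i
  simp_rw [this]
  rw [sum_add_distrib, sum_sub_distrib, ← mul_sum, ← mul_sum, ← e2, ← e3]
  linear_combination c * τ / 2 * e1

lemma iso_det (ρ : Eucl n ≃ₗᵢ[ℝ] Eucl n) :
    LinearMap.det (ρ.toLinearEquiv : Eucl n →ₗ[ℝ] Eucl n) = 1 ∨
    LinearMap.det (ρ.toLinearEquiv : Eucl n →ₗ[ℝ] Eucl n) = -1 := by
  have h := (basisFun (Fin n) ℝ).det_to_matrix_orthonormalBasis_real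
    ((basisFun (Fin n) ℝ).map ρ)
  have h2 := (basisFun (Fin n) ℝ).toBasis.det_comp
    (ρ.toLinearEquiv : Eucl n →ₗ[ℝ] Eucl n) (basisFun (Fin n) ℝ).toBasis
  rw [Module.Basis.det_self, mul_one] at h2
  rw [← h2]
  convert h using 3 <;> (simp; rfl)

lemma P0_iso (hrig : IsRigidMotionInvariant Ψ) (ρ : Eucl n ≃ₗᵢ[ℝ] Eucl n) {t : Fin n → ℝ}
    (ht : ∀ i, 0 ≤ t i) {a b : Fin n} (hab : a ≠ b) (htab : t a = t b) {A' : PM n} (s : ℝ) (v : Eucl n)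
    (hA : ∀ x, quadF A'.1 x = quadF (dP t).1 (ρ x)) : P0 Ψ A' s v = P0 Ψ (dP t) s (ρ v) := by
  rcases iso_det ρ with h | h
  · exact P0_rot hrig ρ h s hA fun x => (ρ.inner_map_map v x).symm
  obtain ⟨u, hu0, hu, huv⟩ : ∃ u : Eucl n, u ≠ 0 ∧ (∀ i, t i * u i = t a * u i) ∧ ⟪u, ρ v⟫ = 0 := by
    by_cases hz : ρ v a = 0
    · refine ⟨single a 1, by simp, fun i => ?_, by
        rw [inner_single_left, hz]; simp⟩
      rcases eq_or_ne i a with rfl | h <;> simp_all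
    · refine ⟨single b (ρ v a) - single a (ρ v b), fun h0 => hz ?_, fun i => ?_, by
        rw [inner_sub_left, inner_single_left, inner_single_left]
        simp [mul_comm]⟩
      · have := congrArg (fun w : Eucl n => w b) h0
        simpa [hab.symm] using this
      · rcases eq_or_ne i a with rfl | h
        · simp
        rcases eq_or_ne i b with rfl | h' <;> simp_all
  have hfix : rf u (ρ v) = ρ v := by rw [rf_apply, huv]; simp
  refine P0_rot hrig (ρ.trans (rf u)) ?_ s (fun x => ?_) fun x => ?_
  · have : (((ρ.trans (rf u)).toLinearEquiv : Eucl n ≃ₗ[ℝ] Eucl n) : Eucl n →ₗ[ℝ] Eucl n) =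
        ((rf u).toLinearEquiv : Eucl n →ₗ[ℝ] Eucl n) ∘ₗ (ρ.toLinearEquiv : Eucl n →ₗ[ℝ] Eucl n) := rfl
    rw [this, LinearMap.det_comp, h, rf_det hu0]; norm_num
  · rw [hA]; exact (rf_quad ht hu _).symm
  · show _ = ⟪ρ v, rf u (ρ x)⟫
    rw [← hfix, (rf u).inner_map_map, ρ.inner_map_map]

lemma t_step (hrig : IsRigidMotionInvariant Ψ) {t : Fin n → ℝ}
    (ht : ∀ i, 0 ≤ t i) {a b : Fin n} (hab : a ≠ b) (htab : t a = t b) (s : ℝ) {v w : Eucl n} {τ : ℝ}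
    (hvw : ∀ i, v i ≠ w i → t i = τ) (hn : ∑ i, v i ^ 2 = ∑ i, w i ^ 2) :
    P0 Ψ (dP t) s v = P0 Ψ (dP t) s w := by
  have hn : ‖v‖ = ‖w‖ := by
    rw [← real_norm_sq_eq, ← real_norm_sq_eq] at hn
    exact (sq_eq_sq₀ (norm_nonneg _) (norm_nonneg _)).1 hn
  have := P0_iso hrig (rf (v - w)) ht hab htab (A' := dP t) s v fun x => (rf_quad ht (τ := τ) (fun i => ?_) x).symm
  · rw [this]; congr 1; exact Submodule.reflection_sub hn
  · by_cases h : v i = w i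
    · simp [h]
    · rw [hvw i h]

def ind (S : Finset (Fin n)) : Fin n → ℝ := fun i => if i ∈ S then 1 else 0

lemma ind_nn (S : Finset (Fin n)) (i : Fin n) : 0 ≤ ind S i := by unfold ind; split_ifs <;> norm_num

def gS (Ψ : ConvFn n → RadonMeasure n) (S : Finset (Fin n)) (s : ℝ) (v : Eucl n) : ℂ := P0 Ψ (dP (ind S)) s v

lemma pig (hn : 3 ≤ n) (S : Finset (Fin n)) : ∃ a b, a ≠ b ∧ ind S a = ind S b := by
  obtain ⟨a, b, hab, h⟩ := Fintype.exists_ne_map_eq_of_card_lt (fun i : Fin n => decide (i ∈ S)) (by simp; omega)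
  exact ⟨a, b, hab, by simp only [decide_eq_decide] at h; simp [ind, h]⟩

lemma g_step (hn : 3 ≤ n) (hrig : IsRigidMotionInvariant Ψ) (S : Finset (Fin n)) (s : ℝ) {v w : Eucl n}
    (hvw : (∀ i ∉ S, v i = w i) ∨ (∀ i ∈ S, v i = w i)) (hs : ∑ i, v i ^ 2 = ∑ i, w i ^ 2) :
    gS Ψ S s v = gS Ψ S s w := by
  obtain ⟨a, b, hab, h⟩ := pig hn S
  rcases hvw with h1 | h1
  · exact t_step hrig (ind_nn S) hab h s (τ := 1) (fun i hi => by
      unfold ind; rw [if_pos]; by_contra hc; exact hi (h1 i hc)) hs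
  · exact t_step hrig (ind_nn S) hab h s (τ := 0) (fun i hi => by
      unfold ind; rw [if_neg]; exact fun hc => hi (h1 i hc)) hs

def prm (τ : Perm (Fin n)) : Eucl n ≃ₗᵢ[ℝ] Eucl n := LinearIsometryEquiv.piLpCongrLeft 2 ℝ ℝ τ

lemma prm_apply (τ : Perm (Fin n)) (x : Eucl n) (i : Fin n) : prm τ x i = x (τ.symm i) := rfl

lemma g_perm (hn : 3 ≤ n) (hrig : IsRigidMotionInvariant Ψ) (τ : Perm (Fin n)) (S : Finset (Fin n))
    (s : ℝ) (v : Eucl n) : gS Ψ (S.map τ.toEmbedding) s (prm τ v) = gS Ψ S s v := by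
  obtain ⟨a, b, hab, h⟩ := pig hn (S.map τ.toEmbedding)
  refine (P0_iso hrig (prm τ) (ind_nn _) hab h s v fun x => ?_).symm
  rw [dP_quad (ind_nn _), dP_quad (ind_nn _), ← Equiv.sum_comp τ (fun i => ind (S.map τ.toEmbedding) i * prm τ x i ^ 2)]
  congr 1
  exact sum_congr rfl fun i _ => by simp [prm_apply, ind]

lemma cauchy_aff {h : ℝ → ℂ} (hc : Continuous h) {R : ℝ}
    (hh : ∀ p q, 0 ≤ p → 0 ≤ q → p + q ≤ R → h p + h q = h (p + q) + h 0) {z : ℝ} (h0 : 0 ≤ z) (h1 : z ≤ R) :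
    R * h z = (R - z) * h 0 + z * h R := by
  set E : ℝ → ℂ := fun z => R * h z - ((R - z) * h 0 + z * h R) with hE
  have hEc : Continuous E := by fun_prop
  have hEa : ∀ p q, 0 ≤ p → 0 ≤ q → p + q ≤ R → E p + E q = E (p + q) := fun p q hp hq hpq => by
    simp only [hE]; push_cast; linear_combination (R : ℂ) * hh p q hp hq hpq
  have hER : E R = 0 := by simp [hE]
  obtain ⟨m, hm, hmax⟩ := isCompact_Icc.exists_isMaxOn (Set.nonempty_Icc.2 (h0.trans h1)) hEc.norm.continuousOn
  have hle : ∀ x ∈ Icc 0 R, x ≤ R / 2 → ‖E m‖ ≤ ‖E x‖ → E m = 0 := fun x hx hx2 hmx => by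
    have e := hEa x x hx.1 hx.1 (by linarith)
    have := hmax (⟨by linarith [hx.1], by linarith⟩ : x + x ∈ Icc 0 R)
    simp only [mem_ofPred_eq] at this
    rw [← e, ← two_mul, norm_mul] at this
    norm_num at this
    exact norm_le_zero_iff.1 (by linarith)
  have hm0 : E m = 0 := by
    rcases le_total m (R / 2) with h | h
    · exact hle m hm h le_rfl
    · refine hle (R - m) ⟨by linarith [hm.2], by linarith [hm.1]⟩ (by linarith) ?_
      have := hEa m (R - m) hm.1 (by linarith [hm.2]) (by linarith)
      rw [add_sub_cancel, hER] at this
      rw [eq_neg_of_add_eq_zero_left this, norm_neg]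
  have := hmax ⟨h0, h1⟩
  simp only [mem_ofPred_eq] at this
  rw [hm0, norm_zero] at this
  exact sub_eq_zero.1 (norm_le_zero_iff.1 this)
end

section
variable {n d k : ℕ} {Ψ : ConvFn n → RadonMeasure n}
lemma g_pair (hn : 3 ≤ n) (hΨ : MemPdLV d Ψ) (htr : TrInv Ψ) (hrig : IsRigidMotionInvariant Ψ)
    {U : Finset (Fin n)} {a b : Fin n} (hab : a ≠ b) (ha : a ∉ U) (hb : b ∉ U) (s : ℝ) {v w : Eucl n}
    (hvw : ∀ i, i ≠ a → i ≠ b → v i = w i) (hs : ∑ i, v i ^ 2 = ∑ i, w i ^ 2) :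
    gS Ψ (insert a U) s v + gS Ψ (insert b U) s v = gS Ψ (insert a U) s w + gS Ψ (insert b U) s w := by
  have key : ∀ v, 4 * P0 Ψ (dP (update (update (ind U) a (1/2)) b (1/2))) s v =
      gS Ψ U s v + gS Ψ (insert a U) s v + gS Ψ (insert b U) s v + gS Ψ (insert a (insert b U)) s v := by
    intro v
    have e0 : update (update (ind U) b 0) a 0 = ind U := by
      funext i; by_cases h1 : i = a <;> by_cases h2 : i = b <;> simp_all [ind]
    have e1 : update (update (ind U) b 0) a 1 = ind (insert a U) := by
      funext i; by_cases h1 : i = a <;> by_cases h2 : i = b <;> simp_all [ind]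
    have e2 : update (update (ind U) b 1) a 0 = ind (insert b U) := by
      funext i; by_cases h1 : i = a <;> by_cases h2 : i = b <;> simp_all [ind]
    have e3 : update (update (ind U) b 1) a 1 = ind (insert a (insert b U)) := by
      funext i; by_cases h1 : i = a <;> by_cases h2 : i = b <;> simp_all [ind]
    have nn : ∀ (c : Fin n) {r : ℝ}, 0 ≤ r → ∀ i, 0 ≤ update (ind U) c r i := fun c r hr i => by
      rcases eq_or_ne i c with rfl | h
      · simpa using hr
      · simpa [h] using ind_nn U i
    unfold gS
    rw [P0_aff hΨ htr (nn a (by norm_num)) b s v (by norm_num), Function.update_comm hab, Function.update_comm hab,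
      P0_aff hΨ htr (nn b le_rfl) a s v (by norm_num), P0_aff hΨ htr (nn b zero_le_one) a s v (by norm_num),
      e0, e1, e2, e3]
    push_cast; ring
  have k1 := key v
  rw [t_step hrig (w := w) (a := a) (b := b) (τ := 1/2) (fun i => ?_) hab (by simp [hab]) s (fun i hi => ?_) hs,
    key w, g_step hn hrig U s (Or.inr fun i hi => hvw i (fun h => ha (h ▸ hi)) (fun h => hb (h ▸ hi))) hs,
    g_step hn hrig (insert a (insert b U)) s (Or.inl fun i hi => by
      simp at hi; exact hvw i hi.1 hi.2.1) hs] at k1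
  · linear_combination -k1
  · have := ind_nn U i
    by_cases h1 : i = a <;> by_cases h2 : i = b <;> simp_all
  · by_cases h1 : i = a <;> by_cases h2 : i = b <;> simp_all

/-- `√x e_a + √y e_b + √z e_c`. -/
def v3 (a b c : Fin n) (x y z : ℝ) : Eucl n := WithLp.toLp 2 fun i =>
  if i = a then √x else if i = b then √y else if i = c then √z else 0

lemma v3_sum {a b c : Fin n} (hab : a ≠ b) (hac : a ≠ c) (hbc : b ≠ c) {x y z : ℝ} (hx : 0 ≤ x) (hy : 0 ≤ y)
    (hz : 0 ≤ z) (S : Finset (Fin n)) : ∑ i ∈ S, v3 a b c x y z i ^ 2 =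
      (if a ∈ S then x else 0) + (if b ∈ S then y else 0) + (if c ∈ S then z else 0) := by
  have : ∀ i, v3 a b c x y z i ^ 2 = (if i = a then x else 0) + (if i = b then y else 0) + (if i = c then z else 0) := by
    intro i
    simp only [v3]
    by_cases h1 : i = a
    · subst h1; simp [hab, hac, hx]
    by_cases h2 : i = b
    · subst h2; simp [h1, hbc, hy]
    by_cases h3 : i = c
    · subst h3; simp [h1, h2, hz]
    · simp [h1, h2, h3]
  simp_rw [this, sum_add_distrib, Finset.sum_ite_eq']

lemma g_quad (hn : 3 ≤ n) (hΨ : MemPdLV d Ψ) (htr : TrInv Ψ) (hrig : IsRigidMotionInvariant Ψ)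
    (S : Finset (Fin n)) (s : ℝ) (v : Eucl n) : (‖v‖ : ℂ) ^ 2 * gS Ψ S s v =
      ∑ l, (v l : ℂ) ^ 2 * gS Ψ S s (single l ‖v‖) := by
  have hN : ‖v‖ ^ 2 = ∑ i, v i ^ 2 := real_norm_sq_eq v
  have hNc : (‖v‖ : ℂ) ^ 2 = ∑ i, (v i : ℂ) ^ 2 := by rw [← ofReal_pow, hN]; push_cast; rfl
  have hsing : ∀ l (r : ℝ), ∑ i, (single l r : Eucl n) i ^ 2 = r ^ 2 := fun l r => by
    rw [sum_eq_single l] <;> simp +contextual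
  by_cases hS : (∀ i, i ∉ S) ∨ (∀ i, i ∈ S)
  · have : ∀ l, gS Ψ S s (single l ‖v‖) = gS Ψ S s v := fun l =>
      g_step hn hrig S s (hS.elim (fun h => Or.inr fun i hi => absurd hi (h i))
        (fun h => Or.inl fun i hi => absurd (h i) hi)) (by rw [hsing, hN])
    simp_rw [this]
    rw [hNc, sum_mul]
  push Not at hS
  obtain ⟨⟨a, ha⟩, b, hb⟩ := hS
  have hab : a ≠ b := fun h => hb (h ▸ ha)
  obtain ⟨c, hc⟩ : ∃ c, c ∉ ({a, b} : Finset (Fin n)) := by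
    by_contra! h
    have := Finset.card_le_card (fun i _ => h i : (univ : Finset (Fin n)) ⊆ {a, b})
    have h2 := Finset.card_le_two (a := a) (b := b)
    simp at this; omega
  simp only [Finset.mem_insert, Finset.mem_singleton, not_or] at hc
  have hca : a ≠ c := fun h => hc.1 h.symm
  have hcb : b ≠ c := fun h => hc.2 h.symm
  set h : ℝ → ℝ → ℂ := fun R z => gS Ψ S s (v3 a b c z (R - z) 0) with hh
  have rep : ∀ w : Eucl n, gS Ψ S s w = h (∑ i, w i ^ 2) (∑ i ∈ S, w i ^ 2) := by
    intro w
    have hsp := sum_add_sum_compl S fun i => w i ^ 2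
    have p1 : 0 ≤ ∑ i ∈ S, w i ^ 2 := sum_nonneg fun i _ => sq_nonneg _
    have p2 : 0 ≤ ∑ i ∈ Sᶜ, w i ^ 2 := sum_nonneg fun i _ => sq_nonneg _
    set X := ∑ i ∈ S, w i ^ 2
    set Y := ∑ i ∈ Sᶜ, w i ^ 2
    rw [hh, ← hsp]
    simp only [add_sub_cancel_left]
    have hv3 := v3_sum hab hca hcb p1 p2 le_rfl
    let w1 : Eucl n := WithLp.toLp 2 fun i => if i ∈ S then w i else v3 a b c X Y 0 i
    have hw1 : ∑ i, w1 i ^ 2 = X + Y := by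
      rw [← sum_add_sum_compl S]
      congr 1
      · exact sum_congr rfl fun i hi => by simp [w1, hi]
      · rw [sum_congr rfl fun i hi => (by simp [w1, mem_compl.1 hi] : w1 i ^ 2 = v3 a b c X Y 0 i ^ 2), hv3]
        simp [ha, hb]
    rw [g_step hn hrig S s (v := w) (w := w1) (Or.inr fun i hi => by simp [w1, hi]) (by rw [hw1, hsp]),
      g_step hn hrig S s (v := w1) (w := v3 a b c X Y 0) (Or.inl fun i hi => by simp [w1, hi]) (by rw [hw1, hv3]; simp)]
  have swp : ∀ w : Eucl n, gS Ψ (insert b (S.erase a)) s w = gS Ψ S s (prm (swap a b) w) := by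
    intro w
    have e : (insert b (S.erase a)).map (swap a b).toEmbedding = S := by
      ext i
      rw [mem_map_equiv, symm_swap]
      by_cases h1 : i = a
      · subst h1; simp [ha]
      by_cases h2 : i = b
      · subst h2; simp [hb, h1, hab]
      · simp [swap_apply_of_ne_of_ne h1 h2, h1, h2]
    rw [← g_perm hn hrig (swap a b), e]
  have pair : ∀ p q y, 0 ≤ p → 0 ≤ q → 0 ≤ y → gS Ψ S s (v3 a b c p q y) + gS Ψ S s (v3 b a c p q y) =
      gS Ψ S s (v3 a b c (p + q) 0 y) + gS Ψ S s (v3 b a c (p + q) 0 y) := by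
    intro p q y hp hq hy
    have hpr : ∀ p q y, prm (swap a b) (v3 a b c p q y) = v3 b a c p q y := by
      intro p q y
      ext i
      rw [prm_apply, symm_swap]
      simp only [v3]
      by_cases h1 : i = a
      · subst h1; simp [hab, hab.symm]
      by_cases h2 : i = b
      · subst h2; simp
      · simp [swap_apply_of_ne_of_ne h1 h2, h1, h2]
    have := g_pair hn hΨ htr hrig hab (U := S.erase a) (by simp) (by simp [hb]) s
      (v := v3 a b c p q y) (w := v3 a b c (p + q) 0 y) (fun i h1 h2 => by simp [v3, h1, h2]) (by
        rw [v3_sum hab hca hcb hp hq hy, v3_sum hab hca hcb (by positivity) le_rfl hy]; simp)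
    rwa [Finset.insert_erase ha, swp, swp, hpr, hpr] at this
  have hcont : ∀ R, Continuous (h R) := fun R => by
    refine P0_cont hΨ htr continuous_const continuous_const ((PiLp.continuous_toLp 2 _).comp (continuous_pi fun i => ?_))
    split_ifs <;> fun_prop
  set R := ∑ i, v i ^ 2 with hR
  have aff : ∀ z, 0 ≤ z → z ≤ R → (R : ℂ) * h R z = (R - z) * h R 0 + z * h R R := by
    by_cases hcS : c ∈ S
    · intro z hz hzR
      have := cauchy_aff (h := fun z => h R (R - z)) ((hcont R).comp (by fun_prop)) (R := R) (fun p q hp hq hpq => by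
        have := pair q p (R - p - q) hq hp (by linarith)
        rw [rep, rep, rep, rep] at this
        have e := fun {x y z : ℝ} (hx : 0 ≤ x) (hy : 0 ≤ y) (hz : 0 ≤ z) (S : Finset (Fin n)) => v3_sum hab hca hcb hx hy hz S
        have e' := fun {x y z : ℝ} (hx : 0 ≤ x) (hy : 0 ≤ y) (hz : 0 ≤ z) (S : Finset (Fin n)) => v3_sum hab.symm hcb hca hx hy hz S
        have y0 : 0 ≤ R - p - q := by linarith
        have pq : 0 ≤ q + p := by linarith
        simp only [e hq hp y0, e' hq hp y0, e pq le_rfl y0, e' pq le_rfl y0, ha, hb, hcS, if_true, if_false, Finset.mem_univ] at this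
        ring_nf at this ⊢
        linear_combination this) (z := R - z) (by linarith) (by linarith)
      simp only [sub_sub_cancel, sub_zero, sub_self] at this
      push_cast at this
      linear_combination this
    · intro z hz hzR
      exact cauchy_aff (hcont R) (fun p q hp hq hpq => by
        have := pair p q (R - p - q) hp hq (by linarith)
        rw [rep, rep, rep, rep] at this
        have y0 : 0 ≤ R - p - q := by linarith
        have pq : 0 ≤ p + q := by linarith
        simp only [v3_sum hab hca hcb hp hq y0, v3_sum hab.symm hcb hca hp hq y0, v3_sum hab hca hcb pq le_rfl y0,
          v3_sum hab.symm hcb hca pq le_rfl y0, ha, hb, hcS, if_true, if_false, Finset.mem_univ] at this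
        ring_nf at this ⊢
        linear_combination this) hz hzR
  have hsS : ∀ l, gS Ψ S s (single l ‖v‖) = if l ∈ S then h R R else h R 0 := fun l => by
    rw [rep, hsing, hN]
    split_ifs with hl
    · rw [sum_eq_single_of_mem l hl (fun i _ hi => by simp [hi])]; simp [hN]
    · rw [sum_eq_zero]
      intro i hi
      simp [show i ≠ l from fun e => hl (e ▸ hi)]
  have p1 : 0 ≤ ∑ i ∈ S, v i ^ 2 := sum_nonneg fun i _ => sq_nonneg _
  have p2 : ∑ i ∈ S, v i ^ 2 ≤ R := Finset.sum_le_univ_sum_of_nonneg fun i => sq_nonneg _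
  have hsp := sum_add_sum_compl S fun i => v i ^ 2
  have e1 := aff _ p1 p2
  rw [← ofReal_pow, hN, rep v, e1]
  rw [← sum_add_sum_compl S]
  have f1 : ∀ l ∈ S, (v l : ℂ) ^ 2 * gS Ψ S s (single l ‖v‖) = (v l : ℂ) ^ 2 * h R R := fun l hl => by
    rw [hsS, if_pos hl]
  have f2 : ∀ l ∈ Sᶜ, (v l : ℂ) ^ 2 * gS Ψ S s (single l ‖v‖) = (v l : ℂ) ^ 2 * h R 0 := fun l hl => by
    rw [hsS, if_neg (mem_compl.1 hl)]
  rw [sum_congr rfl f1, sum_congr rfl f2, ← sum_mul, ← sum_mul]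
  have : (R : ℂ) - ((∑ i ∈ S, v i ^ 2 : ℝ) : ℂ) = ((∑ i ∈ Sᶜ, v i ^ 2 : ℝ) : ℂ) := by
    rw [← Complex.ofReal_sub]; congr 1; linarith
  rw [this]; push_cast; ring
end

section
variable {n d k : ℕ} {Ψ : ConvFn n → RadonMeasure n}
def pS (Ψ : ConvFn n → RadonMeasure n) (S : Finset (Fin n)) (s : ℝ) (v : Eucl n) : ℂ :=
  ∑ U ∈ S.powerset, (-1) ^ (S.card + U.card) * gS Ψ U s v

def mix (T U : Finset (Fin n)) (t : Fin n → ℝ) : Fin n → ℝ := fun i => if i ∈ T then ind U i else t i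

lemma expand_aux (hΨ : MemPdLV d Ψ) (htr : TrInv Ψ) {t : Fin n → ℝ} (ht : ∀ i, 0 ≤ t i) (s : ℝ) (v : Eucl n)
    (T : Finset (Fin n)) : P0 Ψ (dP t) s v = ∑ S ∈ T.powerset, (∏ i ∈ S, (t i : ℂ)) *
      ∑ U ∈ S.powerset, (-1) ^ (S.card + U.card) * P0 Ψ (dP (mix T U t)) s v := by
  induction T using Finset.induction_on with
  | empty => simp [show mix ∅ ∅ t = t from rfl]
  | insert a T ha ih =>
    have hs : ∀ U ∈ T.powerset, P0 Ψ (dP (mix T U t)) s v = P0 Ψ (dP (mix (insert a T) U t)) s v +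
        t a * (P0 Ψ (dP (mix (insert a T) (insert a U) t)) s v - P0 Ψ (dP (mix (insert a T) U t)) s v) := by
      intro U hU
      have haU : a ∉ U := fun h => ha (mem_powerset.1 hU h)
      have e0 : update (mix T U t) a (t a) = mix T U t := by
        funext i; by_cases h : i = a <;> simp_all [mix]
      have e1 : update (mix T U t) a 0 = mix (insert a T) U t := by
        funext i; by_cases h : i = a <;> simp_all [mix, ind]
      have e2 : update (mix T U t) a 1 = mix (insert a T) (insert a U) t := by
        funext i; by_cases h : i = a <;> simp_all [mix, ind]
      have := P0_aff hΨ htr (t := mix T U t) (fun i => by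
        unfold mix; split_ifs; exacts [ind_nn U i, ht i]) a s v (ht a)
      rwa [e0, e1, e2] at this
    rw [ih, Finset.sum_powerset_insert ha, ← sum_add_distrib]
    refine sum_congr rfl fun S hS => ?_
    have haS : a ∉ S := fun h => ha (mem_powerset.1 hS h)
    rw [Finset.sum_powerset_insert haS, Finset.prod_insert haS, Finset.card_insert_of_notMem haS,
      ← sum_add_distrib, mul_sum, mul_sum, mul_sum, ← sum_add_distrib]
    refine sum_congr rfl fun U hU => ?_
    rw [hs U (Finset.powerset_mono.2 (mem_powerset.1 hS) hU),
      Finset.card_insert_of_notMem fun h => haS (mem_powerset.1 hU h)]; ring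

lemma expand (hΨ : MemPdLV d Ψ) (htr : TrInv Ψ) {t : Fin n → ℝ} (ht : ∀ i, 0 ≤ t i) (s : ℝ) (v : Eucl n) :
    P0 Ψ (dP t) s v = ∑ S, (∏ i ∈ S, (t i : ℂ)) * pS Ψ S s v := by
  rw [expand_aux hΨ htr ht s v univ, Finset.powerset_univ]
  simp only [pS, gS, show ∀ U, mix univ U t = ind U from fun U => by funext i; simp [mix]]

lemma moebius0 {q : Finset (Fin n) → ℂ} (h : ∀ U : Finset (Fin n), ∑ V ∈ U.powerset, q V = 0) (U : Finset (Fin n)) : q U = 0 := by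
  induction U using Finset.strongInduction with
  | H U ih =>
    rw [← h U, sum_eq_single_of_mem U (by simp)]
    intro V hV hne
    exact ih V (Finset.ssubset_iff_subset_ne.2 ⟨mem_powerset.1 hV, hne⟩)

lemma pS_hom (hΨ : MemPdLV d Ψ) (htr : TrInv Ψ) (hhom : IsHomogeneousDeg k Ψ) (S : Finset (Fin n)) (c : ℝ≥0)
    (s : ℝ) (v : Eucl n) :
    ((c : ℝ) : ℂ) ^ S.card * pS Ψ S (c * s) ((c : ℝ) • v) = ((c : ℝ) : ℂ) ^ k * pS Ψ S s v := by
  rw [← sub_eq_zero]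
  refine moebius0 (q := fun S => ((c : ℝ) : ℂ) ^ S.card * pS Ψ S (c * s) ((c : ℝ) • v) - ((c : ℝ) : ℂ) ^ k * pS Ψ S s v)
    (fun U => ?_) S
  have hnn : ∀ i, 0 ≤ (c : ℝ) * ind U i := fun i => mul_nonneg c.2 (ind_nn U i)
  have h1 := P0_hom hΨ htr hhom c (A := dP (ind U)) (A' := dP fun i => (c : ℝ) * ind U i) s v (by
    ext x i
    rw [dP_app hnn, smul_apply, PiLp.smul_apply, dP_app (ind_nn U), smul_eq_mul, mul_assoc])
  rw [expand hΨ htr hnn, expand hΨ htr (ind_nn U)] at h1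
  have hz : ∀ S, S ∉ U.powerset → ∃ i ∈ S, ind U i = 0 := fun S hS => by
    rw [mem_powerset, Finset.not_subset] at hS
    obtain ⟨i, hi, hiU⟩ := hS
    exact ⟨i, hi, by simp [ind, hiU]⟩
  have h2 : ∀ S ∈ U.powerset, ∀ i ∈ S, ind U i = 1 := fun S hS i hi => by
    simp [ind, mem_powerset.1 hS hi]
  rw [← sum_subset (subset_univ U.powerset), ← sum_subset (subset_univ U.powerset)] at h1
  · rw [sum_sub_distrib, sub_eq_zero, ← mul_sum]
    convert h1 using 1
    · refine sum_congr rfl fun S hS => ?_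
      rw [prod_congr rfl fun i hi => by rw [h2 S hS i hi, mul_one], Finset.prod_const]
    · congr 1
      refine sum_congr rfl fun S hS => ?_
      rw [prod_congr rfl fun i hi => by rw [h2 S hS i hi], Finset.prod_const]; simp
  all_goals
    intro S _ hS
    obtain ⟨i, hi, h0⟩ := hz S hS
    rw [prod_eq_zero hi (by simp [h0]), zero_mul]

lemma pS_perm (hn : 3 ≤ n) (hrig : IsRigidMotionInvariant Ψ) (τ : Perm (Fin n)) (S : Finset (Fin n))
    (s : ℝ) (v : Eucl n) : pS Ψ (S.map τ.toEmbedding) s (prm τ v) = pS Ψ S s v := by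
  unfold pS
  symm
  refine Finset.sum_bij (fun U _ => U.map τ.toEmbedding) (fun U hU => ?_) (fun U _ V _ h => Finset.map_injective _ h)
    (fun V hV => ⟨V.map τ.symm.toEmbedding, ?_, ?_⟩) (fun U _ => by rw [g_perm hn hrig]; simp)
  · rw [mem_powerset] at hU ⊢; exact Finset.map_subset_map.2 hU
  · rw [mem_powerset] at hV ⊢
    intro i hi
    have := hV ((mem_map_equiv).1 hi)
    simpa using this
  · ext i; simp [mem_map_equiv]

lemma TR {S S' : Finset (Fin n)} {l l' : Fin n} (hc : S.card = S'.card) (hl : l ∈ S ↔ l' ∈ S') :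
    ∃ τ : Perm (Fin n), S.map τ.toEmbedding = S' ∧ τ l = l' := by
  have e : {x // x ∈ S} ≃ {x // x ∈ S'} := Finset.equivOfCardEq hc
  set σ := e.extendSubtype with hσ
  have h1 : ∀ i, σ i ∈ S' ↔ i ∈ S := fun i => by
    by_cases hi : i ∈ S
    · exact iff_of_true (e.extendSubtype_mem i hi) hi
    · exact iff_of_false (e.extendSubtype_not_mem i hi) hi
  refine ⟨σ.trans (swap (σ l) l'), ?_, by simp⟩
  ext i
  rw [mem_map_equiv]
  simp only [Equiv.symm_trans_apply, symm_swap]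
  rw [← h1, Equiv.apply_symm_apply]
  by_cases ha : i = σ l
  · subst ha; rw [Equiv.swap_apply_left, h1, hl]
  by_cases hb : i = l'
  · subst hb; rw [Equiv.swap_apply_right, h1, hl]
  · rw [swap_apply_of_ne_of_ne ha hb]

lemma pS_same (hn : 3 ≤ n) (hrig : IsRigidMotionInvariant Ψ) {S S' : Finset (Fin n)} {l l' : Fin n}
    (hc : S.card = S'.card) (hl : l ∈ S ↔ l' ∈ S') (s ρ : ℝ) :
    pS Ψ S s (single l ρ) = pS Ψ S' s (single l' ρ) := by
  obtain ⟨τ, h1, h2⟩ := TR hc hl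
  rw [← pS_perm hn hrig τ, h1]
  congr 1
  ext i
  rw [prm_apply]
  by_cases h : i = l'
  · subst h; simp [← h2]
  · simp [h, show τ.symm i ≠ l from fun e => h (by rw [← h2, ← e]; simp)]

lemma pS_quad (hn : 3 ≤ n) (hΨ : MemPdLV d Ψ) (htr : TrInv Ψ) (hrig : IsRigidMotionInvariant Ψ)
    (S : Finset (Fin n)) (s : ℝ) (v : Eucl n) : (‖v‖ : ℂ) ^ 2 * pS Ψ S s v =
      ∑ l, (v l : ℂ) ^ 2 * pS Ψ S s (single l ‖v‖) := by
  simp only [pS, mul_sum]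
  rw [sum_comm]
  refine sum_congr rfl fun U _ => ?_
  rw [mul_left_comm, g_quad hn hΨ htr hrig, mul_sum]
  exact sum_congr rfl fun l _ => by ring

lemma pS_even (hn : 3 ≤ n) (hrig : IsRigidMotionInvariant Ψ) (S : Finset (Fin n)) (s : ℝ) (l : Fin n) (ρ : ℝ) :
    pS Ψ S s (single l (-ρ)) = pS Ψ S s (single l ρ) := by
  unfold pS
  refine sum_congr rfl fun U _ => ?_
  congr 1
  refine g_step hn hrig U s ?_ (sum_congr rfl fun i _ => ?_)
  · by_cases h : l ∈ U
    · exact Or.inl fun i hi => by simp [show i ≠ l from fun e => hi (e ▸ h)]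
    · exact Or.inr fun i hi => by simp [show i ≠ l from fun e => h (e ▸ hi)]
  · by_cases h : i = l
    · subst h; simp
    · simp [h]

lemma pS_poly (hΨ : MemPdLV d Ψ) (htr : TrInv Ψ) (S : Finset (Fin n)) :
    ∃ Q : MvPolynomial (Fin (n + 1)) ℂ, Q.totalDegree ≤ d ∧ ∀ s v, pS Ψ S s v = eval (sv s v) Q := by
  choose Q hQ hQe using fun U : Finset (Fin n) => P0_poly hΨ htr (dP (ind U))
  refine ⟨∑ U ∈ S.powerset, MvPolynomial.C ((-1) ^ (S.card + U.card)) * Q U, ?_, fun s v => ?_⟩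
  · refine totalDegree_finsetSum_le fun U _ => ?_
    refine (MvPolynomial.totalDegree_mul _ _).trans ?_
    rw [MvPolynomial.totalDegree_C, zero_add]; exact hQ U
  · rw [map_sum]
    exact sum_congr rfl fun U _ => by rw [map_mul, MvPolynomial.eval_C, ← hQe, gS]
end

section
variable {n d k : ℕ} {Ψ : ConvFn n → RadonMeasure n}
lemma hom_form {f : ℝ → ℝ → ℂ} {l : Fin n} {Q : MvPolynomial (Fin (n + 1)) ℂ} (i : ℕ) (hd : Q.totalDegree ≤ d)
    (hQ : ∀ s ρ, f s ρ = eval (sv s (single l ρ)) Q) (he : ∀ s ρ, f s (-ρ) = f s ρ)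
    (hh : ∀ (c : ℝ≥0) s ρ, ((c : ℝ) : ℂ) ^ i * f (c * s) (c * ρ) = ((c : ℝ) : ℂ) ^ k * f s ρ) :
    ∃ a : ℕ → ℂ, (∀ j, (k < i ∨ min (k - i) d / 2 < j) → a j = 0) ∧ ∀ s ρ, f s ρ =
      ∑ j ∈ range (min (k - i) d / 2 + 1), a j * ((s : ℂ) ^ (k - 2 * j - i) * ((ρ : ℂ) ^ 2) ^ j) := by
  classical
  set C : (Fin (n + 1) →₀ ℕ) → ℂ := fun m => if ∀ t, t ≠ l → m t.succ = 0 then Q.coeff m else 0 with hC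
  have h1 : ∀ s ρ : ℝ, f s ρ = ∑ m ∈ Q.support, C m * ((s : ℂ) ^ m 0 * (ρ : ℂ) ^ m l.succ) := by
    intro s ρ
    rw [hQ, MvPolynomial.eval_eq']
    refine sum_congr rfl fun m _ => ?_
    rw [Fin.prod_univ_succ]
    simp only [sv, Fin.cons_zero, Fin.cons_succ, hC]
    split_ifs with h
    · rw [Finset.prod_eq_single l (fun t _ ht => by rw [h t ht, pow_zero]) (by simp)]; simp
    · push Not at h
      obtain ⟨t, ht, h0⟩ := h
      rw [prod_eq_zero (Finset.mem_univ t) (by simp [ht, h0])]; simp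
  have hdeg : ∀ m ∈ Q.support, m 0 + m l.succ ≤ d := fun m hm => by
    refine le_trans ?_ ((MvPolynomial.le_totalDegree hm).trans hd)
    rw [Finsupp.sum_fintype _ _ (by simp), Fin.sum_univ_succ]
    exact Nat.add_le_add_left (Finset.single_le_sum (f := fun t : Fin n => m t.succ) (by simp) (Finset.mem_univ l)) _
  have h2 : ∀ s ρ : ℝ, f s ρ = ∑ m ∈ Q.support with i + (m 0 + m l.succ) = k,
      C m * ((s : ℂ) ^ m 0 * (ρ : ℂ) ^ m l.succ) := by
    intro s ρ
    have hp : (∑ m ∈ Q.support, monomial (i + (m 0 + m l.succ)) (C m * ((s : ℂ) ^ m 0 * (ρ : ℂ) ^ m l.succ)))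
        = monomial k (f s ρ) := by
      refine Polynomial.eq_of_infinite_eval_eq _ _ ((infinite_range_of_injective
        (f := fun N : ℕ => (N : ℂ)) Nat.cast_injective).mono ?_)
      rintro _ ⟨N, rfl⟩
      have := hh N s ρ
      rw [h1 ((N : ℝ≥0) * s)] at this
      simp only [mem_ofPred_eq, Polynomial.eval_finsetSum, Polynomial.eval_monomial]
      rw [mul_comm (f s ρ)]
      push_cast at this
      rw [← this, mul_sum]
      exact sum_congr rfl fun m _ => by rw [mul_pow, mul_pow]; ring
    have := congrArg (fun p => Polynomial.coeff p k) hp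
    simp only [Polynomial.finsetSum_coeff, Polynomial.coeff_monomial, if_true] at this
    rw [← this, Finset.sum_filter]
  have h3 : ∀ s ρ : ℝ, f s ρ = ∑ m ∈ Q.support with i + (m 0 + m l.succ) = k ∧ Even (m l.succ),
      C m * ((s : ℂ) ^ m 0 * (ρ : ℂ) ^ m l.succ) := by
    intro s ρ
    have : f s ρ = (f s ρ + f s (-ρ)) / 2 := by rw [he]; ring
    rw [this, h2, h2 s (-ρ), ← sum_add_distrib, Finset.sum_div, ← Finset.filter_filter, Finset.sum_filter (p := fun m : Fin (n + 1) →₀ ℕ => Even (m l.succ))]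
    refine sum_congr rfl fun m _ => ?_
    split_ifs with h
    · push_cast; rw [h.neg_pow]; ring
    · push_cast; rw [(Nat.not_even_iff_odd.1 h).neg_pow]; ring
  refine ⟨fun j => ∑ m ∈ Q.support with i + (m 0 + m l.succ) = k ∧ m l.succ = 2 * j, C m, fun j hj => ?_, fun s ρ => ?_⟩
  · refine sum_eq_zero fun m hm => ?_
    rw [mem_filter] at hm
    have := hdeg m hm.1
    omega
  · rw [h3, ← Finset.sum_fiberwise_of_maps_to (g := fun m => m l.succ / 2) (t := range (min (k - i) d / 2 + 1))]
    · refine sum_congr rfl fun j _ => ?_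
      rw [sum_mul, Finset.filter_filter]
      refine sum_congr (Finset.filter_congr fun m _ => ?_) fun m hm => ?_
      · rw [and_assoc]
        refine and_congr_right fun _ => ⟨fun h => ?_, fun h => ⟨⟨j, by omega⟩, by omega⟩⟩
        obtain ⟨⟨r, hr⟩, h⟩ := h; omega
      · rw [mem_filter] at hm
        rw [hm.2.2, show m 0 = k - 2 * j - i by omega, pow_mul]
    · intro m hm
      rw [mem_filter] at hm
      have := hdeg m hm.1
      rw [mem_range]; omega

lemma pS_A (hn : 3 ≤ n) (hΨ : MemPdLV d Ψ) (htr : TrInv Ψ) (hrig : IsRigidMotionInvariant Ψ) (hhom : IsHomogeneousDeg k Ψ)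
    (i : ℕ) (b : Prop) : ∃ a : ℕ → ℂ, (∀ j, (k < i ∨ min (k - i) d / 2 < j) → a j = 0) ∧
      ∀ (S : Finset (Fin n)) (l : Fin n), S.card = i → (l ∈ S ↔ b) → ∀ s ρ : ℝ, pS Ψ S s (single l ρ) =
      ∑ j ∈ range (min (k - i) d / 2 + 1), a j * ((s : ℂ) ^ (k - 2 * j - i) * ((ρ : ℂ) ^ 2) ^ j) := by
  by_cases h : ∃ (S : Finset (Fin n)) (l : Fin n), S.card = i ∧ (l ∈ S ↔ b)
  · obtain ⟨S, l, hi, hb⟩ := h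
    obtain ⟨Q, hQ, hQe⟩ := pS_poly hΨ htr S
    obtain ⟨a, ha, hf⟩ := hom_form (k := k) (f := fun s ρ => pS Ψ S s (single l ρ)) i hQ (fun s ρ => hQe _ _)
      (fun s ρ => pS_even hn hrig S s l ρ) (fun c s ρ => by
        rw [← pS_hom hΨ htr hhom, hi]
        congr 2
        ext t; by_cases ht : t = l <;> simp [ht])
    refine ⟨a, ha, fun S' l' hi' hb' s ρ => ?_⟩
    rw [← hf]
    exact pS_same hn hrig (hi'.trans hi.symm) (hb'.trans hb.symm) s ρ
  · exact ⟨0, fun _ _ => rfl, fun S l h1 h2 => absurd ⟨S, l, h1, h2⟩ h⟩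

lemma pS_form (hn : 3 ≤ n) (hΨ : MemPdLV d Ψ) (htr : TrInv Ψ) (hrig : IsRigidMotionInvariant Ψ) (hhom : IsHomogeneousDeg k Ψ) :
    ∃ c e : ℕ → ℕ → ℂ, (∀ i j, (min n k < i ∨ min (k - i) d / 2 < j) → c i j = 0) ∧
      (∀ i j, (i = 0 ∨ min (n - 1) k < i ∨ j = 0 ∨ min (k - i) d / 2 < j) → e i j = 0) ∧
      ∀ (S : Finset (Fin n)) (s : ℝ) (v : Eucl n), pS Ψ S s v =
        ∑ j ∈ range (min (k - S.card) d / 2 + 1), c S.card j * ((s : ℂ) ^ (k - 2 * j - S.card) * ((‖v‖ : ℂ) ^ 2) ^ j) +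
        (∑ l ∈ Sᶜ, (v l : ℂ) ^ 2) * ∑ j ∈ Finset.Icc 1 (min (k - S.card) d / 2),
          e S.card j * ((s : ℂ) ^ (k - 2 * j - S.card) * ((‖v‖ : ℂ) ^ 2) ^ (j - 1)) := by
  classical
  choose A hA0 hA using pS_A hn hΨ htr hrig hhom
  have heq : ∀ i, 1 ≤ i → i ≤ n - 1 → A i True 0 = A i False 0 := by
    intro i h1 h2
    obtain ⟨S, -, hS⟩ := Finset.exists_subset_card_eq (s := (univ : Finset (Fin n))) (n := i) (by simp; omega)
    obtain ⟨l, hl⟩ := card_pos.1 (by omega : 0 < S.card)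
    obtain ⟨l', hl'⟩ : ∃ l', l' ∉ S := by
      by_contra! h
      have := Finset.card_eq_iff_eq_univ S |>.2 (Finset.eq_univ_of_forall h)
      simp at this; omega
    have e1 := hA i True S l hS (by simpa using hl) 1 0
    have e2 := hA i False S l' hS (by simpa using hl') 1 0
    rw [show single l' (0 : ℝ) = single l (0 : ℝ) by ext; simp, e1] at e2
    simpa [Finset.sum_range_succ'] using e2
  obtain ⟨c, hc⟩ : ∃ c : ℕ → ℕ → ℂ, c = fun i j => if i ≤ n then if i = 0 then A i False j else A i True j else 0 := ⟨_, rfl⟩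
  obtain ⟨e, he⟩ : ∃ e : ℕ → ℕ → ℂ, e = fun i j => if 1 ≤ i ∧ i ≤ n - 1 ∧ 1 ≤ j then A i False j - A i True j else 0 := ⟨_, rfl⟩
  refine ⟨c, e, fun i j h => ?_, fun i j h => ?_, fun S s v => ?_⟩
  · rw [hc]; dsimp only
    split_ifs
    · exact hA0 _ _ _ (by omega)
    · exact hA0 _ _ _ (by omega)
    · rfl
  · rw [he]; dsimp only
    split_ifs
    · rw [hA0 _ _ _ (by omega), hA0 _ _ _ (by omega), sub_zero]
    · rfl
  obtain ⟨i, hi⟩ : ∃ i, i = S.card := ⟨_, rfl⟩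
  rw [← hi]
  have hin : i ≤ n := by rw [hi]; simpa using Finset.card_le_univ S
  have key : ∀ l (ρ : ℝ), pS Ψ S s (single l ρ) =
      ∑ j ∈ range (min (k - i) d / 2 + 1), c i j * ((s : ℂ) ^ (k - 2 * j - i) * ((ρ : ℂ) ^ 2) ^ j) +
      (if l ∈ Sᶜ then 1 else 0) * ((ρ : ℂ) ^ 2 * ∑ j ∈ Finset.Icc 1 (min (k - i) d / 2),
          e i j * ((s : ℂ) ^ (k - 2 * j - i) * ((ρ : ℂ) ^ 2) ^ (j - 1))) := by
    intro l ρ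
    have hE : (ρ : ℂ) ^ 2 * ∑ j ∈ Finset.Icc 1 (min (k - i) d / 2), e i j * ((s : ℂ) ^ (k - 2 * j - i) * ((ρ : ℂ) ^ 2) ^ (j - 1))
        = ∑ j ∈ range (min (k - i) d / 2 + 1), e i j * ((s : ℂ) ^ (k - 2 * j - i) * ((ρ : ℂ) ^ 2) ^ j) := by
      rw [mul_sum]
      refine Finset.sum_subset_zero_on_sdiff (fun j hj => ?_) (fun j hj => ?_) (fun j hj => ?_)
      · rw [mem_Icc] at hj; rw [mem_range]; omega
      · rw [Finset.mem_sdiff, mem_range, mem_Icc] at hj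
        rw [he]; simp only; rw [if_neg (by omega), zero_mul]
      · rw [mem_Icc] at hj
        obtain ⟨q, rfl⟩ : ∃ q, j = q + 1 := ⟨j - 1, by omega⟩
        rw [Nat.add_sub_cancel]; ring
    rw [hE, mul_sum, ← sum_add_distrib]
    by_cases hl : l ∈ S
    · have hi1 : i ≠ 0 := fun h => by rw [h] at hi; rw [card_eq_zero.1 hi.symm] at hl; simp at hl
      rw [hA i True S l hi.symm (by simpa using hl)]
      refine sum_congr rfl fun j _ => ?_
      rw [if_neg (by simpa using hl), hc]; simp [hin, hi1]
    · have hi1 : i ≤ n - 1 := by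
        have : S.card < n := by simpa using Finset.card_lt_univ_of_notMem hl
        omega
      rw [hA i False S l hi.symm (by simpa using hl)]
      refine sum_congr rfl fun j _ => ?_
      rw [if_pos (by simpa using hl), hc, he]; simp only [if_pos hin]
      by_cases h0 : i = 0
      · rw [if_pos h0, if_neg (by omega)]; ring
      · rw [if_neg h0]
        by_cases hj : j = 0
        · rw [if_neg (by omega), hj, heq i (by omega) hi1]; ring
        · rw [if_pos (by omega)]; ring
  by_cases hv : v = 0
  · have := key ⟨0, by omega⟩ 0
    rw [show single (⟨0, by omega⟩ : Fin n) (0 : ℝ) = v by rw [hv]; ext; simp] at this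
    rw [this, hv]; simp
  have hN : ((‖v‖ : ℂ)) ^ 2 ≠ 0 := pow_ne_zero _ (by exact_mod_cast norm_ne_zero_iff.2 hv)
  have hsum : ∑ l, (v l : ℂ) ^ 2 = (‖v‖ : ℂ) ^ 2 := by
    have := real_norm_sq_eq v
    exact_mod_cast this.symm
  apply mul_left_cancel₀ hN
  rw [pS_quad hn hΨ htr hrig, sum_congr rfl fun l _ => by rw [key l]]
  simp only [mul_add, sum_add_distrib, ← sum_mul, hsum, ← mul_assoc]
  rw [show ∑ l, (v l : ℂ) ^ 2 * (if l ∈ Sᶜ then 1 else 0) = ∑ l ∈ Sᶜ, (v l : ℂ) ^ 2 by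
    simp only [mul_ite, mul_one, mul_zero]; rw [Finset.sum_ite_mem, Finset.univ_inter]]
  ring

def eS (i : ℕ) (t : Fin n → ℝ) : ℝ := ∑ S ∈ powersetCard i univ, ∏ a ∈ S, t a
def fS (i : ℕ) (t : Fin n → ℝ) (v : Fin n → ℝ) : ℝ :=
  ∑ S ∈ powersetCard i univ, (∏ a ∈ S, t a) * ∑ l ∈ Sᶜ, v l ^ 2
def Dn (n d k : ℕ) (c e : ℕ → ℕ → ℂ) (s N : ℝ) (X Y : ℕ → ℝ) : ℂ :=
  ∑ i ∈ range (min n k + 1), ∑ j ∈ range (min (k - i) d / 2 + 1),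
    c i j * ((s ^ (k - 2 * j - i) * N ^ j * X i : ℝ) : ℂ) +
  ∑ i ∈ Finset.Icc 1 (min (n - 1) k), ∑ j ∈ Finset.Icc 1 (min (k - i) d / 2),
    e i j * ((s ^ (k - 2 * j - i) * N ^ (j - 1) * Y i : ℝ) : ℂ)

def qS (d k : ℕ) (c e : ℕ → ℕ → ℂ) (S : Finset (Fin n)) (s N : ℝ) (v : Fin n → ℝ) : ℂ :=
  ∑ j ∈ range (min (k - S.card) d / 2 + 1), c S.card j * ((s : ℂ) ^ (k - 2 * j - S.card) * (N : ℂ) ^ j) +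
  (∑ l ∈ Sᶜ, (v l : ℂ) ^ 2) * ∑ j ∈ Finset.Icc 1 (min (k - S.card) d / 2),
    e S.card j * ((s : ℂ) ^ (k - 2 * j - S.card) * (N : ℂ) ^ (j - 1))

lemma Dn_sum {c e : ℕ → ℕ → ℂ} (hc : ∀ i j, (min n k < i ∨ min (k - i) d / 2 < j) → c i j = 0)
    (he : ∀ i j, (i = 0 ∨ min (n - 1) k < i ∨ j = 0 ∨ min (k - i) d / 2 < j) → e i j = 0) (t : Fin n → ℝ) (s N : ℝ)
    (v : Fin n → ℝ) : ∑ S : Finset (Fin n), (∏ i ∈ S, (t i : ℂ)) * qS d k c e S s N v =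
      Dn n d k c e s N (fun i => eS i t) (fun i => fS i t v) := by
  rw [← Finset.powerset_univ, Finset.sum_powerset, Dn]
  have h1 : ∀ i, ∑ S ∈ powersetCard i univ, (∏ a ∈ S, (t a : ℂ)) * qS d k c e S s N v =
      ∑ j ∈ range (min (k - i) d / 2 + 1), c i j * ((s ^ (k - 2 * j - i) * N ^ j * eS i t : ℝ) : ℂ) +
      ∑ j ∈ Finset.Icc 1 (min (k - i) d / 2), e i j * ((s ^ (k - 2 * j - i) * N ^ (j - 1) * fS i t v : ℝ) : ℂ) := by
    intro i
    rw [sum_congr rfl fun S hS => by rw [qS, (mem_powersetCard.1 hS).2, mul_add, ← mul_assoc],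
      sum_add_distrib, ← sum_mul, ← sum_mul, mul_sum, mul_sum]
    simp only [eS, fS]
    push_cast
    congr 1 <;> exact sum_congr rfl fun j _ => by ring
  rw [sum_congr rfl fun i _ => h1 i, sum_add_distrib]
  congr 1
  · symm
    refine sum_subset (fun i hi => ?_) fun i _ hi => sum_eq_zero fun j _ => ?_
    · rw [mem_range] at hi ⊢; simp; omega
    · rw [mem_range] at hi; rw [hc _ _ (by omega), zero_mul]
  · symm
    refine sum_subset (fun i hi => ?_) fun i _ hi => sum_eq_zero fun j _ => ?_
    · rw [mem_Icc] at hi; simp; omega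
    · rw [mem_Icc] at hi; rw [he _ _ (by omega), zero_mul]

lemma F_form (hn : 3 ≤ n) (hΨ : MemPdLV d Ψ) (htr : TrInv Ψ) (hrig : IsRigidMotionInvariant Ψ) (hhom : IsHomogeneousDeg k Ψ) :
    ∃ c e : ℕ → ℕ → ℂ, (∀ i j, (min n k < i ∨ min (k - i) d / 2 < j) → c i j = 0) ∧
      (∀ i j, (i = 0 ∨ min (n - 1) k < i ∨ j = 0 ∨ min (k - i) d / 2 < j) → e i j = 0) ∧
      ∀ (t : Fin n → ℝ) (s : ℝ) (v : Eucl n), (∀ i, 0 ≤ t i) →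
        P0 Ψ (dP t) s v = Dn n d k c e s (‖v‖ ^ 2) (fun i => eS i t) (fun i => fS i t v) := by
  obtain ⟨c, e, hc, he, h⟩ := pS_form hn hΨ htr hrig hhom
  refine ⟨c, e, hc, he, fun t s v ht => ?_⟩
  rw [expand hΨ htr ht, ← Dn_sum hc he]
  refine sum_congr rfl fun S _ => ?_
  rw [h S, qS]; push_cast; rfl
end

section
variable {n d k : ℕ} {Ψ : ConvFn n → RadonMeasure n}
lemma md_right (A : Fin n → Matrix (Fin n) (Fin n) ℝ) (Q : Matrix (Fin n) (Fin n) ℝ) :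
    mixedDisc (fun t => A t * Q) = mixedDisc A * Q.det := by
  unfold mixedDisc
  rw [mul_assoc, sum_mul]
  congr 1
  refine sum_congr rfl fun σ _ => ?_
  rw [← Matrix.det_mul]
  congr 1

lemma md_transpose (A : Fin n → Matrix (Fin n) (Fin n) ℝ) : mixedDisc (fun t => (A t).transpose) = mixedDisc A := by
  unfold mixedDisc
  congr 1
  have h1 : ∑ σ : Perm (Fin n), (Matrix.of fun i j => A (σ i) i j).det =
      ∑ σ : Perm (Fin n), ∑ τ : Perm (Fin n), ((Perm.sign τ : ℤ) : ℝ) * ∏ i, A (σ i) i (τ i) := by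
    refine sum_congr rfl fun σ _ => ?_
    rw [← Matrix.det_transpose, det_apply']
    rfl
  rw [h1]
  simp only [det_apply', of_apply, transpose_apply]
  rw [sum_comm, sum_comm (f := fun σ τ : Perm (Fin n) => ((Perm.sign τ : ℤ) : ℝ) * ∏ i, A (σ i) i (τ i))]
  refine sum_congr rfl fun τ _ => ?_
  exact Fintype.sum_equiv (Equiv.mulRight τ) _ _ fun σ => by simp

lemma md_conj (A : Fin n → Matrix (Fin n) (Fin n) ℝ) (Q : Matrix (Fin n) (Fin n) ℝ) (hQ : Q.transpose * Q = 1) :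
    mixedDisc (fun t => Q.transpose * A t * Q) = mixedDisc A := by
  have hd : Q.det * Q.det = 1 := by
    have := congrArg Matrix.det hQ
    rwa [Matrix.det_mul, Matrix.det_transpose, Matrix.det_one] at this
  rw [md_right, ← md_transpose]
  simp only [Matrix.transpose_mul, Matrix.transpose_transpose]
  rw [md_right, md_transpose, mul_assoc, hd, mul_one]

def XE (i : ℕ) (M : Matrix (Fin n) (Fin n) ℝ) : ℝ := mixedDisc (fun t : Fin n => if (t : ℕ) < i then M else 1)
def XF (i : ℕ) (M : Matrix (Fin n) (Fin n) ℝ) (w : Fin n → ℝ) : ℝ := mixedDisc (fun t : Fin n =>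
  if (t : ℕ) < i then M else if (t : ℕ) < i + 1 then Matrix.vecMulVec w w else 1)

lemma XE_conj (i : ℕ) (M Q : Matrix (Fin n) (Fin n) ℝ) (hQ : Q.transpose * Q = 1) :
    XE i (Q.transpose * M * Q) = XE i M := by
  unfold XE
  rw [← md_conj (fun t : Fin n => if (t : ℕ) < i then M else 1) Q hQ]
  congr 1; funext t
  split_ifs
  · rfl
  · rw [mul_one, hQ]

lemma XF_conj (i : ℕ) (M Q : Matrix (Fin n) (Fin n) ℝ) (w : Fin n → ℝ) (hQ : Q.transpose * Q = 1) :
    XF i (Q.transpose * M * Q) (Q.transpose.mulVec w) = XF i M w := by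
  unfold XF
  rw [← md_conj (fun t : Fin n => if (t : ℕ) < i then M else if (t : ℕ) < i + 1 then Matrix.vecMulVec w w else 1) Q hQ]
  congr 1; funext t
  split_ifs
  · rfl
  · rw [Matrix.mul_vecMulVec, Matrix.vecMulVec_mul, Matrix.mulVec_transpose]
  · rw [mul_one, hQ]

def Qm (ρ : Eucl n ≃ₗᵢ[ℝ] Eucl n) : Matrix (Fin n) (Fin n) ℝ := Matrix.of fun l j => ρ (single j 1) l
def MM (A : Eucl n →L[ℝ] Eucl n) : Matrix (Fin n) (Fin n) ℝ :=
  Matrix.of fun i j => ⟪A (single i 1), single j 1⟫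

lemma Qm_orth (ρ : Eucl n ≃ₗᵢ[ℝ] Eucl n) : (Qm ρ).transpose * Qm ρ = 1 := by
  ext i j
  have := ρ.inner_map_map (single j (1 : ℝ)) (single i 1)
  rw [PiLp.inner_apply] at this
  simp only [Matrix.mul_apply, transpose_apply, Qm, of_apply, Matrix.one_apply]
  simp only [RCLike.inner_apply, conj_trivial] at this
  rw [this]
  simp [inner_single_left, PiLp.single_apply, eq_comm]

lemma Qm_mulVec (ρ : Eucl n ≃ₗᵢ[ℝ] Eucl n) (v : Eucl n) : (Qm ρ).transpose.mulVec (ρ v) = v := by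
  ext j
  have := ρ.inner_map_map v (single j (1 : ℝ))
  rw [PiLp.inner_apply] at this
  simp only [RCLike.inner_apply, conj_trivial] at this
  simp only [Matrix.mulVec, dotProduct, transpose_apply, Qm, of_apply, this]
  simp [inner_single_right]

lemma Qm_conj (ρ : Eucl n ≃ₗᵢ[ℝ] Eucl n) {A B : Eucl n →L[ℝ] Eucl n} (h : ∀ x, ρ (A x) = B (ρ x)) :
    MM A = (Qm ρ).transpose * MM B * Qm ρ := by
  have e : ∀ x : Eucl n, x = ∑ l, x l • single l (1 : ℝ) := fun x => by
    ext i; simp [Finset.sum_apply, Pi.single_apply]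
  ext i j
  simp only [Matrix.mul_apply, transpose_apply, Qm, MM, of_apply]
  rw [← ρ.inner_map_map, h]
  conv_lhs => rw [e (ρ (single i 1)), e (ρ (single j 1))]
  rw [map_sum, inner_sum]
  refine sum_congr rfl fun m _ => ?_
  rw [inner_smul_right, sum_inner, mul_comm]
  congr 1
  exact sum_congr rfl fun l _ => by rw [map_smul, inner_smul_left]; simp

lemma MM_dP {t : Fin n → ℝ} (ht : ∀ i, 0 ≤ t i) : MM (dP t).1 = Matrix.diagonal t := by
  ext i j
  simp only [MM, of_apply, inner_single_right, dP_app ht, diagonal_apply, PiLp.single_apply]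
  by_cases h : i = j
  · subst h; simp
  · simp [h, Ne.symm h]

lemma fib {X : Type} [DecidableEq X] (p : Perm (Fin n) → X) (Y : Finset X) (hp : ∀ σ, p σ ∈ Y)
    (h : ∀ y ∈ Y, ∀ y' ∈ Y, ∃ τ : Perm (Fin n), ∀ σ, p σ = y → p (σ * τ) = y') :
    ∃ N : ℝ, N ≠ 0 ∧ ∀ G : X → ℝ, ∑ σ, G (p σ) = N * ∑ y ∈ Y, G y := by
  have hle : ∀ y ∈ Y, ∀ y' ∈ Y, (univ.filter fun σ => p σ = y).card ≤ (univ.filter fun σ => p σ = y').card := by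
    intro y hy y' hy'
    obtain ⟨τ, hτ⟩ := h y hy y' hy'
    refine Finset.card_le_card_of_injOn (fun σ => σ * τ) (fun σ hσ => ?_) (fun a _ b _ hab => mul_right_cancel hab)
    simp only [Finset.coe_filter, Finset.mem_univ, true_and, mem_ofPred_eq] at hσ ⊢
    exact hτ σ hσ
  refine ⟨(univ.filter fun σ => p σ = p 1).card, ?_, fun G => ?_⟩
  · have : 0 < (univ.filter fun σ => p σ = p 1).card := card_pos.2 ⟨1, by simp⟩
    positivity
  · rw [← Finset.sum_fiberwise_of_maps_to (g := p) (t := Y) (fun σ _ => hp σ), mul_sum]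
    refine sum_congr rfl fun y hy => ?_
    rw [sum_congr rfl fun σ hσ => by rw [(mem_filter.1 hσ).2], Finset.sum_const, nsmul_eq_mul,
      le_antisymm (hle y hy _ (hp 1)) (hle _ (hp 1) y hy)]

def pF (i : ℕ) (σ : Perm (Fin n)) : Finset (Fin n) := univ.filter fun a => (σ a : ℕ) < i

lemma pF_card {i : ℕ} (hi : i ≤ n) (σ : Perm (Fin n)) : (pF i σ).card = i := by
  have : (pF i σ).map σ.toEmbedding = univ.filter fun a : Fin n => (a : ℕ) < i := by
    ext a; simp [pF, mem_map_equiv]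
  rw [← Finset.card_map σ.toEmbedding, this]
  have := Fin.card_filter_val_lt (n := n) (m := i)
  omega

lemma pF_mul (i : ℕ) (σ τ : Perm (Fin n)) : pF i (σ * τ.symm) = (pF i σ).map τ.toEmbedding := by
  ext a; rw [mem_map_equiv]; simp only [pF, mem_filter, Finset.mem_univ, true_and]; rfl

lemma XE_diag (hn : 3 ≤ n) {i : ℕ} (hi : i ≤ n) : ∃ κ : ℝ, κ ≠ 0 ∧ ∀ t : Fin n → ℝ, XE i (Matrix.diagonal t) = κ * eS i t := by
  obtain ⟨N, hN, h⟩ := fib (pF (n := n) i) (powersetCard i univ)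
    (fun σ => by simp [mem_powersetCard, pF_card hi]) (fun S hS S' hS' => by
      have hc := (mem_powersetCard.1 hS).2.trans (mem_powersetCard.1 hS').2.symm
      obtain ⟨l, l', hl⟩ : ∃ l l', l ∈ S ↔ l' ∈ S' := by
        by_cases h0 : S.card = 0
        · refine ⟨⟨0, by omega⟩, ⟨0, by omega⟩, ?_⟩
          rw [card_eq_zero.1 h0, card_eq_zero.1 (hc.symm.trans h0)]
        · obtain ⟨l, hl⟩ := card_pos.1 (Nat.pos_of_ne_zero h0)
          obtain ⟨l', hl'⟩ := card_pos.1 (by omega : 0 < S'.card)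
          exact ⟨l, l', iff_of_true hl hl'⟩
      obtain ⟨τ, hτ, -⟩ := TR hc hl
      exact ⟨τ.symm, fun σ hσ => by rw [pF_mul, hσ, hτ]⟩)
  refine ⟨(n.factorial : ℝ)⁻¹ * N, by positivity, fun t => ?_⟩
  rw [XE, mixedDisc, mul_assoc, eS, ← h]
  congr 1
  refine sum_congr rfl fun σ _ => ?_
  rw [show (Matrix.of fun a b => (if ((σ a : Fin n) : ℕ) < i then Matrix.diagonal t else 1) a b) =
    Matrix.diagonal fun a => if ((σ a : Fin n) : ℕ) < i then t a else 1 by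
      ext a b
      simp only [of_apply, diagonal_apply]
      split_ifs <;> simp_all [Matrix.one_apply],
    Matrix.det_diagonal, pF, Finset.prod_filter]

lemma det_row (D : Fin n → ℝ) (l : Fin n) (w : Fin n → ℝ) (M : Matrix (Fin n) (Fin n) ℝ)
    (h1 : ∀ a, a ≠ l → ∀ b, M a b = if a = b then D a else 0) (h2 : ∀ b, M l b = w b) :
    M.det = w l * ∏ a ∈ univ.erase l, D a := by
  rw [det_apply', sum_eq_single 1]
  · rw [← Finset.mul_prod_erase _ _ (Finset.mem_univ l)]
    simp only [Perm.sign_one, Units.val_one, Int.cast_one, one_mul, Perm.one_apply, h2]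
    congr 1
    exact prod_congr rfl fun a ha => by rw [h1 a (Finset.ne_of_mem_erase ha), if_pos rfl]
  · intro τ _ hτ
    obtain ⟨a, ha, hb⟩ : ∃ a, τ a ≠ l ∧ τ a ≠ a := by
      by_contra! h
      refine hτ (Equiv.ext fun a => ?_)
      by_cases hl : τ a = l
      · by_cases hal : a = l
        · rw [hl, hal]; rfl
        · have h3 : τ l ≠ l := fun e => hal (τ.injective (hl.trans e.symm))
          exact absurd (h l h3) h3
      · exact h a hl
    rw [prod_eq_zero (Finset.mem_univ a) (by rw [h1 _ ha, if_neg hb]), mul_zero]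
  · simp

lemma XF_diag {i : ℕ} (hi : i < n) : ∃ κ : ℝ, κ ≠ 0 ∧ ∀ t w : Fin n → ℝ,
    XF i (Matrix.diagonal t) w = κ * fS i t w := by
  classical
  obtain ⟨N, hN, h⟩ := fib (X := Σ _ : Finset (Fin n), Fin n) (fun σ => ⟨pF (n := n) i σ, σ.symm ⟨i, hi⟩⟩)
    ((powersetCard i univ).sigma fun S => Sᶜ)
    (fun σ => by simp [mem_powersetCard, pF_card hi.le]; simp [pF]) (fun ⟨S, l⟩ hS ⟨S', l'⟩ hS' => by
      simp only [Finset.mem_sigma, mem_powersetCard, mem_compl] at hS hS'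
      obtain ⟨τ, hτ, hl⟩ := TR (hS.1.2.trans hS'.1.2.symm) (iff_of_false hS.2 hS'.2)
      refine ⟨τ.symm, fun σ hσ => ?_⟩
      obtain ⟨h1, h2⟩ := Sigma.mk.inj_iff.1 hσ
      rw [pF_mul, h1, hτ, ← hl, ← eq_of_heq h2]; rfl)
  refine ⟨(n.factorial : ℝ)⁻¹ * N, by positivity, fun t w => ?_⟩
  have h3 := h fun y => (∏ a ∈ y.1, t a) * w y.2 ^ 2
  rw [Finset.sum_sigma] at h3
  simp only [← mul_sum] at h3
  rw [XF, mixedDisc, mul_assoc, fS, ← h3]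
  congr 1
  refine sum_congr rfl fun σ _ => ?_
  obtain ⟨l, hl⟩ : ∃ l, l = σ.symm ⟨i, hi⟩ := ⟨_, rfl⟩
  have hσl : (σ l : ℕ) = i := by rw [hl]; simp
  have hne : ∀ a, a ≠ l → (σ a : ℕ) ≠ i := fun a ha h => ha (σ.injective (Fin.ext (h.trans hσl.symm)))
  rw [det_row (fun a => if (σ a : ℕ) < i then t a else 1) l (fun b => w l * w b) _ (fun a ha b => ?_) (fun b => ?_), ← hl]
  · rw [mul_comm, pow_two, pF, Finset.prod_filter, ← Finset.mul_prod_erase _ _ (Finset.mem_univ l), if_neg (by omega), one_mul]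
  · have := hne a ha
    simp only [of_apply]
    by_cases h1 : (σ a : ℕ) < i
    · simp only [if_pos h1, diagonal_apply]
    · rw [if_neg h1, if_neg h1, if_neg (by omega), Matrix.one_apply]
  · simp [hσl, Matrix.vecMulVec_apply]
end

section
variable {n d k : ℕ} {Ψ : ConvFn n → RadonMeasure n}
lemma diag_ex (hn : 3 ≤ n) (A : PM n) : ∃ (t : Fin n → ℝ) (ρ : Eucl n ≃ₗᵢ[ℝ] Eucl n), (∀ i, 0 ≤ t i) ∧
    LinearMap.det (ρ.toLinearEquiv : Eucl n →ₗ[ℝ] Eucl n) = 1 ∧ ∀ x, ρ (A.1 x) = (dP t).1 (ρ x) := by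
  have hT : (A.1 : Eucl n →ₗ[ℝ] Eucl n).IsSymmetric := fun x y => by
    rw [ContinuousLinearMap.coe_coe, A.2.1, real_inner_comm]
  have hf : Module.finrank ℝ (Eucl n) = n := finrank_euclideanSpace_fin
  obtain ⟨ρ, hρ⟩ : ∃ ρ : Eucl n ≃ₗᵢ[ℝ] Eucl n, ρ = (hT.eigenvectorBasis hf).repr := ⟨_, rfl⟩
  have h1 : ∀ x i, ρ (A.1 x) i = hT.eigenvalues hf i * ρ x i := fun x i => by
    rw [hρ]; exact hT.eigenvectorBasis_apply_self_apply hf x i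
  obtain ⟨t, ht⟩ : ∃ t : Fin n → ℝ, t = hT.eigenvalues hf := ⟨_, rfl⟩
  have h2 : ∀ x i, ρ (A.1 x) i = t i * ρ x i := fun x i => by rw [h1, ht]
  have ht0 : ∀ i, 0 ≤ t i := fun i => by
    have := A.2.2 (ρ.symm (single i 1))
    rw [← ρ.inner_map_map, LinearIsometryEquiv.apply_symm_apply, inner_single_right, h2] at this
    simpa using this
  have h3 : ∀ x, ρ (A.1 x) = (dP t).1 (ρ x) := fun x => by ext i; rw [h2, dP_app ht0]
  rcases iso_det ρ with h | h
  · exact ⟨t, ρ, ht0, h, h3⟩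
  · set u : Eucl n := single ⟨0, by omega⟩ 1 with hu
    refine ⟨t, ρ.trans (rf u), ht0, ?_, fun x => ?_⟩
    · have : ((ρ.trans (rf u)).toLinearEquiv : Eucl n →ₗ[ℝ] Eucl n) =
        ((rf u).toLinearEquiv : Eucl n →ₗ[ℝ] Eucl n) ∘ₗ (ρ.toLinearEquiv : Eucl n →ₗ[ℝ] Eucl n) := rfl
      rw [this, LinearMap.det_comp, h, rf_det (by
        rw [hu]; intro h0; have := congrArg (fun x : Eucl n => x ⟨0, by omega⟩) h0; simp at this)]
      norm_num
    · ext i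
      rw [dP_app ht0]
      simp only [LinearIsometryEquiv.trans_apply, rf_apply, PiLp.sub_apply, PiLp.smul_apply, h2, hu,
        inner_single_left, smul_eq_mul]
      by_cases hi : i = ⟨0, by omega⟩
      · subst hi; simp; ring
      · simp [hi]

lemma P0_gen (hn : 3 ≤ n) (hΨ : MemPdLV d Ψ) (htr : TrInv Ψ) (hrig : IsRigidMotionInvariant Ψ) (hhom : IsHomogeneousDeg k Ψ) :
    ∃ c e : ℕ → ℕ → ℂ, (∀ i j, (min n k < i ∨ min (k - i) d / 2 < j) → c i j = 0) ∧
      (∀ i j, (i = 0 ∨ min (n - 1) k < i ∨ j = 0 ∨ min (k - i) d / 2 < j) → e i j = 0) ∧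
      ∀ (A : PM n) (s : ℝ) (v : Eucl n),
        P0 Ψ A s v = Dn n d k c e s (‖v‖ ^ 2) (fun i => XE i (MM A.1)) (fun i => XF i (MM A.1) v) := by
  obtain ⟨c, e, hc, he, h⟩ := F_form hn hΨ htr hrig hhom
  choose! κ hκ0 hκ using fun (i : ℕ) (hi : i ≤ n) => XE_diag hn hi
  choose! μ hμ0 hμ using fun (i : ℕ) (hi : i < n) => XF_diag hi
  refine ⟨fun i j => c i j / κ i, fun i j => e i j / μ i, fun i j hij => by simp only [hc i j hij, zero_div],
    fun i j hij => by simp only [he i j hij, zero_div], fun A s v => ?_⟩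
  obtain ⟨t, ρ, ht, hdet, hρ⟩ := diag_ex hn A
  rw [P0_rot hrig ρ hdet (A := dP t) (A' := A) s (v := ρ v) (fun x => by
    rw [quadF, quadF, ← hρ, ρ.inner_map_map]) (fun x => (ρ.inner_map_map v x).symm), h t s _ ht, ρ.norm_map]
  have e1 : ∀ i, XE i (MM A.1) = XE i (Matrix.diagonal t) := fun i => by
    rw [Qm_conj ρ hρ, XE_conj _ _ _ (Qm_orth ρ), MM_dP ht]
  have e2 : ∀ i, XF i (MM A.1) v = XF i (Matrix.diagonal t) (ρ v) := fun i => by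
    conv_lhs => rw [← Qm_mulVec ρ v]
    rw [Qm_conj ρ hρ, XF_conj _ _ _ _ (Qm_orth ρ), MM_dP ht]
  unfold Dn
  congr 1
  · refine sum_congr rfl fun i hi => sum_congr rfl fun j _ => ?_
    rw [mem_range] at hi
    have : (κ i : ℂ) ≠ 0 := by exact_mod_cast hκ0 i (by omega)
    dsimp only
    rw [e1, hκ i (by omega)]
    push_cast; field_simp
  · refine sum_congr rfl fun i hi => sum_congr rfl fun j _ => ?_
    rw [mem_Icc] at hi
    have : (μ i : ℂ) ≠ 0 := by exact_mod_cast hμ0 i (by omega)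
    dsimp only
    rw [e2, hμ i (by omega)]
    push_cast; field_simp

lemma gradVec_eq (f : Eucl n → ℝ) (x : Eucl n) : gradVec f x = vG f x := by
  ext i
  rw [gradVec, ← vG_inner, inner_single_right]; simp

lemma gradVec_norm (f : Eucl n → ℝ) (x : Eucl n) : ∑ t, gradVec f x t ^ 2 = ‖vG f x‖ ^ 2 := by
  rw [gradVec_eq, real_norm_sq_eq]

lemma hessMat_eq {f : Eucl n → ℝ} (hf : ContDiff ℝ 2 f) (x : Eucl n) : hessMat f x = MM (aH f x) := by
  have hc1 : ContDiff ℝ 1 (fderiv ℝ f) := hf.fderiv_right (by norm_num)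
  ext i j
  simp only [hessMat, MM, of_apply, aH_inner]
  rw [fderiv_clm_apply (hc1.differentiable (by norm_num) x) (differentiableAt_const _)]
  simp

lemma hessMat_cont {f : Eucl n → ℝ} (hf : ContDiff ℝ 2 f) : Continuous (hessMat f) := by
  have hc2 : Continuous (fderiv ℝ (fderiv ℝ f)) :=
    (hf.fderiv_right (m := 1) (by norm_num)).continuous_fderiv (by norm_num)
  refine continuous_matrix fun i j => ?_
  simp only [hessMat_eq hf, MM, of_apply, aH_inner]
  fun_prop

lemma gradVec_cont {f : Eucl n → ℝ} (hf : ContDiff ℝ 2 f) : Continuous (gradVec f) := by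
  have := hf.continuous_fderiv (by norm_num)
  unfold gradVec
  fun_prop

lemma md_cont {X : Type*} [TopologicalSpace X] {A : X → Fin n → Matrix (Fin n) (Fin n) ℝ}
    (h : ∀ t, Continuous fun x => A x t) : Continuous fun x => mixedDisc (A x) := by
  unfold mixedDisc
  refine continuous_const.mul (continuous_finsetSum _ fun σ _ => Continuous.matrix_det (continuous_matrix fun a b => ?_))
  exact (h (σ a)).matrix_elem a b

lemma XE_cont (i : ℕ) {f : Eucl n → ℝ} (hf : ContDiff ℝ 2 f) : Continuous fun x => XE i (hessMat f x) :=
  md_cont fun t => by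
    split_ifs
    exacts [hessMat_cont hf, continuous_const]

lemma XF_cont (i : ℕ) {f : Eucl n → ℝ} (hf : ContDiff ℝ 2 f) : Continuous fun x => XF i (hessMat f x) (gradVec f x) :=
  md_cont fun t => by
    split_ifs
    exacts [hessMat_cont hf, (gradVec_cont hf).matrix_vecMulVec (gradVec_cont hf), continuous_const]

def Dd (n d k : ℕ) (c e : ℕ → ℕ → ℂ) (f : Eucl n → ℝ) (x : Eucl n) : ℂ :=
  Dn n d k c e (f x) (∑ t, gradVec f x t ^ 2) (fun i => XE i (hessMat f x)) (fun i => XF i (hessMat f x) (gradVec f x))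

lemma Dd_cont (c e : ℕ → ℕ → ℂ) {f : Eucl n → ℝ} (hf : ContDiff ℝ 2 f) : Continuous (Dd n d k c e f) := by
  have h1 := hf.continuous
  have h2 := gradVec_cont hf
  have h3 := fun i => XE_cont i hf
  have h4 := fun i => XF_cont i hf
  unfold Dd Dn
  fun_prop

lemma Dn_int (c e : ℕ → ℕ → ℂ) {f : Eucl n → ℝ} (hf : ContDiff ℝ 2 f) (φ : Cc n) :
    ∫ x, φ x * Dd n d k c e f x =
          (∑ i ∈ range (min n k + 1), ∑ j ∈ range (min (k - i) d / 2 + 1),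
            c i j * Efun (k - 2 * j - i) j i f φ) +
          ∑ i ∈ Finset.Icc 1 (min (n - 1) k), ∑ j ∈ Finset.Icc 1 (min (k - i) d / 2),
            e i j * Ffun (k - 2 * j - i) j i f φ := by
  have h1 := hf.continuous
  have h2 := gradVec_cont hf
  have h3 := fun i => XE_cont i hf
  have h4 := fun i => XF_cont i hf
  have hi : ∀ {g : Eucl n → ℝ}, Continuous g → ∀ c : ℂ, Integrable fun x => c * (φ x * (g x : ℂ)) := fun {g} hg c =>
    ((Continuous.integrable_of_hasCompactSupport (by fun_prop) (φ.hasCompactSupport.mul_right))).const_mul c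
  have hE : ∀ i j, Integrable fun x => c i j * (φ x *
      ((f x ^ (k - 2 * j - i) * (∑ t, gradVec f x t ^ 2) ^ j * XE i (hessMat f x) : ℝ) : ℂ)) := fun i j => hi (by fun_prop) _
  have hF : ∀ i j, Integrable fun x => e i j * (φ x *
      ((f x ^ (k - 2 * j - i) * (∑ t, gradVec f x t ^ 2) ^ (j - 1) * XF i (hessMat f x) (gradVec f x) : ℝ) : ℂ)) :=
    fun i j => hi (by fun_prop) _
  simp only [Dd, Dn, mul_add, mul_sum, mul_left_comm (φ _)]
  rw [integral_add (integrable_finsetSum _ fun i _ => integrable_finsetSum _ fun j _ => hE i j)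
    (integrable_finsetSum _ fun i _ => integrable_finsetSum _ fun j _ => hF i j),
    integral_finsetSum _ (fun i _ => integrable_finsetSum _ fun j _ => hE i j),
    integral_finsetSum _ (fun i _ => integrable_finsetSum _ fun j _ => hF i j)]
  congr 1
  all_goals
    refine sum_congr rfl fun i _ => ?_
    rw [integral_finsetSum _ (fun j _ => by first | exact hE i j | exact hF i j)]
    refine sum_congr rfl fun j _ => ?_
    rw [integral_const_mul]
    rfl

lemma forward (hn : 3 ≤ n) (hΨ : MemPdLV d Ψ) (hrig : IsRigidMotionInvariant Ψ) (hhom : IsHomogeneousDeg k Ψ) :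
    ∃ c e : ℕ → ℕ → ℂ, (∀ i j, (min n k < i ∨ min (k - i) d / 2 < j) → c i j = 0) ∧
      (∀ i j, (i = 0 ∨ min (n - 1) k < i ∨ j = 0 ∨ min (k - i) d / 2 < j) → e i j = 0) ∧
      ∀ f : ConvFn n, ContDiff ℝ 2 f.1 → ∀ φ : Cc n, (Ψ f).1 φ = ∫ x, φ x * Dd n d k c e f.1 x := by
  have htr := trInv_of_rigid hrig
  obtain ⟨c, e, hc, he, h⟩ := P0_gen hn hΨ htr hrig hhom
  refine ⟨c, e, hc, he, fun f hf φ => ?_⟩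
  rw [jet_int hΨ htr (c2_jet f hf)]
  congr 1; funext x
  rw [h, Dd, gradVec_norm, hessMat_eq hf, gradVec_eq]
  rfl
end

section
variable {n d k : ℕ} {Ψ : ConvFn n → RadonMeasure n}
lemma qa_fd (A : PM n) (s : ℝ) (v a : Eucl n) :
    HasFDerivAt (addAffine (qd A) s v).1 (innerSL ℝ (A.1 a + v)) a := by
  have h1 := ((A.1.hasFDerivAt (x := a)).inner ℝ (hasFDerivAt_id a)).const_mul (1 / 2 : ℝ)
  have h2 := h1.add (((innerSL ℝ v).hasFDerivAt (x := a)).const_add s)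
  rw [show ⇑(addAffine (qd A) s v).1 = (fun y => 1 / 2 * ⟪A.1 y, id y⟫) + fun x => s + innerSL ℝ v x from funext fun x => by
    rw [addAffine_apply, qd_apply, quadF]
    simp only [Pi.add_apply, id, innerSL_apply_apply]; ring]
  refine h2.congr_fderiv ?_
  · ext y
    simp only [add_apply, smul_apply, innerSL_apply_apply, inner_add_left, comp_apply,
      fderivInnerCLM_apply, ContinuousLinearMap.prod_apply, id, id_apply, smul_eq_mul]
    rw [A.2.1 y a, real_inner_comm]; ring

lemma qa_fderiv (A : PM n) (s : ℝ) (v : Eucl n) :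
    fderiv ℝ (addAffine (qd A) s v).1 = fun a => innerSL ℝ (A.1 a + v) := funext fun a => (qa_fd A s v a).fderiv

lemma qa_c2 (A : PM n) (s : ℝ) (v : Eucl n) : ContDiff ℝ 2 (addAffine (qd A) s v).1 := by
  refine (contDiff_succ_iff_fderiv (n := 1)).2 ⟨fun a => (qa_fd A s v a).differentiableAt, by simp, ?_⟩
  rw [qa_fderiv]
  exact (innerSL ℝ).contDiff.comp (A.1.contDiff.add contDiff_const)

lemma qa_grad (A : PM n) (s : ℝ) (v : Eucl n) : gradVec (addAffine (qd A) s v).1 0 = v := by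
  ext i
  rw [gradVec, qa_fderiv]
  simp [inner_single_right]

lemma qa_hess (A : PM n) (s : ℝ) (v : Eucl n) : hessMat (addAffine (qd A) s v).1 0 = MM A.1 := by
  ext i j
  simp only [hessMat, MM, of_apply, qa_fderiv]
  have : HasFDerivAt (fun y => (innerSL ℝ (A.1 y + v)) (single j (1 : ℝ)))
      ((innerSL ℝ (single j (1 : ℝ))).comp A.1) 0 := by
    have h := ((innerSL ℝ (single j (1 : ℝ))).hasFDerivAt (x := A.1 0 + v)).comp (0 : Eucl n)
      ((A.1.hasFDerivAt (x := 0)).add_const v)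
    rw [show (fun y => (innerSL ℝ (A.1 y + v)) (single j (1 : ℝ))) =
      ⇑(innerSL ℝ (single j (1 : ℝ))) ∘ fun x => A.1 x + v from funext fun y => by
        simp only [Function.comp, innerSL_apply_apply]; exact real_inner_comm _ _]
    exact h
  rw [this.fderiv, comp_apply, innerSL_apply_apply, real_inner_comm]

lemma pol0 {m : ℕ} {a : ℕ → ℂ} (h : ∀ r : ℝ, ∑ j ∈ range m, a j * ((r : ℂ) ^ 2) ^ j = 0) : ∀ j < m, a j = 0 := by
  intro j hj
  have hp : (∑ j ∈ range m, monomial j (a j)) = 0 := by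
    refine Polynomial.eq_of_infinite_eval_eq _ _ ((infinite_range_of_injective
      (f := fun N : ℕ => ((N ^ 2 : ℕ) : ℂ)) (Nat.cast_injective.comp (Nat.pow_left_injective (by norm_num)))).mono ?_)
    rintro _ ⟨N, rfl⟩
    have := h N
    simp only [mem_ofPred_eq, Polynomial.eval_finsetSum, Polynomial.eval_monomial, Polynomial.eval_zero]
    push_cast at this ⊢
    exact this
  have := congrArg (fun p => Polynomial.coeff p j) hp
  simpa [Polynomial.finsetSum_coeff, Polynomial.coeff_monomial, hj] using this

lemma uniq (hn : 3 ≤ n) {c e : ℕ → ℕ → ℂ} (hc : ∀ i j, (min n k < i ∨ min (k - i) d / 2 < j) → c i j = 0)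
    (he : ∀ i j, (i = 0 ∨ min (n - 1) k < i ∨ j = 0 ∨ min (k - i) d / 2 < j) → e i j = 0)
    (h : ∀ f : ConvFn n, ContDiff ℝ 2 f.1 → ∀ φ : Cc n, ∫ x, φ x * Dd n d k c e f.1 x = 0) :
    (∀ i j, c i j = 0) ∧ ∀ i j, e i j = 0 := by
  choose! κ hκ0 hκ using fun (i : ℕ) (hi : i ≤ n) => XE_diag hn hi
  choose! μ hμ0 hμ using fun (i : ℕ) (hi : i < n) => XF_diag hi
  obtain ⟨c', hc'⟩ : ∃ c' : ℕ → ℕ → ℂ, c' = fun i j => c i j * κ i := ⟨_, rfl⟩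
  obtain ⟨e', he'⟩ : ∃ e' : ℕ → ℕ → ℂ, e' = fun i j => e i j * μ i := ⟨_, rfl⟩
  have hc1 : ∀ i j, (min n k < i ∨ min (k - i) d / 2 < j) → c' i j = 0 := fun i j hij => by rw [hc']; simp [hc i j hij]
  have he1 : ∀ i j, (i = 0 ∨ min (n - 1) k < i ∨ j = 0 ∨ min (k - i) d / 2 < j) → e' i j = 0 :=
    fun i j hij => by rw [he']; simp [he i j hij]
  have h1 : ∀ (t : Fin n → ℝ) (v : Eucl n), (∀ i, 0 ≤ t i) →
      Dn n d k c' e' 1 (∑ l, v l ^ 2) (fun i => eS i t) (fun i => fS i t v) = 0 := by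
    intro t v ht
    have h2 := cc_zero (Dd_cont c e (qa_c2 (dP t) 1 v)) (h _ (qa_c2 (dP t) 1 v))
    rw [Dd, qa_grad, qa_hess, MM_dP ht, addAffine_apply, qd_apply] at h2
    rw [← h2]
    unfold Dn
    simp only [quadF, map_zero, inner_zero_right, zero_div, add_zero, zero_add]
    congr 1
    · refine sum_congr rfl fun i hi => sum_congr rfl fun j _ => ?_
      rw [mem_range] at hi
      rw [hκ i (by omega), hc']
      push_cast; ring
    · refine sum_congr rfl fun i hi => sum_congr rfl fun j _ => ?_
      rw [mem_Icc] at hi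
      rw [hμ i (by omega), he']
      push_cast; ring
  have h2 : ∀ (S : Finset (Fin n)) (v : Eucl n), qS d k c' e' S 1 (∑ l, v l ^ 2) v = 0 := by
    intro S v
    refine moebius0 (q := fun S => qS d k c' e' S 1 (∑ l, v l ^ 2) v) (fun U => ?_) S
    have h3 := h1 (ind U) v (ind_nn U)
    rw [← Dn_sum hc1 he1, ← sum_subset (subset_univ U.powerset)] at h3
    · rw [← h3]
      refine sum_congr rfl fun S hS => ?_
      rw [Finset.prod_eq_one fun i hi => by simp [ind, mem_powerset.1 hS hi], one_mul]
    · intro S _ hS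
      rw [mem_powerset, Finset.not_subset] at hS
      obtain ⟨i, hi, hiU⟩ := hS
      rw [prod_eq_zero hi (by simp [ind, hiU]), zero_mul]
  have h3 : ∀ (S : Finset (Fin n)) (l : Fin n) (r : ℝ), ∑ j ∈ range (min (k - S.card) d / 2 + 1),
      (c' S.card j + (if l ∈ Sᶜ then 1 else 0) * e' S.card j) * ((r : ℂ) ^ 2) ^ j = 0 := by
    intro S l r
    have h4 := h2 S (single l r)
    have e1 : ∑ a, (single l r : Eucl n) a ^ 2 = r ^ 2 := by simp [Pi.single_apply, ite_pow]
    have e2 : ∑ a ∈ Sᶜ, (((single l r : Eucl n) a : ℝ) : ℂ) ^ 2 = (if l ∈ Sᶜ then 1 else 0) * (r : ℂ) ^ 2 := by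
      split_ifs with hl
      · rw [sum_eq_single_of_mem l hl (fun b _ hb => by simp [hb])]; simp
      · rw [sum_eq_zero fun b hb => by simp [show b ≠ l from fun h => hl (h ▸ hb)]]; simp
    rw [qS, e1, e2] at h4
    refine Eq.trans ?_ h4
    simp only [add_mul, sum_add_distrib, Complex.ofReal_one, one_pow, one_mul, ofReal_pow]
    congr 1
    rw [mul_assoc, mul_sum, mul_sum]
    symm
    refine Finset.sum_subset_zero_on_sdiff (fun j hj => ?_) (fun j hj => ?_) (fun j hj => ?_)
    · rw [mem_Icc] at hj; rw [mem_range]; omega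
    · rw [Finset.mem_sdiff, mem_range, mem_Icc] at hj
      rw [he1 _ _ (by omega)]; ring
    · rw [mem_Icc] at hj
      obtain ⟨q, rfl⟩ : ∃ q, j = q + 1 := ⟨j - 1, by omega⟩
      rw [Nat.add_sub_cancel]; ring
  have h4 : ∀ i j, c' i j = 0 ∧ e' i j = 0 := by
    intro i j
    by_cases hj : min (k - i) d / 2 < j
    · exact ⟨hc1 _ _ (by omega), he1 _ _ (by omega)⟩
    by_cases hi : n < i
    · exact ⟨hc1 _ _ (by omega), he1 _ _ (by omega)⟩
    obtain ⟨S, -, hS⟩ := Finset.exists_subset_card_eq (s := (univ : Finset (Fin n))) (n := i) (by simp; omega)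
    have hin : ∀ l ∈ S, c' i j = 0 := fun l hl => by
      have := pol0 (h3 S l) j (by omega)
      rw [hS] at this
      simpa [hl] using this
    have hout : ∀ l, l ∉ S → c' i j + e' i j = 0 := fun l hl => by
      have := pol0 (h3 S l) j (by omega)
      rw [hS] at this
      simpa [hl] using this
    by_cases h0 : i = 0
    · have h5 := he1 i j (by omega)
      refine ⟨?_, h5⟩
      have := hout ⟨0, by omega⟩ (by rw [card_eq_zero.1 (hS.trans h0)]; simp)
      rwa [h5, add_zero] at this
    · obtain ⟨l, hl⟩ := card_pos.1 (by omega : 0 < S.card)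
      have h5 := hin l hl
      refine ⟨h5, ?_⟩
      by_cases h6 : n - 1 < i
      · exact he1 _ _ (by omega)
      obtain ⟨l', hl'⟩ : ∃ l', l' ∉ S := by
        by_contra! h
        have := Finset.card_eq_iff_eq_univ S |>.2 (Finset.eq_univ_of_forall h)
        simp at this; omega
      have := hout l' hl'
      rwa [h5, zero_add] at this
  refine ⟨fun i j => ?_, fun i j => ?_⟩
  · by_cases hi : n < i
    · exact hc _ _ (by omega)
    · have := (h4 i j).1
      rw [hc'] at this
      exact (mul_eq_zero.1 this).resolve_right (by exact_mod_cast hκ0 i (by omega))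
  · by_cases hi : n - 1 < i
    · exact he _ _ (by omega)
    · have := (h4 i j).2
      rw [he'] at this
      exact (mul_eq_zero.1 this).resolve_right (by exact_mod_cast hμ0 i (by omega))
end

section
variable {n d k : ℕ} {Ψ : ConvFn n → RadonMeasure n}
section rig
variable {f : Eucl n → ℝ} (ρ : Eucl n ≃ₗᵢ[ℝ] Eucl n) (x₀ : Eucl n)

lemma rg_fd {F : Type*} [NormedAddCommGroup F] [NormedSpace ℝ F] {g : Eucl n → F} (hg : Differentiable ℝ g) (x y : Eucl n) :
    fderiv ℝ (fun x => g (ρ x + x₀)) x y = fderiv ℝ g (ρ x + x₀) (ρ y) := by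
  have h : HasFDerivAt (fun x => ρ x + x₀) (ρ.toContinuousLinearEquiv : Eucl n →L[ℝ] Eucl n) x :=
    (ρ.toContinuousLinearEquiv.hasFDerivAt).add_const x₀
  have h2 := ((hg (ρ x + x₀)).hasFDerivAt).comp x h
  have h3 : fderiv ℝ (fun x => g (ρ x + x₀)) x = _ := h2.fderiv
  rw [h3]; rfl

lemma rg_vG (hf : ContDiff ℝ 2 f) (x : Eucl n) : ρ (vG (fun x => f (ρ x + x₀)) x) = vG f (ρ x + x₀) := by
  refine ext_inner_right ℝ fun y => ?_
  obtain ⟨z, rfl⟩ := ρ.surjective y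
  rw [ρ.inner_map_map, vG_inner, vG_inner, rg_fd ρ x₀ (hf.differentiable (by norm_num))]

lemma rg_aH (hf : ContDiff ℝ 2 f) (x w : Eucl n) : ρ (aH (fun x => f (ρ x + x₀)) x w) = aH f (ρ x + x₀) (ρ w) := by
  refine ext_inner_right ℝ fun y => ?_
  obtain ⟨z, rfl⟩ := ρ.surjective y
  rw [ρ.inner_map_map, aH_inner, aH_inner]
  have hd : Differentiable ℝ (fderiv ℝ f) := (hf.fderiv_right (m := 1) (by norm_num)).differentiable (by norm_num)
  have h1 : Differentiable ℝ fun x => f (ρ x + x₀) :=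
    (hf.differentiable (by norm_num)).comp (ρ.toContinuousLinearEquiv.differentiable.add_const x₀)
  have h2 : fderiv ℝ (fun x => f (ρ x + x₀)) = fun x =>
      (fderiv ℝ f (ρ x + x₀)).comp (ρ.toContinuousLinearEquiv : Eucl n →L[ℝ] Eucl n) := by
    funext x; ext y; exact rg_fd ρ x₀ (hf.differentiable (by norm_num)) x y
  have h3 : fderiv ℝ (fderiv ℝ fun x => f (ρ x + x₀)) x w z = fderiv ℝ (fun x => fderiv ℝ f (ρ x + x₀)) x w (ρ z) := by
    rw [h2, fderiv_clm_comp ?_ (differentiableAt_const _)]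
    · simp
    · exact (hd.comp (ρ.toContinuousLinearEquiv.differentiable.add_const x₀)) x
  rw [h3, rg_fd ρ x₀ hd]

lemma rg_c2 (hf : ContDiff ℝ 2 f) : ContDiff ℝ 2 fun x => f (ρ x + x₀) :=
  hf.comp (ρ.toContinuousLinearEquiv.contDiff.add contDiff_const)

lemma rg_Dd (hf : ContDiff ℝ 2 f) (c e : ℕ → ℕ → ℂ) (x : Eucl n) :
    Dd n d k c e (fun x => f (ρ x + x₀)) x = Dd n d k c e f (ρ x + x₀) := by
  unfold Dd
  rw [gradVec_norm, gradVec_norm, hessMat_eq (rg_c2 ρ x₀ hf), hessMat_eq hf, Qm_conj ρ (rg_aH ρ x₀ hf x),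
    gradVec_eq, gradVec_eq, ← rg_vG ρ x₀ hf x, ρ.norm_map, ← Qm_mulVec ρ (vG (fun x => f (ρ x + x₀)) x)]
  simp only [XE_conj _ _ _ (Qm_orth ρ), XF_conj _ _ _ _ (Qm_orth ρ)]
end rig

lemma rg_int (ρ : Eucl n ≃ₗᵢ[ℝ] Eucl n) (x₀ : Eucl n) (g : Eucl n → ℂ) : ∫ x, g (ρ x + x₀) = ∫ x, g x := by
  rw [ρ.measurePreserving.integral_comp ρ.toHomeomorph.measurableEmbedding (fun y => g (y + x₀)), integral_add_right_eq_self]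

lemma rg_continuous (ρ : Eucl n ≃ₗᵢ[ℝ] Eucl n) (x₀ : Eucl n) : Continuous (rigidComp ρ x₀) := by
  refine Continuous.subtype_mk ?_ _
  exact (ContinuousMap.continuous_precomp ⟨fun x => ρ x + x₀, by fun_prop⟩).comp continuous_subtype_val

lemma mollify (f : ConvFn n) (ε : ℝ) (hε : 0 < ε) : ∃ g : ConvFn n, ContDiff ℝ 2 g.1 ∧
    ∀ x δ, (∀ y, ‖y - x‖ < ε → |f.1 y - f.1 x| ≤ δ) → |g.1 x - f.1 x| ≤ δ := by
  let b : ContDiffBump (0 : Eucl n) := ⟨ε / 2, ε, by positivity, by linarith⟩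
  have hf := map_continuous f.1
  have hc : ContDiff ℝ 2 (convolution (b.normed volume) f.1 (ContinuousLinearMap.lsmul ℝ ℝ) volume) :=
    b.hasCompactSupport_normed.contDiff_convolution_left _ b.contDiff_normed hf.locallyIntegrable
  have hi : ∀ x, Integrable fun t => b.normed volume t * f.1 (x - t) := fun x => by
    refine Continuous.integrable_of_hasCompactSupport ?_ b.hasCompactSupport_normed.mul_right
    have : Continuous (b.normed (volume : Measure (Eucl n))) := b.continuous_normed
    fun_prop
  refine ⟨⟨⟨_, hc.continuous⟩, convex_univ, fun x _ y _ p q hp hq hpq => ?_⟩, hc, fun x δ h => ?_⟩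
  · simp only [ContinuousMap.coe_mk, convolution, ContinuousLinearMap.lsmul_apply, smul_eq_mul]
    rw [← integral_const_mul, ← integral_const_mul, ← integral_add ((hi x).const_mul p) ((hi y).const_mul q)]
    refine integral_mono (hi _) (((hi x).const_mul p).add ((hi y).const_mul q)) fun t => ?_
    have h1 := f.2.2 (mem_univ (x - t)) (mem_univ (y - t)) hp hq hpq
    rw [show p • (x - t) + q • (y - t) = p • x + q • y - t by
      rw [smul_sub, smul_sub, sub_add_sub_comm, ← add_smul, hpq, one_smul]] at h1
    have h2 := mul_le_mul_of_nonneg_left h1 (b.nonneg_normed (μ := volume) t)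
    simp only [smul_eq_mul] at h2
    linarith
  · have := b.dist_normed_convolution_le (μ := volume) (g := f.1) (x₀ := x) (ε := δ) hf.aestronglyMeasurable
      (fun y hy => by rw [dist_eq]; exact h y (by rwa [mem_ball, dist_eq_norm] at hy))
    rwa [dist_eq] at this

lemma smooth_seq (f : ConvFn n) : ∃ g : ℕ → ConvFn n, (∀ j, ContDiff ℝ 2 (g j).1) ∧ Tendsto g atTop (𝓝 f) := by
  choose g h1 h2 using fun j : ℕ => mollify f (1 / ((j : ℝ) + 1)) (by positivity)
  refine ⟨g, h1, conv_tendsto_of fun R hR ε hε => ?_⟩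
  have hu := (isCompact_closedBall (0 : Eucl n) (R + 1)).uniformContinuousOn_of_continuous (map_continuous f.1).continuousOn
  rw [Metric.uniformContinuousOn_iff] at hu
  obtain ⟨δ, hδ, hu⟩ := hu ε hε
  obtain ⟨N, hN⟩ := exists_nat_one_div_lt hδ
  filter_upwards [eventually_ge_atTop N] with j hj x hx
  refine h2 j x ε fun y hy => ?_
  have hj1 : 1 / ((j : ℝ) + 1) ≤ 1 / ((N : ℝ) + 1) := one_div_le_one_div_of_le (by positivity) (by gcongr)
  have hj2 : 1 / ((j : ℝ) + 1) ≤ 1 := by rw [div_le_one (by positivity)]; linarith [cast_nonneg (α := ℝ) j]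
  have h3 := norm_add_le (y - x) x
  rw [sub_add_cancel] at h3
  have := hu y (by rw [mem_closedBall_zero_iff]; linarith) x (by rw [mem_closedBall_zero_iff]; linarith)
    (by rw [dist_eq_norm]; linarith)
  rw [dist_eq] at this
  exact this.le

lemma reverse (hΨ : IsContinuousFunctional Ψ) (c e : ℕ → ℕ → ℂ)
    (h : ∀ f : ConvFn n, ContDiff ℝ 2 f.1 → ∀ φ : Cc n, (Ψ f).1 φ = ∫ x, φ x * Dd n d k c e f.1 x) :
    IsRigidMotionInvariant Ψ := by
  intro ρ _ x₀ f φ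
  have h1 : ∀ f : ConvFn n, ContDiff ℝ 2 f.1 → (Ψ (rigidComp ρ x₀ f)).1 (rigidCompCc ρ x₀ φ) = (Ψ f).1 φ := by
    intro f hf
    rw [h f hf, h _ (rg_c2 ρ x₀ hf), ← rg_int ρ x₀ fun x => φ x * Dd n d k c e f.1 x]
    congr 1; funext x
    exact congrArg (φ (ρ x + x₀) * ·) (rg_Dd ρ x₀ hf c e x)
  obtain ⟨g, hg, ht⟩ := smooth_seq f
  have h2 := ((hΨ (rigidCompCc ρ x₀ φ)).comp (rg_continuous ρ x₀)).tendsto f |>.comp ht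
  have h3 := (hΨ φ).tendsto f |>.comp ht
  refine tendsto_nhds_unique h2 (h3.congr fun j => (h1 (g j) (hg j)).symm)

lemma Dd_sub (c e c' e' : ℕ → ℕ → ℂ) (f : Eucl n → ℝ) (x : Eucl n) :
    Dd n d k (fun i j => c i j - c' i j) (fun i j => e i j - e' i j) f x = Dd n d k c e f x - Dd n d k c' e' f x := by
  simp only [Dd, Dn, sub_mul, sum_sub_distrib]
  ring
end

end aux

/-- For `n ≥ 3`, a `k`-homogeneous `Ψ ∈ P_dLV_k(ℝⁿ)` is rigid motion
invariant if and only if it is a linear combination, with unique coefficients, of the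
functionals `E^{k−2j−i,j}_i` (`0 ≤ i ≤ min(n,k)`, `0 ≤ j ≤ ⌊min(k−i,d)/2⌋`) and
`F^{k−2j−i,j}_i` (`1 ≤ i ≤ min(n−1,k)`, `1 ≤ j ≤ ⌊min(k−i,d)/2⌋`). -/
theorem rigid_motion_invariant_classification {n d k : ℕ} (hn : 3 ≤ n)
    (Ψ : ConvFn n → RadonMeasure n) (hΨ : MemPdLV d Ψ) (hhom : IsHomogeneousDeg k Ψ) :
    IsRigidMotionInvariant Ψ ↔
    ∃! cd : (ℕ → ℕ → ℂ) × (ℕ → ℕ → ℂ),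
      (∀ i j, (min n k < i ∨ min (k - i) d / 2 < j) → cd.1 i j = 0) ∧
      (∀ i j, (i = 0 ∨ min (n - 1) k < i ∨ j = 0 ∨ min (k - i) d / 2 < j) → cd.2 i j = 0) ∧
      ∀ f : ConvFn n, ContDiff ℝ 2 ⇑f.1 → ∀ φ : C_c(Eucl n, ℂ),
        (Ψ f).1 φ =
          (∑ i ∈ Finset.range (min n k + 1), ∑ j ∈ Finset.range (min (k - i) d / 2 + 1),
            cd.1 i j * Efun (k - 2 * j - i) j i (⇑f.1) φ) +
          ∑ i ∈ Finset.Icc 1 (min (n - 1) k), ∑ j ∈ Finset.Icc 1 (min (k - i) d / 2),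
            cd.2 i j * Ffun (k - 2 * j - i) j i (⇑f.1) φ := by
  constructor
  · intro hrig
    obtain ⟨c, e, hc, he, h⟩ := forward hn hΨ hrig hhom
    refine ⟨(c, e), ⟨hc, he, fun f hf φ => by rw [h f hf, Dn_int c e hf]⟩, ?_⟩
    rintro ⟨c', e'⟩ ⟨hc', he', h'⟩
    obtain ⟨u1, u2⟩ := uniq (d := d) (k := k) hn (c := fun i j => c' i j - c i j) (e := fun i j => e' i j - e i j)
      (fun i j hij => by rw [hc i j hij, show c' i j = 0 from hc' i j hij, sub_zero])
      (fun i j hij => by rw [he i j hij, show e' i j = 0 from he' i j hij, sub_zero]) (fun f hf φ => by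
        have hi : ∀ c e : ℕ → ℕ → ℂ, MeasureTheory.Integrable fun x => φ x * Dd n d k c e f.1 x := fun c e =>
          (φ.continuous.mul (Dd_cont c e hf)).integrable_of_hasCompactSupport φ.hasCompactSupport'.mul_right
        simp only [Dd_sub, mul_sub]
        rw [integral_sub (hi c' e') (hi c e), ← h f hf, Dn_int c' e' hf, h' f hf, sub_self])
    exact Prod.ext (funext fun i => funext fun j => sub_eq_zero.1 (u1 i j))
      (funext fun i => funext fun j => sub_eq_zero.1 (u2 i j))
  · rintro ⟨⟨c, e⟩, ⟨-, -, h⟩, -⟩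
    exact reverse (d := d) (k := k) hΨ.2.1 c e fun f hf φ => by rw [h f hf, Dn_int c e hf]

end
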